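/- Minimum bisection of random regular graphs: for every ε > 0 there exists an integer γ₀ such that for every integer γ ≥ γ₀, if R_n(γ) is a uniformly random simple γ-regular graph on n vertices, then P( |mcut(R_n(γ))/n − (γ/4 − P_*·√(γ/4))| ≤ ε·√γ ) → 1 as n → ∞ along even n > γ. (That is, w.h.p. mcut(R_n(γ))/n = γ/4 − P_*√(γ/4) + o_γ(√γ).) -/

import Mathlib

open MeasureTheory Filter Finset

/-- The real value (±1) of a Boolean spin. -/
noncomputable def spin (b : Bool) : ℝ := if b then 1 else -1

/-- The Sherrington–Kirkpatrick Hamiltonian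
`H^SK_n(σ) = -(2n)^{-1/2} Σ_{i,j} J_{ij} σ_i σ_j`. -/
noncomputable def HSK (n : ℕ) (J : Fin n × Fin n → ℝ) (σ : Fin n → Bool) : ℝ :=
  -(Real.sqrt (2 * n))⁻¹ * ∑ p : Fin n × Fin n, J p * spin (σ p.1) * spin (σ p.2)

/-- The law of the i.i.d. standard Gaussian couplings `(J_{ij})`. -/
noncomputable def skMeasure (n : ℕ) : Measure ((Fin n × Fin n) → ℝ) :=
  Measure.pi fun _ => ProbabilityTheory.gaussianReal 0 1

open Classical in
/-- The cut size of the partition `(S, Sᶜ)` in the graph `G`. -/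
noncomputable def cutSize {n : ℕ} (G : SimpleGraph (Fin n)) (S : Finset (Fin n)) : ℕ :=
  ∑ i ∈ S, ∑ j ∈ Sᶜ, if G.Adj i j then 1 else 0

/-- `S` induces a bisection: the sizes of the two parts differ by at most one. -/
def IsBisection {n : ℕ} (S : Finset (Fin n)) : Prop :=
  (n : ℤ) - 1 ≤ 2 * S.card ∧ (2 * S.card : ℤ) ≤ n + 1

/-- Minimum bisection size. -/
noncomputable def mcut {n : ℕ} (G : SimpleGraph (Fin n)) : ℕ :=
  sInf {k : ℕ | ∃ S : Finset (Fin n), IsBisection S ∧ cutSize G S = k}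

/-- Probability that a uniformly random element of the (finite) set `A`
lies in the set `B`. -/
noncomputable def probUniform {α : Type*} (A B : Set α) : ℝ :=
  ((A ∩ B).ncard : ℝ) / (A.ncard : ℝ)


namespace RB

/-! ### Finite averages -/

/-- Average of a real function over a finite type. -/
noncomputable def ev {α : Type*} [Fintype α] (f : α → ℝ) : ℝ := (∑ x, f x) / (Fintype.card α : ℝ)

section ev
variable {α β : Type*} [Fintype α] [Fintype β]

lemma ev_add (f g : α → ℝ) : ev (fun x => f x + g x) = ev f + ev g := by
  simp [ev, Finset.sum_add_distrib, add_div]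

lemma ev_sub (f g : α → ℝ) : ev (fun x => f x - g x) = ev f - ev g := by
  simp [ev, Finset.sum_sub_distrib, sub_div]

lemma ev_neg (f : α → ℝ) : ev (fun x => - f x) = - ev f := by
  simp [ev, neg_div]

lemma ev_mul (c : ℝ) (f : α → ℝ) : ev (fun x => c * f x) = c * ev f := by
  simp [ev, ← Finset.mul_sum, mul_div_assoc]

lemma ev_sum {ι : Type*} (s : Finset ι) (f : ι → α → ℝ) :
    ev (fun x => ∑ i ∈ s, f i x) = ∑ i ∈ s, ev (f i) := by
  simp only [ev]
  rw [Finset.sum_comm, Finset.sum_div]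

lemma ev_mono {f g : α → ℝ} (h : ∀ x, f x ≤ g x) : ev f ≤ ev g := by
  unfold ev
  gcongr
  exact h _

lemma ev_const [Nonempty α] (c : ℝ) : ev (fun _ : α => c) = c := by
  have : (Fintype.card α : ℝ) ≠ 0 := by exact_mod_cast Fintype.card_ne_zero
  simp [ev]

lemma ev_le_const [Nonempty α] {f : α → ℝ} {c : ℝ} (h : ∀ x, f x ≤ c) : ev f ≤ c := by
  simpa [ev_const] using ev_mono h

lemma const_le_ev [Nonempty α] {f : α → ℝ} {c : ℝ} (h : ∀ x, c ≤ f x) : c ≤ ev f := by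
  simpa [ev_const] using ev_mono h

lemma abs_ev_le (f : α → ℝ) : |ev f| ≤ ev (fun x => |f x|) := by
  unfold ev
  rw [abs_div, Nat.abs_cast]
  gcongr
  exact Finset.abs_sum_le_sum_abs _ _

lemma ev_equiv (e : α ≃ β) (f : β → ℝ) : ev (fun x => f (e x)) = ev f := by
  unfold ev
  rw [Fintype.card_congr e, Equiv.sum_comp e f]

lemma ev_prod (f : α × β → ℝ) : ev f = ev (fun a => ev (fun b => f (a, b))) := by
  unfold ev
  rw [Fintype.sum_prod_type, Fintype.card_prod, ← Finset.sum_div, div_div]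
  push_cast
  ring_nf

lemma ev_nonneg {f : α → ℝ} (h : ∀ x, 0 ≤ f x) : 0 ≤ ev f := by
  unfold ev
  have := Finset.sum_nonneg (s := univ) (fun x _ => h x)
  positivity

end ev

/-! ### Soft maximum and Gibbs averages -/

section gibbs
variable {B : Type*} [Fintype B]

noncomputable def Zs (β : ℝ) (y : B → ℝ) : ℝ := ∑ σ, Real.exp (β * y σ)
noncomputable def gib (β : ℝ) (y : B → ℝ) (v : B → ℝ) : ℝ :=
  (∑ σ, v σ * Real.exp (β * y σ)) / Zs β y
noncomputable def Phi (β : ℝ) (y : B → ℝ) : ℝ := Real.log (Zs β y) / β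

lemma Zs_pos [Nonempty B] (β : ℝ) (y : B → ℝ) : 0 < Zs β y :=
  Finset.sum_pos (fun _ _ => Real.exp_pos _) univ_nonempty

lemma gib_const [Nonempty B] (β : ℝ) (y : B → ℝ) (c : ℝ) : gib β y (fun _ => c) = c := by
  unfold gib
  rw [← Finset.mul_sum]
  have := (Zs_pos β y).ne'
  change c * Zs β y / Zs β y = c
  field_simp

lemma gib_add (β : ℝ) (y v w : B → ℝ) :
    gib β y (fun σ => v σ + w σ) = gib β y v + gib β y w := by
  simp [gib, add_mul, Finset.sum_add_distrib, add_div]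

lemma gib_sub (β : ℝ) (y v w : B → ℝ) :
    gib β y (fun σ => v σ - w σ) = gib β y v - gib β y w := by
  simp [gib, sub_mul, Finset.sum_sub_distrib, sub_div]

lemma gib_mul (β : ℝ) (y : B → ℝ) (c : ℝ) (v : B → ℝ) :
    gib β y (fun σ => c * v σ) = c * gib β y v := by
  simp [gib, mul_assoc, ← Finset.mul_sum, mul_div_assoc]

lemma gib_sum {ι : Type*} (s : Finset ι) (β : ℝ) (y : B → ℝ) (v : ι → B → ℝ) :
    gib β y (fun σ => ∑ i ∈ s, v i σ) = ∑ i ∈ s, gib β y (v i) := by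
  simp only [gib, Finset.sum_mul]
  rw [Finset.sum_comm, Finset.sum_div]

lemma gib_mono [Nonempty B] (β : ℝ) (y : B → ℝ) {v w : B → ℝ} (h : ∀ σ, v σ ≤ w σ) :
    gib β y v ≤ gib β y w := by
  unfold gib
  have := (Zs_pos β y).le
  gcongr
  exact h _

lemma abs_gib_le [Nonempty B] (β : ℝ) (y : B → ℝ) {v : B → ℝ} {K : ℝ} (h : ∀ σ, |v σ| ≤ K) :
    |gib β y v| ≤ K := by
  rw [abs_le]
  constructor
  · rw [← gib_const β y (-K)]
    exact gib_mono β y fun σ => (abs_le.1 (h σ)).1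
  · rw [← gib_const β y K]
    exact gib_mono β y fun σ => (abs_le.1 (h σ)).2

lemma le_Phi [Nonempty B] {β : ℝ} (hβ : 0 < β) (y : B → ℝ) (σ : B) : y σ ≤ Phi β y := by
  unfold Phi
  rw [le_div_iff₀ hβ, Real.le_log_iff_exp_le (Zs_pos β y), mul_comm]
  exact Finset.single_le_sum (f := fun σ => Real.exp (β * y σ))
    (fun _ _ => (Real.exp_pos _).le) (mem_univ σ)

lemma Phi_le [Nonempty B] {β : ℝ} (hβ : 0 < β) (y : B → ℝ) {m : ℝ} (h : ∀ σ, y σ ≤ m) :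
    Phi β y ≤ m + Real.log (Fintype.card B) / β := by
  unfold Phi
  have hc : (0 : ℝ) < Fintype.card B := by exact_mod_cast Fintype.card_pos
  rw [div_le_iff₀ hβ, add_mul, div_mul_cancel₀ _ hβ.ne', Real.log_le_iff_le_exp (Zs_pos β y),
    Real.exp_add, Real.exp_log hc]
  unfold Zs
  calc ∑ σ, Real.exp (β * y σ) ≤ ∑ σ : B, Real.exp (m * β) := by
        refine Finset.sum_le_sum fun σ _ => Real.exp_le_exp.2 ?_
        rw [mul_comm m]
        exact mul_le_mul_of_nonneg_left (h σ) hβ.le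
    _ = _ := by simp [mul_comm]

lemma hasDerivAt_Zs (β : ℝ) {y : ℝ → B → ℝ} {y' : B → ℝ} {t : ℝ} (v : B → ℝ)
    (h : ∀ σ, HasDerivAt (fun t => y t σ) (y' σ) t) :
    HasDerivAt (fun t => ∑ σ, v σ * Real.exp (β * y t σ))
      (β * ∑ σ, (v σ * y' σ) * Real.exp (β * y t σ)) t := by
  have : HasDerivAt (fun t => ∑ σ, v σ * Real.exp (β * y t σ))
      (∑ σ, v σ * (Real.exp (β * y t σ) * (β * y' σ))) t :=
    HasDerivAt.fun_sum fun σ _ => (((h σ).const_mul β).exp).const_mul (v σ)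
  convert this using 1
  rw [Finset.mul_sum]
  exact Finset.sum_congr rfl fun σ _ => by ring

lemma hasDerivAt_gib [Nonempty B] (β : ℝ) {y : ℝ → B → ℝ} {y' : B → ℝ} {t : ℝ} (v : B → ℝ)
    (h : ∀ σ, HasDerivAt (fun t => y t σ) (y' σ) t) :
    HasDerivAt (fun t => gib β (y t) v)
      (β * (gib β (y t) (fun σ => v σ * y' σ) - gib β (y t) v * gib β (y t) y')) t := by
  have h1 := hasDerivAt_Zs β v h
  have h2 := hasDerivAt_Zs β (fun _ => 1) h
  simp only [one_mul] at h2
  have hz : (∑ σ, Real.exp (β * y t σ)) ≠ 0 := (Zs_pos β (y t)).ne'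
  have h3 := h1.fun_div h2 hz
  refine h3.congr_deriv ?_
  unfold gib Zs
  field_simp

lemma hasDerivAt_Phi [Nonempty B] {β : ℝ} (hβ : 0 < β) {y : ℝ → B → ℝ} {y' : B → ℝ} {t : ℝ}
    (h : ∀ σ, HasDerivAt (fun t => y t σ) (y' σ) t) :
    HasDerivAt (fun t => Phi β (y t)) (gib β (y t) y') t := by
  have h2 := hasDerivAt_Zs β (fun _ => 1) h
  simp only [one_mul] at h2
  have hz : (∑ σ, Real.exp (β * y t σ)) ≠ 0 := (Zs_pos β (y t)).ne'
  refine ((h2.log hz).div_const β).congr_deriv ?_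
  unfold gib Zs
  field_simp

/-- Second order Taylor estimate for Gibbs averages. -/
lemma gib_taylor [Nonempty B] {β : ℝ} (hβ : 0 ≤ β) (y v : B → ℝ) {K h : ℝ} (hh : 0 ≤ h)
    (hv : ∀ σ, |v σ| ≤ K) :
    |gib β (fun σ => y σ + h * v σ) v - gib β y v
      - h * (β * (gib β y (fun σ => v σ * v σ) - gib β y v * gib β y v))|
      ≤ 6 * β ^ 2 * K ^ 3 * h ^ 2 := by
  have hK : 0 ≤ K := (abs_nonneg _).trans (hv (Classical.arbitrary B))
  set Y : ℝ → B → ℝ := fun t σ => y σ + t * v σ with hY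
  have hYd : ∀ t σ, HasDerivAt (fun t => Y t σ) (v σ) t := fun t σ => by
    simpa [hY] using ((hasDerivAt_id t).mul_const (v σ)).const_add (y σ)
  have hY0 : Y 0 = y := by simp [hY]
  set k1 : ℝ → ℝ := fun t => β * (gib β (Y t) (fun σ => v σ * v σ) - gib β (Y t) v * gib β (Y t) v)
    with hk1
  have hk : ∀ t, HasDerivAt (fun t => gib β (Y t) v) (k1 t) t := fun t =>
    hasDerivAt_gib β v (hYd t)
  have b1 : ∀ t, |gib β (Y t) v| ≤ K := fun t => abs_gib_le _ _ hv
  have b2 : ∀ t, |gib β (Y t) (fun σ => v σ * v σ)| ≤ K ^ 2 := fun t => abs_gib_le _ _ fun σ => by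
    rw [abs_mul, sq]; exact mul_le_mul (hv σ) (hv σ) (abs_nonneg _) hK
  have b3 : ∀ t, |gib β (Y t) (fun σ => v σ * v σ * v σ)| ≤ K ^ 3 := fun t =>
    abs_gib_le _ _ fun σ => by
      rw [abs_mul, abs_mul, pow_succ, sq]
      have := hv σ
      have := abs_nonneg (v σ)
      gcongr
  set k2 : ℝ → ℝ := fun t => β * ((β * (gib β (Y t) (fun σ => v σ * v σ * v σ)
      - gib β (Y t) (fun σ => v σ * v σ) * gib β (Y t) v))
      - (k1 t * gib β (Y t) v + gib β (Y t) v * k1 t)) with hk2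
  have hk' : ∀ t, HasDerivAt k1 (k2 t) t := fun t =>
    ((hasDerivAt_gib β (fun σ => v σ * v σ) (hYd t)).fun_sub ((hk t).fun_mul (hk t))).const_mul β
  have bk1 : ∀ t, |k1 t| ≤ β * (2 * K ^ 2) := fun t => by
    simp only [hk1, abs_mul, abs_of_nonneg hβ]
    gcongr
    refine (abs_sub _ _).trans ?_
    have := mul_le_mul (b1 t) (b1 t) (abs_nonneg _) hK
    rw [abs_mul]
    nlinarith [b2 t]
  have bk2 : ∀ t, |k2 t| ≤ 6 * β ^ 2 * K ^ 3 := fun t => by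
    have e1 : |gib β (Y t) (fun σ => v σ * v σ) * gib β (Y t) v| ≤ K ^ 2 * K := by
      rw [abs_mul]; exact mul_le_mul (b2 t) (b1 t) (abs_nonneg _) (by positivity)
    have e2 : |k1 t * gib β (Y t) v| ≤ β * (2 * K ^ 2) * K := by
      rw [abs_mul]; exact mul_le_mul (bk1 t) (b1 t) (abs_nonneg _) (by positivity)
    have e3 : |β * (gib β (Y t) (fun σ => v σ * v σ * v σ)
      - gib β (Y t) (fun σ => v σ * v σ) * gib β (Y t) v)| ≤ β * (2 * K ^ 3) := by
      rw [abs_mul, abs_of_nonneg hβ]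
      gcongr
      refine (abs_sub _ _).trans ?_
      nlinarith [b3 t]
    simp only [hk2]
    rw [abs_mul, abs_of_nonneg hβ]
    have : |β * (gib β (Y t) (fun σ => v σ * v σ * v σ)
      - gib β (Y t) (fun σ => v σ * v σ) * gib β (Y t) v)
      - (k1 t * gib β (Y t) v + gib β (Y t) v * k1 t)| ≤ 6 * β * K ^ 3 := by
      refine (abs_sub _ _).trans ?_
      have e4 : |k1 t * gib β (Y t) v + gib β (Y t) v * k1 t| ≤ 2 * (β * (2 * K ^ 2) * K) := by
        rw [mul_comm (gib β (Y t) v) (k1 t)]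
        refine (abs_add_le _ _).trans ?_
        linarith
      nlinarith
    nlinarith [mul_le_mul_of_nonneg_left this hβ]
  have c1 : ∀ t ∈ Set.Icc (0:ℝ) h, |k1 t - k1 0| ≤ 6 * β ^ 2 * K ^ 3 * h := fun t ht => by
    have := Convex.norm_image_sub_le_of_norm_hasDerivWithin_le (f := k1) (f' := k2)
      (s := Set.univ) (x := 0) (y := t) (C := 6 * β ^ 2 * K ^ 3)
      (fun x _ => (hk' x).hasDerivWithinAt) (fun x _ => bk2 x) convex_univ trivial trivial
    simp only [Real.norm_eq_abs, sub_zero] at this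
    refine this.trans ?_
    rw [abs_of_nonneg ht.1]
    have := ht.2
    gcongr
  have c2 := Convex.norm_image_sub_le_of_norm_hasDerivWithin_le
      (f := fun t => gib β (Y t) v - t * k1 0) (f' := fun t => k1 t - k1 0)
      (s := Set.Icc 0 h) (x := 0) (y := h) (C := 6 * β ^ 2 * K ^ 3 * h)
      (fun x _ => by
        have := (hk x).fun_sub ((hasDerivAt_id x).mul_const (k1 0))
        simpa using this.hasDerivWithinAt)
      (fun x hx => by simpa using c1 x hx) (convex_Icc _ _) ⟨le_rfl, hh⟩ ⟨hh, le_rfl⟩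
  simp only [Real.norm_eq_abs, sub_zero, zero_mul, abs_of_nonneg hh] at c2
  have e : gib β (fun σ => y σ + h * v σ) v - gib β y v
      - h * (β * (gib β y (fun σ => v σ * v σ) - gib β y v * gib β y v))
      = gib β (Y h) v - h * k1 0 - gib β (Y 0) v := by
    simp only [hk1, hY0]
    simp only [hY]
    ring
  rw [e]
  calc _ ≤ _ := c2
    _ = _ := by ring

end gibbs

end RB


namespace RB

/-! ### Concentration for Lipschitz functions of a uniform permutation -/

section jensen
variable {α : Type*} [Fintype α] [Nonempty α]

lemma exp_ev_le (f : α → ℝ) : Real.exp (ev f) ≤ ev (fun x => Real.exp (f x)) := by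
  have h : ∀ x, Real.exp (ev f) * (f x - ev f + 1) ≤ Real.exp (f x) := fun x => by
    have := Real.add_one_le_exp (f x - ev f)
    calc _ ≤ Real.exp (ev f) * Real.exp (f x - ev f) := by gcongr
      _ = _ := by rw [← Real.exp_add]; ring_nf
  have h2 := ev_mono h
  rw [ev_mul, ev_add, ev_sub, ev_const, ev_const] at h2
  simpa using h2

lemma hoeffding_ev (f : α → ℝ) {R : ℝ} (hR : ∀ x y, |f x - f y| ≤ R) (s : ℝ) :
    ev (fun x => Real.exp (s * (f x - ev f))) ≤ Real.exp (s ^ 2 * R ^ 2 / 2) := by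
  have h1 : ∀ x, Real.exp (s * (f x - ev f)) ≤ ev (fun y => Real.exp (s * (f x - f y))) := by
    intro x
    have := exp_ev_le (fun y => s * (f x - f y))
    rwa [ev_mul, ev_sub, ev_const] at this
  have h2 := ev_mono h1
  refine h2.trans ?_
  have h3 : ev (fun x => ev (fun y => Real.exp (s * (f x - f y))))
      = ev (fun x => ev (fun y => Real.exp (s * (f y - f x)))) := by
    rw [← ev_prod (fun p : α × α => Real.exp (s * (f p.1 - f p.2))),
      ← ev_prod (fun p : α × α => Real.exp (s * (f p.2 - f p.1))),
      ← ev_equiv (Equiv.prodComm α α)]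
    rfl
  have h4 : ev (fun x => ev (fun y => Real.exp (s * (f x - f y))))
      = ev (fun x => ev (fun y => Real.cosh (s * (f x - f y)))) := by
    have : ∀ x y, Real.cosh (s * (f x - f y))
        = 2⁻¹ * (Real.exp (s * (f x - f y)) + Real.exp (s * (f y - f x))) := fun x y => by
      rw [Real.cosh_eq]
      ring_nf
    simp only [this, ev_mul, ev_add]
    rw [← h3]
    ring
  rw [h4]
  refine ev_le_const fun x => ev_le_const fun y => (Real.cosh_le_exp_half_sq _).trans ?_
  rw [Real.exp_le_exp, mul_pow]
  have : (f x - f y) ^ 2 ≤ R ^ 2 := by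
    rw [← sq_abs]
    exact pow_le_pow_left₀ (abs_nonneg _) (hR x y) 2
  gcongr

end jensen

def PermLip {α : Type*} [DecidableEq α] (f : Equiv.Perm α → ℝ) (L : ℝ) : Prop :=
  ∀ (x y : α) (π : Equiv.Perm α), |f (Equiv.swap x y * π) - f π| ≤ L

lemma perm_mgf_aux : ∀ (α : Type) [Fintype α], ∀ [DecidableEq α] (f : Equiv.Perm α → ℝ) (L : ℝ),
    PermLip f L → ∀ s : ℝ,
      ev (fun π => Real.exp (s * (f π - ev f))) ≤ Real.exp (2 * s ^ 2 * L ^ 2 * Fintype.card α) := by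
  intro α _
  refine Fintype.induction_empty_option (P := fun α _ => ∀ [DecidableEq α]
    (f : Equiv.Perm α → ℝ) (L : ℝ), PermLip f L → ∀ s : ℝ,
      ev (fun π => Real.exp (s * (f π - ev f))) ≤ Real.exp (2 * s ^ 2 * L ^ 2 * Fintype.card α))
      ?_ ?_ ?_ α
  · intro α β _ e ih _ f L hf s
    classical
    let _ : Fintype α := Fintype.ofEquiv β e.symm
    have h1 := ih (fun π => f (e.permCongr π)) L (fun x y π => by
      have := hf (e x) (e y) (e.permCongr π)
      convert this using 4
      ext z
      simp [Equiv.permCongr_apply, Equiv.swap_apply_def, apply_ite e]) s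
    rw [ev_equiv e.permCongr f, ev_equiv e.permCongr (fun π => Real.exp (s * (f π - ev f)))] at h1
    rw [← Fintype.card_congr e]
    exact h1
  · intro _ f L hf s
    have : ∀ π : Equiv.Perm PEmpty, f π = ev f := fun π => by
      have : f = fun _ => f π := by
        funext ρ
        congr 1
        exact Subsingleton.elim _ _
      rw [this, ev_const]
    simp [this, ev_const]
  · intro α _ ih _ f L hf s
    rename_i inst
    have hda : DecidableEq α := Classical.decEq α
    obtain rfl : inst = (fun a b => @Option.instDecidableEq α hda a b) := Subsingleton.elim _ _
    have key : ∀ F : Equiv.Perm (Option α) → ℝ, ev F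
        = ev (fun i : Option α => ev (fun σ : Equiv.Perm α =>
            F (Equiv.swap none i * Equiv.optionCongr σ))) := by
      intro F
      rw [← ev_equiv (Equiv.Perm.decomposeOption (α := α)).symm F, ev_prod]
      simp only [Equiv.Perm.decomposeOption_symm_apply]
    set g : Option α → Equiv.Perm α → ℝ := fun i σ => f (Equiv.swap none i * Equiv.optionCongr σ)
      with hg
    have hL : ∀ i, PermLip (g i) L := by
      intro i x y σ
      have h1 : Equiv.swap none i * Equiv.optionCongr (Equiv.swap x y * σ)
          = Equiv.swap (Equiv.swap none i (some x)) (Equiv.swap none i (some y)) *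
            (Equiv.swap none i * Equiv.optionCongr σ) := by
        rw [← mul_assoc, ← Equiv.mul_swap_eq_swap_mul, mul_assoc]
        congr 1
        rw [← Equiv.optionCongr_swap]
        ext z : 1
        cases z <;> simp [-Equiv.optionCongr_swap]
      simp only [hg, h1]
      exact hf _ _ _
    have hm : ∀ i j, |ev (g i) - ev (g j)| ≤ 2 * L := by
      intro i j
      rw [← ev_sub]
      refine (abs_ev_le _).trans (ev_le_const fun σ => ?_)
      have a1 := hf none i (Equiv.optionCongr σ)
      have a2 := hf none j (Equiv.optionCongr σ)
      simp only [hg]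
      rw [abs_le] at *
      constructor <;> linarith
    rw [key (fun π => Real.exp (s * (f π - ev f)))]
    have hf' : ev f = ev (fun i => ev (g i)) := key f
    have step : ∀ i, ev (fun σ => Real.exp (s * (g i σ - ev f)))
        ≤ Real.exp (2 * s ^ 2 * L ^ 2 * Fintype.card α) *
          Real.exp (s * (ev (g i) - ev fun i => ev (g i))) := by
      intro i
      have : ∀ σ, Real.exp (s * (g i σ - ev f)) = Real.exp (s * (ev (g i) - ev fun i => ev (g i))) *
          Real.exp (s * (g i σ - ev (g i))) := fun σ => by
        rw [← Real.exp_add, hf']; ring_nf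
      simp only [this, ev_mul]
      rw [mul_comm]
      gcongr
      exact ih (g i) L (hL i) s
    refine (ev_mono step).trans ?_
    rw [ev_mul]
    have h2 := hoeffding_ev (fun i => ev (g i)) hm s
    calc _ ≤ Real.exp (2 * s ^ 2 * L ^ 2 * Fintype.card α) * Real.exp (s ^ 2 * (2 * L) ^ 2 / 2) := by
          gcongr
      _ = _ := by
        rw [← Real.exp_add, Fintype.card_option]
        push_cast
        ring_nf

lemma perm_mgf {α : Type} [Fintype α] [DecidableEq α] {f : Equiv.Perm α → ℝ} {L : ℝ}
    (hf : PermLip f L) (s : ℝ) :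
    ev (fun π => Real.exp (s * (f π - ev f))) ≤ Real.exp (2 * s ^ 2 * L ^ 2 * Fintype.card α) :=
  perm_mgf_aux α f L hf s

/-- Tail bound. -/
lemma perm_tail {α : Type} [Fintype α] [DecidableEq α] {f : Equiv.Perm α → ℝ} {L : ℝ}
    (hf : PermLip f L) {s r : ℝ} (hs : 0 ≤ s) (p : Equiv.Perm α → Prop) [DecidablePred p]
    (hp : ∀ π, p π → r ≤ |f π - ev f|) :
    ev (fun π => if p π then (1:ℝ) else 0) ≤
      2 * Real.exp (2 * s ^ 2 * L ^ 2 * Fintype.card α - s * r) := by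
  have h1 := perm_mgf hf s
  have h2 := perm_mgf hf (-s)
  have h3 : ∀ π, (if p π then (1:ℝ) else 0) ≤ Real.exp (- (s * r)) *
      (Real.exp (s * (f π - ev f)) + Real.exp (-s * (f π - ev f))) := by
    intro π
    split_ifs with h
    · have h4 := hp π h
      rw [mul_add, ← Real.exp_add, ← Real.exp_add]
      rcases le_total 0 (f π - ev f) with h5 | h5
      · rw [abs_of_nonneg h5] at h4
        have : 1 ≤ Real.exp (- (s * r) + s * (f π - ev f)) := by
          rw [Real.one_le_exp_iff]; nlinarith
        linarith [Real.exp_pos (- (s * r) + -s * (f π - ev f))]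
      · rw [abs_of_nonpos h5] at h4
        have : 1 ≤ Real.exp (- (s * r) + -s * (f π - ev f)) := by
          rw [Real.one_le_exp_iff]; nlinarith
        linarith [Real.exp_pos (- (s * r) + s * (f π - ev f))]
    · positivity
  refine (ev_mono h3).trans ?_
  rw [ev_mul, ev_add]
  rw [neg_sq] at h2
  calc _ ≤ Real.exp (- (s * r)) * (Real.exp (2 * s ^ 2 * L ^ 2 * Fintype.card α) +
        Real.exp (2 * s ^ 2 * L ^ 2 * Fintype.card α)) := by gcongr
    _ = _ := by
      rw [← two_mul, mul_left_comm, ← Real.exp_add]; ring_nf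

/-- Maximal inequality. -/
lemma perm_max {α : Type} [Fintype α] [DecidableEq α] {I : Type*} [Fintype I] [Nonempty I]
    {f : I → Equiv.Perm α → ℝ} {L c : ℝ}
    (hf : ∀ i, PermLip (f i) L) (hc : ∀ i, |ev (f i)| ≤ c) {s : ℝ} (hs : 0 < s)
    (M : Equiv.Perm α → ℝ) (hM : ∀ π, ∃ i, M π ≤ |f i π|) :
    ev M ≤ c + Real.log (2 * Fintype.card I) / s + 2 * s * L ^ 2 * Fintype.card α := by
  have hI : (0:ℝ) < Fintype.card I := by exact_mod_cast Fintype.card_pos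
  have h1 := exp_ev_le (fun π => s * M π)
  rw [ev_mul] at h1
  have h2 : ∀ π, Real.exp (s * M π) ≤
      ∑ i, (Real.exp (s * f i π) + Real.exp (-s * f i π)) := by
    intro π
    obtain ⟨i, hi⟩ := hM π
    refine le_trans ?_ (Finset.single_le_sum
      (f := fun i => Real.exp (s * f i π) + Real.exp (-s * f i π))
      (fun j _ => by positivity) (mem_univ i))
    rcases le_total 0 (f i π) with h5 | h5
    · rw [abs_of_nonneg h5] at hi
      have : Real.exp (s * M π) ≤ Real.exp (s * f i π) := by gcongr
      linarith [Real.exp_pos (-s * f i π)]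
    · rw [abs_of_nonpos h5] at hi
      have : Real.exp (s * M π) ≤ Real.exp (-s * f i π) := by
        rw [Real.exp_le_exp]; nlinarith
      linarith [Real.exp_pos (s * f i π)]
  have h3 : ∀ t : ℝ, |t| = s → ∀ i, ev (fun π => Real.exp (t * f i π)) ≤
      Real.exp (s * c + 2 * s ^ 2 * L ^ 2 * Fintype.card α) := by
    intro t ht i
    have h4 := perm_mgf (hf i) t
    have h5 : ∀ π, Real.exp (t * f i π) = Real.exp (t * ev (f i)) *
        Real.exp (t * (f i π - ev (f i))) := fun π => by
      rw [← Real.exp_add]; ring_nf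
    simp only [h5, ev_mul]
    rw [Real.exp_add]
    have h6 : t * ev (f i) ≤ s * c := by
      refine (le_abs_self _).trans ?_
      rw [abs_mul, ht]
      exact mul_le_mul_of_nonneg_left (hc i) hs.le
    rw [← sq_abs t, ht] at h4
    exact mul_le_mul (Real.exp_le_exp.2 h6) h4 (ev_nonneg fun _ => (Real.exp_pos _).le)
      (Real.exp_pos _).le
  have h4 : Real.exp (s * ev M) ≤ (2 * Fintype.card I) *
      Real.exp (s * c + 2 * s ^ 2 * L ^ 2 * Fintype.card α) := by
    refine h1.trans ((ev_mono h2).trans ?_)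
    rw [ev_sum]
    calc _ ≤ ∑ i : I, (2 * Real.exp (s * c + 2 * s ^ 2 * L ^ 2 * Fintype.card α)) := by
          refine Finset.sum_le_sum fun i _ => ?_
          rw [ev_add]
          have a := h3 s (abs_of_pos hs) i
          have b := h3 (-s) (by rw [abs_neg, abs_of_pos hs]) i
          linarith
      _ = _ := by
        rw [Finset.sum_const, card_univ, nsmul_eq_mul]; ring
  have h5 := Real.log_le_log (Real.exp_pos _) h4
  rw [Real.log_exp, Real.log_mul (by positivity) (Real.exp_pos _).ne', Real.log_exp] at h5
  have : ev M ≤ (Real.log (2 * Fintype.card I) +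
    (s * c + 2 * s ^ 2 * L ^ 2 * Fintype.card α)) / s := by
    rw [le_div_iff₀ hs]; linarith
  refine this.trans (le_of_eq ?_)
  field_simp
  ring

end RB


namespace RB

/-! ### Uniform matchings: switching identities -/

section matching
variable {H : Type} [Fintype H] [DecidableEq H]

/-- The matching obtained by conjugating a base matching by a permutation. -/
def Mt (ι₀ π : Equiv.Perm H) : Equiv.Perm H := π * ι₀ * π⁻¹

noncomputable def ff (ι₀ : Equiv.Perm H) (u v : H → ℝ) (π : Equiv.Perm H) : ℝ :=
  ∑ h, u h * v (Mt ι₀ π h)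

/-- Fixed point free involution. -/
def FPF (ι₀ : Equiv.Perm H) : Prop := (∀ x, ι₀ (ι₀ x) = x) ∧ ∀ x, ι₀ x ≠ x

variable {ι₀ : Equiv.Perm H}

lemma Mt_fpf (h0 : FPF ι₀) (π : Equiv.Perm H) : FPF (Mt ι₀ π) := by
  refine ⟨fun x => ?_, fun x hx => ?_⟩
  · simp [Mt, h0.1]
  · apply h0.2 (π⁻¹ x)
    simp only [Mt, Equiv.Perm.coe_mul, Function.comp_apply] at hx
    rw [Equiv.Perm.eq_inv_iff_eq]
    exact hx

lemma Mt_swap (a c : H) (π : Equiv.Perm H) (h : H) :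
    Mt ι₀ (Equiv.swap a c * π) h = Equiv.swap a c (Mt ι₀ π (Equiv.swap a c h)) := by
  simp [Mt, mul_assoc]

lemma sum_Mt (π : Equiv.Perm H) (f : H → ℝ) : ∑ h, f (Mt ι₀ π h) = ∑ h, f h :=
  Equiv.sum_comp _ _

lemma swap_eval (u : H → ℝ) (a c h : H) : u (Equiv.swap a c h) =
    u h + (u c - u a) * ((if h = a then 1 else 0) - (if h = c then 1 else 0)) := by
  rw [Equiv.swap_apply_def]
  by_cases h1 : h = a
  · by_cases h2 : h = c
    · subst h1; subst h2; simp
    · subst h1; simp [h2]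
  · by_cases h2 : h = c
    · subst h2; simp [h1]
    · simp [h1, h2]

lemma ff_swap (h0 : FPF ι₀) (u v : H → ℝ) (a c : H) (π : Equiv.Perm H) :
    ff ι₀ u v (Equiv.swap a c * π) - ff ι₀ u v π =
      -(u a - u c) * (v (Mt ι₀ π a) - v (Mt ι₀ π c)) - (v a - v c) * (u (Mt ι₀ π a) - u (Mt ι₀ π c))
      - 2 * (if c = Mt ι₀ π a then 1 else 0) * ((u a - u c) * (v a - v c)) := by
  obtain ⟨hi, hn⟩ := Mt_fpf h0 π
  set M := Mt ι₀ π with hM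
  have e1 : ff ι₀ u v (Equiv.swap a c * π) =
      ∑ h, u (Equiv.swap a c h) * v (Equiv.swap a c (M h)) := by
    unfold ff
    rw [← Equiv.sum_comp (Equiv.swap a c)]
    simp only [Mt_swap, Equiv.swap_apply_self, hM]
  have hMa : ∀ h x, (M h = x) ↔ (h = M x) := fun h x => by
    constructor
    · rintro rfl; exact (hi h).symm
    · rintro rfl; exact hi x
  have e2 : ∀ h, u (Equiv.swap a c h) * v (Equiv.swap a c (M h)) =
      u h * v (M h) + (u c - u a) * ((if h = a then v (M h) else 0) - (if h = c then v (M h) else 0))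
      + (v c - v a) * ((if h = M a then u h else 0) - (if h = M c then u h else 0))
      + (u c - u a) * (v c - v a) *
        ((if h = a then ((if h = M a then 1 else 0) - (if h = M c then 1 else 0)) else 0) -
         (if h = c then ((if h = M a then 1 else 0) - (if h = M c then 1 else 0)) else 0)) := by
    intro h
    rw [swap_eval u, swap_eval v]
    simp only [hMa]
    split_ifs <;> ring
  rw [e1, Finset.sum_congr rfl fun h _ => e2 h]
  simp only [Finset.sum_add_distrib, ← Finset.mul_sum, Finset.sum_sub_distrib,
    Finset.sum_ite_eq', mem_univ, if_true, hi]
  have n1 : a ≠ M a := (hn a).symm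
  have n2 : c ≠ M c := (hn c).symm
  have n3 : (a = M c) ↔ (c = M a) := by rw [← hMa c a, eq_comm]
  simp only [n1, n2, n3, if_false]
  unfold ff
  rw [← hM]
  split_ifs <;> ring

lemma abs_ff_swap_le (h0 : FPF ι₀) {u v : H → ℝ} (hu : ∀ h, |u h| ≤ 1) (hv : ∀ h, |v h| ≤ 1) :
    PermLip (ff ι₀ u v) 8 := by
  intro a c π
  rw [ff_swap h0]
  obtain ⟨hi, hn⟩ := Mt_fpf h0 π
  have hd : ∀ {w : H → ℝ}, (∀ h, |w h| ≤ 1) → ∀ x y, |w x - w y| ≤ 2 := fun hw x y => by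
    have := hw x
    have := hw y
    refine (abs_sub _ _).trans (by linarith)
  have hp : ∀ x y z t, |(u x - u y) * (v z - v t)| ≤ 4 := fun x y z t => by
    rw [abs_mul]
    nlinarith [hd hu x y, hd hv z t, abs_nonneg (u x - u y), abs_nonneg (v z - v t)]
  split_ifs with h
  · subst h
    rw [hi]
    have : -(u a - u (Mt ι₀ π a)) * (v (Mt ι₀ π a) - v a) - (v a - v (Mt ι₀ π a)) *
      (u (Mt ι₀ π a) - u a)
      - 2 * 1 * ((u a - u (Mt ι₀ π a)) * (v a - v (Mt ι₀ π a))) = 0 := by ring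
    rw [this]
    norm_num
  · have a1 := abs_le.1 (hp a c (Mt ι₀ π a) (Mt ι₀ π c))
    have a2 := abs_le.1 (hp (Mt ι₀ π a) (Mt ι₀ π c) a c)
    rw [abs_le]
    constructor <;> nlinarith

lemma sum_ff_swap (h0 : FPF ι₀) (u v : H → ℝ) (π : Equiv.Perm H) :
    ∑ a, ∑ c, (ff ι₀ u v (Equiv.swap a c * π) - ff ι₀ u v π) =
      -4 * Fintype.card H * ff ι₀ u v π + 4 * ((∑ h, u h) * ∑ h, v h)
      - 2 * ∑ a, (u a - u (Mt ι₀ π a)) * (v a - v (Mt ι₀ π a)) := by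
  obtain ⟨hi, hn⟩ := Mt_fpf h0 π
  simp only [ff_swap h0]
  set M := Mt ι₀ π with hM
  obtain ⟨p, hp⟩ : ∃ p : H → ℝ, ∀ a, p a = u a * v (M a) := ⟨_, fun _ => rfl⟩
  obtain ⟨q, hq⟩ : ∃ q : H → ℝ, ∀ a, q a = v a * u (M a) := ⟨_, fun _ => rfl⟩
  have e : ∀ a c, -(u a - u c) * (v (M a) - v (M c)) - (v a - v c) * (u (M a) - u (M c))
      - 2 * (if c = M a then 1 else 0) * ((u a - u c) * (v a - v c)) =
      - p a - p c + u a * v (M c) + u c * v (M a)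
      - q a - q c + v a * u (M c) + v c * u (M a)
      - 2 * (if c = M a then ((u a - u c) * (v a - v c)) else 0) := by
    intro a c
    rw [hp, hp, hq, hq]
    split_ifs <;> ring
  have s1 : ∀ w : H → ℝ, ∑ h, w (M h) = ∑ h, w h := fun w => Equiv.sum_comp M w
  have s2 : ∑ h, q h = ∑ h, p h := by
    rw [← Equiv.sum_comp M]
    exact Finset.sum_congr rfl fun h _ => by rw [hp, hq, hi, mul_comm]
  have s3 : ff ι₀ u v π = ∑ h, p h := by
    unfold ff
    exact Finset.sum_congr rfl fun h _ => by rw [hp, ← hM]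
  simp only [e, Finset.sum_add_distrib, Finset.sum_sub_distrib, Finset.sum_neg_distrib,
    ← Finset.mul_sum, ← Finset.sum_mul, Finset.sum_ite_eq', mem_univ, if_true, s1, s2,
    Finset.sum_const, card_univ, nsmul_eq_mul, s3]
  ring

lemma ev_swap (F : Equiv.Perm H → ℝ) (t : Equiv.Perm H) : ev (fun π => F (t * π)) = ev F :=
  ev_equiv (Equiv.mulLeft t) F

/-- The centered bilinear form. -/
noncomputable def fb (ι₀ : Equiv.Perm H) (u v : H → ℝ) (π : Equiv.Perm H) : ℝ :=
  ff ι₀ u v π - (∑ h, u h) * (∑ h, v h) / Fintype.card H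

lemma fb_lip (h0 : FPF ι₀) {u v : H → ℝ} (hu : ∀ h, |u h| ≤ 1) (hv : ∀ h, |v h| ≤ 1) :
    PermLip (fb ι₀ u v) 8 := by
  intro a c π
  have := abs_ff_swap_le h0 hu hv a c π
  simpa [fb] using this

lemma abs_ev_fb_le [Nonempty H] (h0 : FPF ι₀) {u v : H → ℝ} (hu : ∀ h, |u h| ≤ 1)
    (hv : ∀ h, |v h| ≤ 1) : |ev (fb ι₀ u v)| ≤ 2 := by
  have hN : (0:ℝ) < Fintype.card H := by exact_mod_cast Fintype.card_pos
  have h1 : ev (fun π => ∑ a, ∑ c, (ff ι₀ u v (Equiv.swap a c * π) - ff ι₀ u v π)) = 0 := by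
    rw [ev_sum]
    refine Finset.sum_eq_zero fun a _ => ?_
    rw [ev_sum]
    refine Finset.sum_eq_zero fun c _ => ?_
    rw [ev_sub, ev_swap (ff ι₀ u v), sub_self]
  have h2 : ∀ π, fb ι₀ u v π = - (4 * (Fintype.card H:ℝ))⁻¹ *
      (∑ a, ∑ c, (ff ι₀ u v (Equiv.swap a c * π) - ff ι₀ u v π))
      + - (2 * (Fintype.card H:ℝ))⁻¹ *
        ∑ a, (u a - u (Mt ι₀ π a)) * (v a - v (Mt ι₀ π a)) := by
    intro π
    rw [sum_ff_swap h0]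
    unfold fb
    field_simp
    ring
  have h3 : ev (fb ι₀ u v) = - (2 * (Fintype.card H:ℝ))⁻¹ *
      ev (fun π => ∑ a, (u a - u (Mt ι₀ π a)) * (v a - v (Mt ι₀ π a))) := by
    rw [show fb ι₀ u v = fun π => fb ι₀ u v π from rfl]
    simp only [h2]
    rw [ev_add, ev_mul, ev_mul, h1]
    ring
  rw [h3, abs_mul]
  have h4 : |ev (fun π => ∑ a, (u a - u (Mt ι₀ π a)) * (v a - v (Mt ι₀ π a)))|
      ≤ 4 * Fintype.card H := by
    refine (abs_ev_le _).trans (ev_le_const fun π => ?_)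
    refine (Finset.abs_sum_le_sum_abs _ _).trans ?_
    have : ∀ a, |(u a - u (Mt ι₀ π a)) * (v a - v (Mt ι₀ π a))| ≤ 4 := fun a => by
      have b1 : |u a - u (Mt ι₀ π a)| ≤ 2 := by
        have := hu a
        have := hu (Mt ι₀ π a)
        refine (abs_sub _ _).trans (by linarith)
      have b2 : |v a - v (Mt ι₀ π a)| ≤ 2 := by
        have := hv a
        have := hv (Mt ι₀ π a)
        refine (abs_sub _ _).trans (by linarith)
      rw [abs_mul]
      nlinarith [abs_nonneg (u a - u (Mt ι₀ π a)), abs_nonneg (v a - v (Mt ι₀ π a))]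
    refine (Finset.sum_le_sum fun a _ => this a).trans ?_
    simp [mul_comm]
  rw [abs_neg, abs_of_pos (by positivity)]
  calc _ ≤ (2 * (Fintype.card H:ℝ))⁻¹ * (4 * Fintype.card H) := by gcongr
    _ = 2 := by field_simp; norm_num

end matching

end RB


namespace RB

/-! ### Approximate integration by parts for the matching Hamiltonian -/

section stein
variable {H : Type} [Fintype H] [DecidableEq H] {B : Type*} [Fintype B]

noncomputable def Xh (ι₀ : Equiv.Perm H) (κ : ℝ) (s : B → H → ℝ) (π : Equiv.Perm H) (σ : B) : ℝ :=
  κ / 2 * ff ι₀ (s σ) (s σ) π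

noncomputable def gib2 (β : ℝ) (y : B → ℝ) (w : B → B → ℝ) : ℝ :=
  gib β y (fun σ => gib β y (fun σ' => w σ σ'))

lemma gib2_var (β : ℝ) (y v : B → ℝ) [Nonempty B] :
    gib β y (fun σ => v σ * v σ) - gib β y v * gib β y v =
      gib2 β y (fun σ σ' => v σ * v σ - v σ * v σ') := by
  unfold gib2
  have : ∀ σ, gib β y (fun σ' => v σ * v σ - v σ * v σ') = v σ * v σ - gib β y v * v σ := by
    intro σ
    rw [gib_sub, gib_const, gib_mul, mul_comm (v σ) (gib β y v)]
  simp only [this]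
  rw [gib_sub, gib_mul]

lemma gib2_sub (β : ℝ) (y : B → ℝ) (v w : B → B → ℝ) :
    gib2 β y (fun σ τ => v σ τ - w σ τ) = gib2 β y v - gib2 β y w := by
  simp only [gib2, gib_sub]

lemma gib2_mul (β : ℝ) (y : B → ℝ) (c : ℝ) (w : B → B → ℝ) :
    gib2 β y (fun σ τ => c * w σ τ) = c * gib2 β y w := by
  simp only [gib2, gib_mul]

lemma gib2_sum {ι : Type*} (s : Finset ι) (β : ℝ) (y : B → ℝ) (v : ι → B → B → ℝ) :
    gib2 β y (fun σ τ => ∑ i ∈ s, v i σ τ) = ∑ i ∈ s, gib2 β y (v i) := by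
  simp only [gib2, gib_sum]

lemma abs_gib2_le [Nonempty B] (β : ℝ) (y : B → ℝ) {w : B → B → ℝ} {K : ℝ}
    (h : ∀ σ τ, |w σ τ| ≤ K) : |gib2 β y w| ≤ K :=
  abs_gib_le β y fun σ => abs_gib_le β y fun τ => h σ τ

variable {ι₀ : Equiv.Perm H} {s : B → H → ℝ}

lemma ff_comm (h0 : FPF ι₀) (u v : H → ℝ) (π : Equiv.Perm H) : ff ι₀ u v π = ff ι₀ v u π := by
  obtain ⟨hi, hn⟩ := Mt_fpf h0 π
  unfold ff
  rw [← Equiv.sum_comp (Mt ι₀ π)]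
  exact Finset.sum_congr rfl fun h _ => by rw [hi, mul_comm]

/-- The four-point sum. -/
lemma sum_four (h0 : FPF ι₀) (u v : H → ℝ) (π : Equiv.Perm H) (hu : ∑ h, u h = 0)
    (hv : ∑ h, v h = 0) :
    ∑ a, ∑ c, ((u a - u c) * (u (Mt ι₀ π a) - u (Mt ι₀ π c))) *
      ((v a - v c) * (v (Mt ι₀ π a) - v (Mt ι₀ π c))) =
    2 * Fintype.card H * ff ι₀ (fun h => u h * v h) (fun h => u h * v h) π
      + 2 * (∑ h, u h * v h) ^ 2 + 2 * (ff ι₀ u u π * ff ι₀ v v π) + 2 * (ff ι₀ u v π) ^ 2 := by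
  set M := Mt ι₀ π with hM
  have hsq : (ff ι₀ u v π) ^ 2 = ff ι₀ u v π * ff ι₀ v u π := by rw [ff_comm h0 v u]; ring
  obtain ⟨r, hr⟩ : ∃ p : H → ℝ, ∀ a, p a = u a * v a := ⟨_, fun _ => rfl⟩
  obtain ⟨r', hr'⟩ : ∃ p : H → ℝ, ∀ a, p a = u (M a) * v (M a) := ⟨_, fun _ => rfl⟩
  obtain ⟨rr, hrr⟩ : ∃ p : H → ℝ, ∀ a, p a = u a * v a * (u (M a) * v (M a)) := ⟨_, fun _ => rfl⟩
  obtain ⟨ru, hru⟩ : ∃ p : H → ℝ, ∀ a, p a = u a * v a * u (M a) := ⟨_, fun _ => rfl⟩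
  obtain ⟨rv, hrv⟩ : ∃ p : H → ℝ, ∀ a, p a = u a * v a * v (M a) := ⟨_, fun _ => rfl⟩
  obtain ⟨ru', hru'⟩ : ∃ p : H → ℝ, ∀ a, p a = u (M a) * v (M a) * u a := ⟨_, fun _ => rfl⟩
  obtain ⟨rv', hrv'⟩ : ∃ p : H → ℝ, ∀ a, p a = u (M a) * v (M a) * v a := ⟨_, fun _ => rfl⟩
  obtain ⟨uu, huu⟩ : ∃ p : H → ℝ, ∀ a, p a = u a * u (M a) := ⟨_, fun _ => rfl⟩
  obtain ⟨vv, hvv⟩ : ∃ p : H → ℝ, ∀ a, p a = v a * v (M a) := ⟨_, fun _ => rfl⟩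
  obtain ⟨uv, huv⟩ : ∃ p : H → ℝ, ∀ a, p a = u a * v (M a) := ⟨_, fun _ => rfl⟩
  obtain ⟨vu, hvu⟩ : ∃ p : H → ℝ, ∀ a, p a = v a * u (M a) := ⟨_, fun _ => rfl⟩
  have e : ∀ a c, ((u a - u c) * (u (M a) - u (M c))) * ((v a - v c) * (v (M a) - v (M c))) =
      rr a + rr c + r a * r' c + r' a * r c
      - ru a * v (M c) - rv a * u (M c) - v (M a) * ru c - u (M a) * rv c
      - ru' a * v c - rv' a * u c - v a * ru' c - u a * rv' c
      + uu a * vv c + vv a * uu c + uv a * vu c + vu a * uv c := by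
    intro a c
    simp only [hr, hr', hrr, hru, hrv, hru', hrv', huu, hvv, huv, hvu]
    ring
  have s1 : ∀ w : H → ℝ, ∑ h, w (M h) = ∑ h, w h := fun w => Equiv.sum_comp M w
  have t1 : ∑ h, r' h = ∑ h, r h := by
    rw [← s1 r]
    exact Finset.sum_congr rfl fun h _ => by rw [hr, hr']
  have f1 : ff ι₀ (fun h => u h * v h) (fun h => u h * v h) π = ∑ h, rr h := by
    unfold ff; exact Finset.sum_congr rfl fun h _ => by rw [hrr, ← hM]
  have f2 : ff ι₀ u u π = ∑ h, uu h := by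
    unfold ff; exact Finset.sum_congr rfl fun h _ => by rw [huu, ← hM]
  have f3 : ff ι₀ v v π = ∑ h, vv h := by
    unfold ff; exact Finset.sum_congr rfl fun h _ => by rw [hvv, ← hM]
  have f4 : ff ι₀ u v π = ∑ h, uv h := by
    unfold ff; exact Finset.sum_congr rfl fun h _ => by rw [huv, ← hM]
  have f5 : ff ι₀ v u π = ∑ h, vu h := by
    unfold ff; exact Finset.sum_congr rfl fun h _ => by rw [hvu, ← hM]
  rw [hsq]
  simp only [← hr]
  simp only [hr]
  rw [f1, f2, f3, f4, f5]
  simp only [← hr]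
  simp only [e, Finset.sum_add_distrib, Finset.sum_sub_distrib,
    ← Finset.mul_sum, ← Finset.sum_mul, s1, hu, hv, t1,
    Finset.sum_const, card_univ, nsmul_eq_mul]
  ring

lemma Xh_swap (h0 : FPF ι₀) (κ : ℝ) (a c : H) (π : Equiv.Perm H) (σ : B) :
    Xh ι₀ κ s (Equiv.swap a c * π) σ - Xh ι₀ κ s π σ =
      -κ * (if c = Mt ι₀ π a then 0 else
        (s σ a - s σ c) * (s σ (Mt ι₀ π a) - s σ (Mt ι₀ π c))) := by
  obtain ⟨hi, hn⟩ := Mt_fpf h0 π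
  have : Xh ι₀ κ s (Equiv.swap a c * π) σ - Xh ι₀ κ s π σ = κ / 2 *
    (ff ι₀ (s σ) (s σ) (Equiv.swap a c * π) - ff ι₀ (s σ) (s σ) π) := by unfold Xh; ring
  rw [this, ff_swap h0]
  split_ifs with h
  · subst h; rw [hi]; ring
  · ring

lemma abs_Xh_swap (h0 : FPF ι₀) {κ : ℝ} (hκ : 0 ≤ κ) (hs : ∀ σ h, |s σ h| ≤ 1) (a c : H)
    (π : Equiv.Perm H) (σ : B) :
    |Xh ι₀ κ s (Equiv.swap a c * π) σ - Xh ι₀ κ s π σ| ≤ 4 * κ := by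
  have : Xh ι₀ κ s (Equiv.swap a c * π) σ - Xh ι₀ κ s π σ = κ / 2 *
    (ff ι₀ (s σ) (s σ) (Equiv.swap a c * π) - ff ι₀ (s σ) (s σ) π) := by unfold Xh; ring
  rw [this, abs_mul, abs_of_nonneg (by positivity)]
  have := abs_ff_swap_le h0 (hs σ) (hs σ) a c π
  nlinarith

lemma sum_VV (h0 : FPF ι₀) (κ : ℝ) (hs : ∀ σ h, |s σ h| ≤ 1) (h00 : ∀ σ, ∑ h, s σ h = 0)
    (π : Equiv.Perm H) (σ τ : B) :
    ∃ δ, 0 ≤ δ ∧ δ ≤ 16 * (Fintype.card H : ℝ) ∧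
    ∑ a, ∑ c, (Xh ι₀ κ s (Equiv.swap a c * π) σ - Xh ι₀ κ s π σ) *
      (Xh ι₀ κ s (Equiv.swap a c * π) τ - Xh ι₀ κ s π τ) =
    κ ^ 2 * ((2 * Fintype.card H * ff ι₀ (fun h => s σ h * s τ h) (fun h => s σ h * s τ h) π
      + 2 * (∑ h, s σ h * s τ h) ^ 2 + 2 * (ff ι₀ (s σ) (s σ) π * ff ι₀ (s τ) (s τ) π)
      + 2 * (ff ι₀ (s σ) (s τ) π) ^ 2) - δ) := by
  obtain ⟨hi, hn⟩ := Mt_fpf h0 π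
  refine ⟨∑ a, (s σ a - s σ (Mt ι₀ π a)) ^ 2 * (s τ a - s τ (Mt ι₀ π a)) ^ 2, ?_, ?_, ?_⟩
  · exact Finset.sum_nonneg fun a _ => by positivity
  · have : ∀ ρ a, (s ρ a - s ρ (Mt ι₀ π a)) ^ 2 ≤ 4 := fun ρ a => by
      have b1 := abs_le.1 (hs ρ a)
      have b2 := abs_le.1 (hs ρ (Mt ι₀ π a))
      nlinarith
    have h2 : ∀ a, (s σ a - s σ (Mt ι₀ π a)) ^ 2 * (s τ a - s τ (Mt ι₀ π a)) ^ 2 ≤ 16 := fun a => by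
      have := mul_le_mul (this σ a) (this τ a) (by positivity) (by norm_num)
      linarith
    refine (Finset.sum_le_sum fun a _ => h2 a).trans ?_
    simp [mul_comm]
  · rw [← sum_four h0 (s σ) (s τ) π (h00 σ) (h00 τ)]
    have e : ∀ a c, (Xh ι₀ κ s (Equiv.swap a c * π) σ - Xh ι₀ κ s π σ) *
      (Xh ι₀ κ s (Equiv.swap a c * π) τ - Xh ι₀ κ s π τ) =
      κ ^ 2 * (((s σ a - s σ c) * (s σ (Mt ι₀ π a) - s σ (Mt ι₀ π c))) *
      ((s τ a - s τ c) * (s τ (Mt ι₀ π a) - s τ (Mt ι₀ π c)))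
      - (if c = Mt ι₀ π a then (s σ a - s σ c) ^ 2 * (s τ a - s τ c) ^ 2 else 0)) := by
      intro a c
      rw [Xh_swap h0, Xh_swap h0]
      split_ifs with h
      · subst h; rw [hi]; ring
      · ring
    simp only [e, ← Finset.mul_sum, Finset.sum_sub_distrib, Finset.sum_ite_eq', mem_univ, if_true]

lemma abs_ff_le {u v : H → ℝ} (hu : ∀ h, |u h| ≤ 1) (hv : ∀ h, |v h| ≤ 1) (π : Equiv.Perm H) :
    |ff ι₀ u v π| ≤ Fintype.card H := by
  unfold ff
  refine (Finset.abs_sum_le_sum_abs _ _).trans ?_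
  have : ∀ h, |u h * v (Mt ι₀ π h)| ≤ 1 := fun h => by
    rw [abs_mul]
    exact mul_le_one₀ (hu h) (abs_nonneg _) (hv _)
  refine (Finset.sum_le_sum fun h _ => this h).trans ?_
  simp

/-- bound on the sum of squared switches -/
lemma sum_VV_bound [Nonempty H] (h0 : FPF ι₀) (κ : ℝ) (hs : ∀ σ h, s σ h * s σ h = 1)
    (h00 : ∀ σ, ∑ h, s σ h = 0) (π : Equiv.Perm H) {E : ℝ}
    (hE1 : ∀ σ τ, |fb ι₀ (s σ) (s τ) π| ≤ E)
    (hE2 : ∀ σ τ, |fb ι₀ (fun h => s σ h * s τ h) (fun h => s σ h * s τ h) π| ≤ E) (σ τ : B) :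
    |∑ a, ∑ c, ((Xh ι₀ κ s (Equiv.swap a c * π) σ - Xh ι₀ κ s π σ) *
      (Xh ι₀ κ s (Equiv.swap a c * π) σ - Xh ι₀ κ s π σ) -
      (Xh ι₀ κ s (Equiv.swap a c * π) σ - Xh ι₀ κ s π σ) *
      (Xh ι₀ κ s (Equiv.swap a c * π) τ - Xh ι₀ κ s π τ)) -
      κ ^ 2 * (4 * ((Fintype.card H : ℝ) ^ 2 - (∑ h, s σ h * s τ h) ^ 2))|
      ≤ κ ^ 2 * (12 * Fintype.card H * E + 16 * Fintype.card H) := by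
  have hN : (0:ℝ) < Fintype.card H := by exact_mod_cast Fintype.card_pos
  have hs1 : ∀ σ h, |s σ h| ≤ 1 := fun σ h => by
    rw [abs_le]; constructor <;> nlinarith [hs σ h]
  have key : ∀ ρ τ, |(2 * Fintype.card H * ff ι₀ (fun h => s ρ h * s τ h) (fun h => s ρ h * s τ h) π
      + 2 * (∑ h, s ρ h * s τ h) ^ 2 + 2 * (ff ι₀ (s ρ) (s ρ) π * ff ι₀ (s τ) (s τ) π)
      + 2 * (ff ι₀ (s ρ) (s τ) π) ^ 2) - 4 * (∑ h, s ρ h * s τ h) ^ 2|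
      ≤ 6 * Fintype.card H * E := by
    intro ρ τ
    have e1 : 2 * Fintype.card H * ff ι₀ (fun h => s ρ h * s τ h) (fun h => s ρ h * s τ h) π =
      2 * Fintype.card H * fb ι₀ (fun h => s ρ h * s τ h) (fun h => s ρ h * s τ h) π
        + 2 * (∑ h, s ρ h * s τ h) ^ 2 := by
      unfold fb; field_simp; ring
    have e2 : ∀ ρ τ, fb ι₀ (s ρ) (s τ) π = ff ι₀ (s ρ) (s τ) π := fun ρ τ => by
      unfold fb; rw [h00]; simp
    have b1 : |ff ι₀ (s ρ) (s ρ) π * ff ι₀ (s τ) (s τ) π| ≤ Fintype.card H * E := by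
      rw [abs_mul]
      exact mul_le_mul (abs_ff_le (hs1 ρ) (hs1 ρ) π) (by rw [← e2]; exact hE1 _ _) (abs_nonneg _) hN.le
    have b2 : |ff ι₀ (s ρ) (s τ) π * ff ι₀ (s ρ) (s τ) π| ≤ Fintype.card H * E := by
      rw [abs_mul]
      exact mul_le_mul (abs_ff_le (hs1 ρ) (hs1 τ) π) (by rw [← e2]; exact hE1 _ _) (abs_nonneg _) hN.le
    have b3 : |Fintype.card H * fb ι₀ (fun h => s ρ h * s τ h) (fun h => s ρ h * s τ h) π|
        ≤ Fintype.card H * E := by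
      rw [abs_mul, abs_of_pos hN]
      exact mul_le_mul_of_nonneg_left (hE2 _ _) hN.le
    rw [e1]
    rw [abs_le] at *
    constructor <;> nlinarith
  obtain ⟨δ, d1, d2, d3⟩ := sum_VV h0 κ hs1 h00 π σ σ
  obtain ⟨δ', d1', d2', d3'⟩ := sum_VV h0 κ hs1 h00 π σ τ
  simp only [Finset.sum_sub_distrib]
  rw [d3, d3']
  have k1 := key σ σ
  have k2 := key σ τ
  have e3 : (∑ h, s σ h * s σ h) = Fintype.card H := by simp [hs]
  rw [e3] at k1 ⊢
  generalize (2 * Fintype.card H * ff ι₀ (fun h => s σ h * s τ h) (fun h => s σ h * s τ h) π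
      + 2 * (∑ h, s σ h * s τ h) ^ 2 + 2 * (ff ι₀ (s σ) (s σ) π * ff ι₀ (s τ) (s τ) π)
      + 2 * (ff ι₀ (s σ) (s τ) π) ^ 2) = Q2 at *
  generalize (2 * Fintype.card H * ff ι₀ (fun h => s σ h * s σ h) (fun h => s σ h * s σ h) π
      + 2 * (Fintype.card H : ℝ) ^ 2 + 2 * (ff ι₀ (s σ) (s σ) π * ff ι₀ (s σ) (s σ) π)
      + 2 * (ff ι₀ (s σ) (s σ) π) ^ 2) = Q1 at *
  have : κ ^ 2 * (Q1 - δ) - κ ^ 2 * (Q2 - δ') - κ ^ 2 * (4 * ((Fintype.card H : ℝ) ^ 2 -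
    (∑ h, s σ h * s τ h) ^ 2)) = κ ^ 2 * ((Q1 - 4 * (Fintype.card H : ℝ) ^ 2)
      - (Q2 - 4 * (∑ h, s σ h * s τ h) ^ 2) - δ + δ') := by ring
  rw [this, abs_mul, abs_of_nonneg (sq_nonneg κ)]
  refine mul_le_mul_of_nonneg_left ?_ (sq_nonneg κ)
  rw [abs_le] at *
  constructor <;> linarith

lemma exch [Nonempty B] (h0 : FPF ι₀) {κ β h : ℝ} (hκ : 0 ≤ κ) (hβ : 0 ≤ β) (hh : 0 ≤ h)
    (hs1 : ∀ σ h, |s σ h| ≤ 1) (g : B → ℝ) (a c : H) :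
    |ev (fun π => gib β (fun σ => h * Xh ι₀ κ s π σ + g σ)
        (fun σ => Xh ι₀ κ s (Equiv.swap a c * π) σ - Xh ι₀ κ s π σ)) +
      ev (fun π => h * β / 2 * gib2 β (fun σ => h * Xh ι₀ κ s π σ + g σ) (fun σ τ =>
        (Xh ι₀ κ s (Equiv.swap a c * π) σ - Xh ι₀ κ s π σ) *
      (Xh ι₀ κ s (Equiv.swap a c * π) σ - Xh ι₀ κ s π σ) -
      (Xh ι₀ κ s (Equiv.swap a c * π) σ - Xh ι₀ κ s π σ) *
      (Xh ι₀ κ s (Equiv.swap a c * π) τ - Xh ι₀ κ s π τ)))|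
      ≤ 192 * β ^ 2 * κ ^ 3 * h ^ 2 := by
  set t := Equiv.swap a c with ht
  have htt : ∀ π, t * (t * π) = π := fun π => by rw [← mul_assoc, Equiv.swap_mul_self, one_mul]
  set A : Equiv.Perm H → ℝ := fun π => gib β (fun σ => h * Xh ι₀ κ s π σ + g σ)
        (fun σ => Xh ι₀ κ s (t * π) σ - Xh ι₀ κ s π σ) with hA
  set A' : Equiv.Perm H → ℝ := fun π => gib β (fun σ => h * Xh ι₀ κ s (t * π) σ + g σ)
        (fun σ => Xh ι₀ κ s (t * π) σ - Xh ι₀ κ s π σ) with hA'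
  have e1 : ev A = ev (fun π => - A' π) := by
    rw [← ev_swap A t]
    congr 1
    ext π
    simp only [hA, hA', htt]
    rw [← neg_one_mul, ← gib_mul]
    congr 1
    ext σ
    ring
  rw [ev_neg] at e1
  set D : Equiv.Perm H → ℝ := fun π => h * β / 2 * gib2 β (fun σ => h * Xh ι₀ κ s π σ + g σ) (fun σ τ =>
        (Xh ι₀ κ s (t * π) σ - Xh ι₀ κ s π σ) *
      (Xh ι₀ κ s (t * π) σ - Xh ι₀ κ s π σ) -
      (Xh ι₀ κ s (t * π) σ - Xh ι₀ κ s π σ) *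
      (Xh ι₀ κ s (t * π) τ - Xh ι₀ κ s π τ)) with hD
  have e2 : ev A + ev D = ev (fun π => (-1/2) * (A' π - A π - 2 * D π)) := by
    rw [ev_mul (-1/2), ev_sub, ev_sub, ev_mul 2 D]
    linarith
  rw [e2]
  refine (abs_ev_le _).trans (ev_le_const fun π => ?_)
  rw [abs_mul]
  have := gib_taylor hβ (fun σ => h * Xh ι₀ κ s π σ + g σ)
    (fun σ => Xh ι₀ κ s (t * π) σ - Xh ι₀ κ s π σ) hh
    (fun σ => abs_Xh_swap h0 hκ hs1 a c π σ)
  rw [gib2_var] at this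
  have e3 : (fun σ => h * Xh ι₀ κ s π σ + g σ + h * (Xh ι₀ κ s (t * π) σ - Xh ι₀ κ s π σ)) =
    fun σ => h * Xh ι₀ κ s (t * π) σ + g σ := by ext σ; ring
  rw [e3] at this
  have e4 : A' π - A π - 2 * D π = gib β (fun σ => h * Xh ι₀ κ s (t * π) σ + g σ)
        (fun σ => Xh ι₀ κ s (t * π) σ - Xh ι₀ κ s π σ) -
      gib β (fun σ => h * Xh ι₀ κ s π σ + g σ) (fun σ => Xh ι₀ κ s (t * π) σ - Xh ι₀ κ s π σ) -
    h * (β * gib2 β (fun σ => h * Xh ι₀ κ s π σ + g σ) (fun σ τ =>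
        (Xh ι₀ κ s (t * π) σ - Xh ι₀ κ s π σ) *
      (Xh ι₀ κ s (t * π) σ - Xh ι₀ κ s π σ) -
      (Xh ι₀ κ s (t * π) σ - Xh ι₀ κ s π σ) *
      (Xh ι₀ κ s (t * π) τ - Xh ι₀ κ s π τ))) := by
    simp only [hA, hA', hD]; ring
  rw [← e4] at this
  have : |(-1/2 : ℝ)| = 1/2 := by norm_num
  rw [this]
  nlinarith

lemma stein [Nonempty B] [Nonempty H] (h0 : FPF ι₀) {κ β h : ℝ} (hκ : 0 ≤ κ) (hβ : 0 ≤ β)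
    (hh : 0 ≤ h) (hs : ∀ σ h, s σ h * s σ h = 1) (h00 : ∀ σ, ∑ h, s σ h = 0) (g : B → ℝ)
    (E : Equiv.Perm H → ℝ) (hE1 : ∀ π σ τ, |fb ι₀ (s σ) (s τ) π| ≤ E π)
    (hE2 : ∀ π σ τ, |fb ι₀ (fun h => s σ h * s τ h) (fun h => s σ h * s τ h) π| ≤ E π) :
    |ev (fun π => gib β (fun σ => h * Xh ι₀ κ s π σ + g σ) (Xh ι₀ κ s π)) -
      h * (β * κ ^ 2 / (2 * Fintype.card H)) *
      ev (fun π => gib2 β (fun σ => h * Xh ι₀ κ s π σ + g σ)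
        (fun σ τ => (Fintype.card H : ℝ) ^ 2 - (∑ h, s σ h * s τ h) ^ 2))|
      ≤ κ + 48 * Fintype.card H * β ^ 2 * κ ^ 3 * h ^ 2 + h * β * κ ^ 2 * (2 + 3 / 2 * ev E) := by
  have hN : (0:ℝ) < Fintype.card H := by exact_mod_cast Fintype.card_pos
  set N : ℝ := ((Fintype.card H : ℕ) : ℝ) with hNdef
  have hs1 : ∀ σ h, |s σ h| ≤ 1 := fun σ h => by
    rw [abs_le]; constructor <;> nlinarith [hs σ h]
  set y : Equiv.Perm H → B → ℝ := fun π σ => h * Xh ι₀ κ s π σ + g σ with hy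
  set V : H → H → Equiv.Perm H → B → ℝ := fun a c π σ =>
    Xh ι₀ κ s (Equiv.swap a c * π) σ - Xh ι₀ κ s π σ with hV
  set D : H → H → Equiv.Perm H → ℝ := fun a c π =>
    gib2 β (y π) (fun σ τ => V a c π σ * V a c π σ - V a c π σ * V a c π τ) with hD
  set W : Equiv.Perm H → ℝ := fun π => gib2 β (y π) (fun σ τ => N ^ 2 - (∑ h, s σ h * s τ h) ^ 2)
    with hW
  -- step 1
  have s1 : ∀ π, |4 * N * gib β (y π) (Xh ι₀ κ s π) + ∑ a, ∑ c, gib β (y π) (V a c π)|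
      ≤ 4 * N * κ := by
    intro π
    have e : 4 * N * gib β (y π) (Xh ι₀ κ s π) + ∑ a, ∑ c, gib β (y π) (V a c π) =
      gib β (y π) (fun σ => 4 * N * Xh ι₀ κ s π σ + ∑ a, ∑ c, V a c π σ) := by
      rw [gib_add, gib_mul, gib_sum]
      simp only [gib_sum]
    rw [e]
    refine abs_gib_le _ _ fun σ => ?_
    have e2 : ∑ a, ∑ c, V a c π σ = κ / 2 * ∑ a, ∑ c,
      (ff ι₀ (s σ) (s σ) (Equiv.swap a c * π) - ff ι₀ (s σ) (s σ) π) := by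
      simp only [Finset.mul_sum, hV, Xh]
      refine Finset.sum_congr rfl fun a _ => Finset.sum_congr rfl fun c _ => by ring
    rw [e2, sum_ff_swap h0, h00]
    have e3 : 4 * N * Xh ι₀ κ s π σ + κ / 2 * (-4 * (Fintype.card H : ℝ) * ff ι₀ (s σ) (s σ) π + 4 * (0 * 0)
      - 2 * ∑ a, (s σ a - s σ (Mt ι₀ π a)) * (s σ a - s σ (Mt ι₀ π a))) =
      - (κ * ∑ a, (s σ a - s σ (Mt ι₀ π a)) * (s σ a - s σ (Mt ι₀ π a))) := by
      rw [← hNdef]; unfold Xh; ring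
    rw [e3, abs_neg, abs_mul, abs_of_nonneg hκ]
    have e4 : |∑ a, (s σ a - s σ (Mt ι₀ π a)) * (s σ a - s σ (Mt ι₀ π a))| ≤ 4 * N := by
      refine (Finset.abs_sum_le_sum_abs _ _).trans ?_
      have : ∀ a, |(s σ a - s σ (Mt ι₀ π a)) * (s σ a - s σ (Mt ι₀ π a))| ≤ 4 := fun a => by
        have b1 := abs_le.1 (hs1 σ a)
        have b2 := abs_le.1 (hs1 σ (Mt ι₀ π a))
        rw [abs_mul_self]
        nlinarith
      refine (Finset.sum_le_sum fun a _ => this a).trans ?_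
      simp [hNdef, mul_comm]
    nlinarith
  have s2 : |4 * N * ev (fun π => gib β (y π) (Xh ι₀ κ s π)) +
      ∑ a, ∑ c, ev (fun π => gib β (y π) (V a c π))| ≤ 4 * N * κ := by
    have e : 4 * N * ev (fun π => gib β (y π) (Xh ι₀ κ s π)) +
      ∑ a, ∑ c, ev (fun π => gib β (y π) (V a c π)) =
      ev (fun π => 4 * N * gib β (y π) (Xh ι₀ κ s π) + ∑ a, ∑ c, gib β (y π) (V a c π)) := by
      rw [ev_add, ev_mul, ev_sum]
      simp only [ev_sum]
    rw [e]
    exact (abs_ev_le _).trans (ev_le_const s1)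
  have s3 : ∀ a c, |ev (fun π => gib β (y π) (V a c π)) + h * β / 2 * ev (D a c)| ≤
      192 * β ^ 2 * κ ^ 3 * h ^ 2 := fun a c => by
    rw [← ev_mul]
    exact exch h0 hκ hβ hh hs1 g a c
  have s4 : |∑ a, ∑ c, ev (fun π => gib β (y π) (V a c π)) + h * β / 2 * ∑ a, ∑ c, ev (D a c)| ≤
      N ^ 2 * (192 * β ^ 2 * κ ^ 3 * h ^ 2) := by
    simp only [Finset.mul_sum, ← Finset.sum_add_distrib]
    refine (Finset.abs_sum_le_sum_abs _ _).trans ?_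
    refine (Finset.sum_le_sum fun a _ => (Finset.abs_sum_le_sum_abs _ _).trans
      (Finset.sum_le_sum fun c _ => s3 a c)).trans ?_
    simp only [Finset.sum_const, card_univ, nsmul_eq_mul, ← hNdef]
    apply le_of_eq; ring
  have s5 : |∑ a, ∑ c, ev (D a c) - 4 * κ ^ 2 * ev W| ≤ κ ^ 2 * (12 * N * ev E + 16 * N) := by
    have e : ∑ a, ∑ c, ev (D a c) - 4 * κ ^ 2 * ev W =
      ev (fun π => ∑ a, ∑ c, D a c π - 4 * κ ^ 2 * W π) := by
      rw [ev_sub, ev_mul, ev_sum]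
      simp only [ev_sum]
    have e' : κ ^ 2 * (12 * N * ev E + 16 * N) = ev (fun π => κ ^ 2 * (12 * N * E π + 16 * N)) := by
      rw [ev_mul, ev_add, ev_mul, ev_const]
    rw [e, e']
    refine (abs_ev_le _).trans (ev_mono fun π => ?_)
    have e'' : ∑ a, ∑ c, D a c π - 4 * κ ^ 2 * W π = gib2 β (y π) (fun σ τ =>
      ∑ a, ∑ c, (V a c π σ * V a c π σ - V a c π σ * V a c π τ) -
        κ ^ 2 * (4 * (N ^ 2 - (∑ h, s σ h * s τ h) ^ 2))) := by
      rw [gib2_sub, gib2_sum, gib2_mul, gib2_mul]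
      simp only [gib2_sum, hW, hD]
      ring
    rw [e'']
    exact abs_gib2_le _ _ fun σ τ => sum_VV_bound h0 κ hs h00 π (hE1 π) (hE2 π) σ τ
  change |ev (fun π => gib β (y π) (Xh ι₀ κ s π)) - h * (β * κ ^ 2 / (2 * N)) * ev W| ≤ _
  generalize ev (fun π => gib β (y π) (Xh ι₀ κ s π)) = x1 at *
  generalize ∑ a, ∑ c, ev (fun π => gib β (y π) (V a c π)) = x2 at *
  generalize ∑ a, ∑ c, ev (D a c) = x3 at *
  generalize ev W = x4 at *
  generalize ev E = x5 at *
  have hhb : 0 ≤ h * β / 2 := by positivity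
  have s6 := mul_le_mul_of_nonneg_left s5 hhb
  rw [← abs_of_nonneg hhb, ← abs_mul, abs_of_nonneg hhb] at s6
  have e : 4 * N * (x1 - h * (β * κ ^ 2 / (2 * N)) * x4) = (4 * N * x1 + x2)
    - (x2 + h * β / 2 * x3) + h * β / 2 * (x3 - 4 * κ ^ 2 * x4) := by field_simp; ring
  have s7 : |4 * N * (x1 - h * (β * κ ^ 2 / (2 * N)) * x4)| ≤ 4 * N * κ +
      N ^ 2 * (192 * β ^ 2 * κ ^ 3 * h ^ 2) + h * β / 2 * (κ ^ 2 * (12 * N * x5 + 16 * N)) := by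
    rw [e]
    rw [abs_le] at *
    constructor <;> linarith
  rw [abs_mul, abs_of_pos (by positivity)] at s7
  refine le_of_mul_le_mul_left (s7.trans (le_of_eq ?_)) (by positivity : 0 < 4 * N)
  ring

end stein
end RB


namespace RB

/-! ### Gaussian integration by parts -/

noncomputable abbrev gs : Measure ℝ := ProbabilityTheory.gaussianReal 0 1

lemma hasDerivAt_pdf (x : ℝ) : HasDerivAt (ProbabilityTheory.gaussianPDFReal 0 1)
    (-x * ProbabilityTheory.gaussianPDFReal 0 1 x) x := by
  rw [ProbabilityTheory.gaussianPDFReal_def]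
  have h1 : HasDerivAt (fun x : ℝ => -(x - 0) ^ 2 / (2 * ((1 : NNReal) : ℝ))) (-x) x := by
    have := (((hasDerivAt_id x).sub_const 0).pow 2).neg.div_const (2 * ((1 : NNReal) : ℝ))
    refine this.congr_deriv ?_
    simp
    ring
  refine ((h1.exp).const_mul _).congr_deriv ?_
  ring

lemma integrable_gs_id : Integrable (fun x : ℝ => x) gs :=
  (ProbabilityTheory.memLp_id_gaussianReal (μ := 0) (v := 1) 1).integrable (by norm_num)

lemma gs_integrable_iff (f : ℝ → ℝ) : Integrable f gs ↔
    Integrable (fun x => ProbabilityTheory.gaussianPDFReal 0 1 x * f x) := by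
  unfold gs
  rw [ProbabilityTheory.gaussianReal_of_var_ne_zero 0 one_ne_zero,
    integrable_withDensity_iff_integrable_smul'
      (ProbabilityTheory.measurable_gaussianPDF _ _) (ae_of_all _ fun x =>
        ProbabilityTheory.gaussianPDF_lt_top)]
  simp only [ProbabilityTheory.toReal_gaussianPDF, smul_eq_mul]

lemma stein_one {f f' : ℝ → ℝ} (hf : ∀ x, HasDerivAt f (f' x) x) (h1 : Integrable f gs)
    (h2 : Integrable f' gs) (h3 : Integrable (fun x => x * f x) gs) :
    ∫ x, x * f x ∂gs = ∫ x, f' x ∂gs := by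
  rw [gs_integrable_iff] at h1 h2 h3
  have key := integral_mul_deriv_eq_deriv_mul_of_integrable (u := f)
    (v := ProbabilityTheory.gaussianPDFReal 0 1) (u' := f')
    (v' := fun x => -x * ProbabilityTheory.gaussianPDFReal 0 1 x)
    (fun x _ => hf x) (fun x _ => hasDerivAt_pdf x)
    (h3.neg.congr (ae_of_all _ fun x => by simp; ring))
    (h2.congr (ae_of_all _ fun x => by simp; ring))
    (h1.congr (ae_of_all _ fun x => by simp; ring))
  unfold gs
  rw [ProbabilityTheory.integral_gaussianReal_eq_integral_smul one_ne_zero,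
    ProbabilityTheory.integral_gaussianReal_eq_integral_smul one_ne_zero]
  simp only [smul_eq_mul]
  have e1 : ∫ x, ProbabilityTheory.gaussianPDFReal 0 1 x * (x * f x) =
      - ∫ x, f x * (-x * ProbabilityTheory.gaussianPDFReal 0 1 x) := by
    rw [← integral_neg]
    congr 1; ext x; ring
  rw [e1, key, neg_neg]
  congr 1; ext x; ring

section multi
variable {P : Type*} [Fintype P] [DecidableEq P]

noncomputable abbrev gm (P : Type*) [Fintype P] : Measure (P → ℝ) := Measure.pi fun _ => gs

lemma mp_update (p : P) : MeasurePreserving (fun z : (P → ℝ) × ℝ => Function.update z.1 p z.2)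
    ((gm P).prod gs) (gm P) := by
  have hm : Measurable (fun z : (P → ℝ) × ℝ => Function.update z.1 p z.2) := by
    refine measurable_pi_iff.2 fun q => ?_
    by_cases h : q = p
    · subst h; simpa using measurable_snd
    · simp only [Function.update_of_ne h]
      exact (measurable_pi_apply q).comp measurable_fst
  refine ⟨hm, ?_⟩
  symm
  refine Measure.pi_eq fun s hs => ?_
  rw [Measure.map_apply hm (MeasurableSet.univ_pi hs)]
  have e : (fun z : (P → ℝ) × ℝ => Function.update z.1 p z.2) ⁻¹' (Set.univ.pi s) =
      (Set.univ.pi (Function.update s p Set.univ)) ×ˢ (s p) := by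
    ext z
    simp only [Set.mem_preimage, Set.mem_pi, Set.mem_univ, true_imp_iff, Set.mem_prod]
    constructor
    · intro h
      refine ⟨fun q => ?_, by simpa using h p⟩
      by_cases hq : q = p
      · subst hq; simp
      · have := h q
        simp only [Function.update_of_ne hq] at this ⊢
        exact this
    · rintro ⟨h1, h2⟩ q
      by_cases hq : q = p
      · subst hq; simpa using h2
      · have := h1 q
        simp only [Function.update_of_ne hq] at this ⊢
        exact this
  rw [e, Measure.prod_prod, Measure.pi_pi]
  rw [← Finset.mul_prod_erase _ _ (mem_univ p), ← Finset.mul_prod_erase _ (fun i => gs (s i)) (mem_univ p)]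
  simp only [Function.update_self, measure_univ, one_mul]
  rw [mul_comm]
  congr 1
  refine Finset.prod_congr rfl fun q hq => ?_
  rw [Function.update_of_ne (Finset.ne_of_mem_erase hq)]

lemma gm_split (p : P) {f : (P → ℝ) → ℝ} (hf : Integrable f (gm P)) :
    ∫ J, f J ∂(gm P) = ∫ J, ∫ x, f (Function.update J p x) ∂gs ∂(gm P) := by
  have h := mp_update p
  have h1 : Integrable (f ∘ fun z : (P → ℝ) × ℝ => Function.update z.1 p z.2) ((gm P).prod gs) :=
    (h.integrable_comp hf.aestronglyMeasurable).2 hf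
  have h2 := integral_prod _ h1
  simp only [Function.comp_apply] at h2
  rw [← h2, ← integral_map h.measurable.aemeasurable (by rw [h.map_eq]; exact hf.aestronglyMeasurable),
    h.map_eq]

lemma integrable_coord (p : P) : Integrable (fun J : P → ℝ => J p) (gm P) := by
  have := measurePreserving_eval (fun _ : P => gs) p
  exact (this.integrable_comp (g := fun x : ℝ => x) aestronglyMeasurable_id).2 integrable_gs_id

lemma stein_multi (p : P) {f f' : (P → ℝ) → ℝ} {K : ℝ} (hc : Continuous f) (hc' : Continuous f')
    (hb : ∀ J, |f J| ≤ K) (hb' : ∀ J, |f' J| ≤ K)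
    (hd : ∀ J x, HasDerivAt (fun x => f (Function.update J p x)) (f' (Function.update J p x)) x) :
    ∫ J, J p * f J ∂(gm P) = ∫ J, f' J ∂(gm P) := by
  have hu : ∀ J : P → ℝ, Continuous (fun x : ℝ => Function.update J p x) := fun J =>
    continuous_const.update p continuous_id
  have i1 : Integrable (fun J : P → ℝ => J p * f J) (gm P) :=
    (integrable_coord p).mul_bdd (c := K) hc.aestronglyMeasurable (ae_of_all _ hb)
  have i2 : Integrable f' (gm P) :=
    Integrable.of_bound hc'.aestronglyMeasurable K (ae_of_all _ hb')
  rw [gm_split p i1, gm_split p i2]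
  congr 1
  ext J
  simp only [Function.update_self]
  refine stein_one (hd J) ?_ ?_ ?_
  · exact Integrable.of_bound (hc.comp (hu J)).aestronglyMeasurable K (ae_of_all _ fun x => hb _)
  · exact Integrable.of_bound (hc'.comp (hu J)).aestronglyMeasurable K (ae_of_all _ fun x => hb' _)
  · exact integrable_gs_id.mul_bdd (c := K) (hc.comp (hu J)).aestronglyMeasurable (ae_of_all _ fun x => hb _)

variable {B : Type*} [Fintype B]

lemma continuous_Zs {T : Type*} [TopologicalSpace T] (β : ℝ) {y : T → B → ℝ}
    (hy : ∀ σ, Continuous fun t => y t σ) : Continuous fun t => Zs β (y t) := by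
  unfold Zs
  exact continuous_finsetSum _ fun σ _ => ((hy σ).const_mul β).rexp

lemma continuous_gib [Nonempty B] {T : Type*} [TopologicalSpace T] (β : ℝ) {y v : T → B → ℝ}
    (hy : ∀ σ, Continuous fun t => y t σ) (hv : ∀ σ, Continuous fun t => v t σ) :
    Continuous fun t => gib β (y t) (v t) := by
  unfold gib
  refine Continuous.div ?_ (continuous_Zs β hy) fun t => (Zs_pos β (y t)).ne'
  exact continuous_finsetSum _ fun σ _ => (hv σ).mul ((hy σ).const_mul β).rexp

lemma continuous_gib2 [Nonempty B] {T : Type*} [TopologicalSpace T] (β : ℝ) {y : T → B → ℝ}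
    (hy : ∀ σ, Continuous fun t => y t σ) (w : B → B → ℝ) :
    Continuous fun t => gib2 β (y t) w := by
  unfold gib2
  exact continuous_gib β hy fun σ => continuous_gib β hy fun _ => continuous_const

lemma continuous_Phi [Nonempty B] {T : Type*} [TopologicalSpace T] (β : ℝ) {y : T → B → ℝ}
    (hy : ∀ σ, Continuous fun t => y t σ) : Continuous fun t => Phi β (y t) := by
  unfold Phi
  exact ((continuous_Zs β hy).log fun t => (Zs_pos β (y t)).ne').div_const β

/-- the Gaussian process -/
noncomputable def Gp (c : P → B → ℝ) (J : P → ℝ) (σ : B) : ℝ := ∑ p, J p * c p σ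

lemma continuous_Gp (c : P → B → ℝ) (σ : B) : Continuous fun J => Gp c J σ := by
  unfold Gp
  exact continuous_finsetSum _ fun p _ => (continuous_apply p).mul continuous_const

lemma Gp_update (c : P → B → ℝ) (J : P → ℝ) (p : P) (x : ℝ) (σ : B) :
    Gp c (Function.update J p x) σ = Gp c (Function.update J p 0) σ + x * c p σ := by
  unfold Gp
  rw [← Finset.add_sum_erase _ _ (mem_univ p),
    ← Finset.add_sum_erase _ (fun q => Function.update J p 0 q * c q σ) (mem_univ p)]
  have : ∀ x : ℝ, ∑ q ∈ univ.erase p, Function.update J p x q * c q σ =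
      ∑ q ∈ univ.erase p, J q * c q σ := fun x => Finset.sum_congr rfl fun q hq => by
    rw [Function.update_of_ne (Finset.ne_of_mem_erase hq)]
  rw [this, this]
  simp
  ring

lemma abs_Gp_le {c : P → B → ℝ} {C : ℝ} (hC : ∀ p σ, |c p σ| ≤ C) (J : P → ℝ) (σ : B) :
    |Gp c J σ| ≤ C * ∑ p, |J p| := by
  unfold Gp
  refine (Finset.abs_sum_le_sum_abs _ _).trans ?_
  rw [Finset.mul_sum]
  refine Finset.sum_le_sum fun p _ => ?_
  rw [abs_mul, mul_comm]
  exact mul_le_mul_of_nonneg_right (hC p σ) (abs_nonneg _)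

lemma integrable_sum_abs : Integrable (fun J : P → ℝ => ∑ p, |J p|) (gm P) :=
  integrable_finset_sum _ fun p _ => (integrable_coord p).abs

lemma gauss_ibp [Nonempty B] (β k : ℝ) (a : B → ℝ) {c : P → B → ℝ} {C : ℝ} (hC : ∀ p σ, |c p σ| ≤ C) :
    ∫ J, gib β (fun σ => a σ + k * Gp c J σ) (Gp c J) ∂(gm P) =
      k * ∫ J, gib2 β (fun σ => a σ + k * Gp c J σ)
        (fun σ τ => β * ∑ p, (c p σ * c p σ - c p σ * c p τ)) ∂(gm P) := by
  set y : (P → ℝ) → B → ℝ := fun J σ => a σ + k * Gp c J σ with hy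
  have hcy : ∀ σ, Continuous fun J => y J σ := fun σ =>
    continuous_const.add ((continuous_Gp c σ).const_mul k)
  have e1 : ∀ J, gib β (y J) (Gp c J) = ∑ p, J p * gib β (y J) (c p) := by
    intro J
    simp only [← gib_mul, ← gib_sum]
    rfl
  have e2 : ∀ J, gib2 β (y J) (fun σ τ => β * ∑ p, (c p σ * c p σ - c p σ * c p τ)) =
      ∑ p, β * (gib β (y J) (fun σ => c p σ * c p σ) - gib β (y J) (c p) * gib β (y J) (c p)) := by
    intro J
    rw [gib2_mul, gib2_sum, Finset.mul_sum]
    refine Finset.sum_congr rfl fun p _ => ?_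
    rw [gib2_var]
  have hC0 : ∀ p, 0 ≤ C := fun p => (abs_nonneg _).trans (hC p (Classical.arbitrary B))
  have hg : ∀ p J, |gib β (y J) (c p)| ≤ C := fun p J => abs_gib_le _ _ (hC p)
  have hgc : ∀ p, Continuous fun J => gib β (y J) (c p) := fun p =>
    continuous_gib β hcy fun _ => continuous_const
  have hgc2 : ∀ p, Continuous fun J => gib β (y J) (fun σ => c p σ * c p σ) := fun p =>
    continuous_gib β hcy fun _ => continuous_const
  have hvb : ∀ p J, |β * (gib β (y J) (fun σ => c p σ * c p σ) -
      gib β (y J) (c p) * gib β (y J) (c p))| ≤ |β| * (2 * C ^ 2) := by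
    intro p J
    rw [abs_mul]
    refine mul_le_mul_of_nonneg_left ?_ (abs_nonneg _)
    have b1 : |gib β (y J) (fun σ => c p σ * c p σ)| ≤ C ^ 2 := abs_gib_le _ _ fun σ => by
      rw [abs_mul, sq]
      exact mul_le_mul (hC p σ) (hC p σ) (abs_nonneg _) (hC0 p)
    have b2 : |gib β (y J) (c p) * gib β (y J) (c p)| ≤ C ^ 2 := by
      rw [abs_mul, sq]
      exact mul_le_mul (hg p J) (hg p J) (abs_nonneg _) (hC0 p)
    refine (abs_sub _ _).trans (by linarith)
  change ∫ J, gib β (y J) (Gp c J) ∂(gm P) = k * ∫ J, gib2 β (y J)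
    (fun σ τ => β * ∑ p, (c p σ * c p σ - c p σ * c p τ)) ∂(gm P)
  have hvc : ∀ p, Continuous fun J => β * (gib β (y J) (fun σ => c p σ * c p σ) -
      gib β (y J) (c p) * gib β (y J) (c p)) := fun p =>
    ((hgc2 p).sub ((hgc p).mul (hgc p))).const_mul β
  simp only [e1, e2]
  rw [integral_finset_sum _ fun p _ => (integrable_coord p).mul_bdd (c := C) (hgc p).aestronglyMeasurable
    (ae_of_all _ (hg p)),
    integral_finset_sum _ fun p _ => Integrable.of_bound (hvc p).aestronglyMeasurable _ (ae_of_all _ (hvb p)), Finset.mul_sum]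
  refine Finset.sum_congr rfl fun p _ => ?_
  rw [← integral_const_mul]
  refine stein_multi p (K := max C (|k| * (|β| * (2 * C ^ 2)))) (hgc p) ((hvc p).const_mul k) (fun J => (hg p J).trans (le_max_left _ _)) (fun J => ?_) ?_
  · rw [abs_mul]
    exact (mul_le_mul_of_nonneg_left (hvb p J) (abs_nonneg _)).trans (le_max_right _ _)
  · intro J x
    have hd : ∀ σ, HasDerivAt (fun x => y (Function.update J p x) σ) (k * c p σ) x := fun σ => by
      simp only [hy]
      have : (fun x => a σ + k * Gp c (Function.update J p x) σ) = fun x =>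
        a σ + k * (Gp c (Function.update J p 0) σ + x * c p σ) := by
        ext x; rw [Gp_update]
      rw [this]
      refine ((((hasDerivAt_id x).mul_const (c p σ)).const_add _).const_mul k).const_add _
        |>.congr_deriv ?_
      simp
    refine (hasDerivAt_gib β (c p) hd).congr_deriv ?_
    have : (fun σ => c p σ * (k * c p σ)) = fun σ => k * (c p σ * c p σ) := by ext σ; ring
    rw [this, gib_mul, gib_mul]
    ring

set_option maxHeartbeats 1000000 in
/-- The interpolation. -/
lemma interpolation [Nonempty B] {Ω : Type*} [Fintype Ω] [Nonempty Ω] {β err : ℝ} (hβ : 0 < β)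
    (X : Ω → B → ℝ) {c : P → B → ℝ} {C : ℝ} (hC : ∀ p σ, |c p σ| ≤ C)
    (hX : ∀ (h : ℝ) (g : B → ℝ), 0 ≤ h → h ≤ 1 →
      |ev (fun ω => gib β (fun σ => h * X ω σ + g σ) (X ω)) -
        h * ev (fun ω => gib2 β (fun σ => h * X ω σ + g σ)
          (fun σ τ => β * ∑ p, (c p σ * c p σ - c p σ * c p τ)))| ≤ err) :
    |ev (fun ω => Phi β (X ω)) - ∫ J, Phi β (Gp c J) ∂(gm P)| ≤ 2 * err := by
  obtain ⟨K, hK⟩ : ∃ K, ∀ ω σ, |X ω σ| ≤ K := by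
    obtain ⟨K, hK⟩ := (Set.finite_range (fun z : Ω × B => |X z.1 z.2|)).bddAbove
    exact ⟨K, fun ω σ => hK ⟨(ω, σ), rfl⟩⟩
  set Y : Ω → ℝ → (P → ℝ) → B → ℝ := fun ω θ J σ => Real.sin θ * X ω σ + Real.cos θ * Gp c J σ with hY
  have hcY : ∀ ω θ σ, Continuous fun J => Y ω θ J σ := fun ω θ σ =>
    continuous_const.add ((continuous_Gp c σ).const_mul _)
  have hdY : ∀ ω J θ σ, HasDerivAt (fun θ => Y ω θ J σ)
      (Real.cos θ * X ω σ - Real.sin θ * Gp c J σ) θ := fun ω J θ σ => by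
    refine ((Real.hasDerivAt_sin θ).mul_const _).add ((Real.hasDerivAt_cos θ).mul_const _)
      |>.congr_deriv ?_
    ring
  have hder : ∀ ω J θ, HasDerivAt (fun θ => Phi β (Y ω θ J))
      (gib β (Y ω θ J) (fun σ => Real.cos θ * X ω σ - Real.sin θ * Gp c J σ)) θ := fun ω J θ =>
    hasDerivAt_Phi hβ (hdY ω J θ)
  have hGc : ∀ σ, Continuous fun J => Gp c J σ := continuous_Gp c
  have ib : Integrable (fun J : P → ℝ => K + C * ∑ p, |J p|) (gm P) :=
    (integrable_const K).add (integrable_sum_abs.const_mul C)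
  have hbX : ∀ ω θ J, |gib β (Y ω θ J) (X ω)| ≤ K := fun ω θ J => abs_gib_le _ _ (hK ω)
  have hbG : ∀ ω θ J, |gib β (Y ω θ J) (Gp c J)| ≤ C * ∑ p, |J p| := fun ω θ J =>
    abs_gib_le _ _ (abs_Gp_le hC J)
  have hbd : ∀ ω θ J, |gib β (Y ω θ J) (fun σ => Real.cos θ * X ω σ - Real.sin θ * Gp c J σ)| ≤
      K + C * ∑ p, |J p| := fun ω θ J => by
    refine abs_gib_le _ _ fun σ => ?_
    refine (abs_sub _ _).trans ?_
    rw [abs_mul, abs_mul]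
    have h1 := Real.abs_cos_le_one θ
    have h2 := Real.abs_sin_le_one θ
    have h3 := hK ω σ
    have h4 := abs_Gp_le hC J σ
    have h5 := mul_le_mul h1 h3 (abs_nonneg _) zero_le_one
    have h6 := mul_le_mul h2 h4 (abs_nonneg _) zero_le_one
    linarith
  have hPc : ∀ ω θ, Continuous fun J => Phi β (Y ω θ J) := fun ω θ => continuous_Phi β (hcY ω θ)
  have iP : ∀ ω θ, Integrable (fun J => Phi β (Y ω θ J)) (gm P) := fun ω θ => by
    have hlc : 0 ≤ Real.log (Fintype.card B) / β := by
      refine div_nonneg (Real.log_natCast_nonneg _) hβ.le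
    have ib2 : Integrable (fun J : P → ℝ => K + C * ∑ p, |J p| + Real.log (Fintype.card B) / β)
      (gm P) := ib.add (integrable_const _)
    refine ib2.mono' (hPc ω θ).aestronglyMeasurable (ae_of_all _ fun J => ?_)
    have hYb : ∀ σ, |Y ω θ J σ| ≤ K + C * ∑ p, |J p| := fun σ => by
      simp only [hY]
      refine (abs_add_le _ _).trans ?_
      rw [abs_mul, abs_mul]
      have h1 := Real.abs_cos_le_one θ
      have h2 := Real.abs_sin_le_one θ
      have h5 := mul_le_mul h2 (hK ω σ) (abs_nonneg _) zero_le_one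
      have h6 := mul_le_mul h1 (abs_Gp_le hC J σ) (abs_nonneg _) zero_le_one
      linarith
    rw [Real.norm_eq_abs, abs_le]
    constructor
    · have := le_Phi hβ (Y ω θ J) (Classical.arbitrary B)
      have := (abs_le.1 (hYb (Classical.arbitrary B))).1
      linarith
    · exact Phi_le hβ _ fun σ => (abs_le.1 (hYb σ)).2
  have iX : ∀ ω θ, Integrable (fun J => gib β (Y ω θ J) (X ω)) (gm P) := fun ω θ =>
    Integrable.of_bound (continuous_gib β (v := fun _ => X ω) (hcY ω θ)
      fun _ => continuous_const).aestronglyMeasurable K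
      (ae_of_all _ (hbX ω θ))
  have iG : ∀ ω θ, Integrable (fun J => gib β (Y ω θ J) (Gp c J)) (gm P) := fun ω θ =>
    (integrable_sum_abs.const_mul C).mono' (continuous_gib β (hcY ω θ) hGc).aestronglyMeasurable
      (ae_of_all _ (hbG ω θ))
  set w : B → B → ℝ := fun σ τ => β * ∑ p, (c p σ * c p σ - c p σ * c p τ) with hw
  have iW : ∀ ω θ, Integrable (fun J => gib2 β (Y ω θ J) w) (gm P) := fun ω θ => by
    obtain ⟨K', hK'⟩ := (Set.finite_range (fun z : B × B => |w z.1 z.2|)).bddAbove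
    exact Integrable.of_bound (continuous_gib2 β (hcY ω θ) w).aestronglyMeasurable K'
      (ae_of_all _ fun J => abs_gib2_le _ _ fun σ τ => hK' ⟨(σ, τ), rfl⟩)
  have hF1 : ∀ ω θ, HasDerivAt (fun θ => ∫ J, Phi β (Y ω θ J) ∂(gm P))
      (∫ J, gib β (Y ω θ J) (fun σ => Real.cos θ * X ω σ - Real.sin θ * Gp c J σ) ∂(gm P)) θ := by
    intro ω θ
    refine (hasDerivAt_integral_of_dominated_loc_of_deriv_le (s := Set.univ)
      (bound := fun J => K + C * ∑ p, |J p|) univ_mem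
      (Eventually.of_forall fun θ => (hPc ω θ).aestronglyMeasurable) (iP ω θ) ?_
      (ae_of_all _ fun J θ _ => hbd ω θ J) ib (ae_of_all _ fun J θ _ => hder ω J θ)).2
    exact (continuous_gib β (hcY ω θ) fun σ => continuous_const.sub
      ((hGc σ).const_mul _)).aestronglyMeasurable
  set F : ℝ → ℝ := fun θ => ev (fun ω => ∫ J, Phi β (Y ω θ J) ∂(gm P)) with hF
  set F' : ℝ → ℝ := fun θ => ev (fun ω => ∫ J, gib β (Y ω θ J)
    (fun σ => Real.cos θ * X ω σ - Real.sin θ * Gp c J σ) ∂(gm P)) with hF'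
  have hFd : ∀ θ, HasDerivAt F (F' θ) θ := fun θ => by
    simp only [hF, hF', ev]
    exact (HasDerivAt.fun_sum fun ω _ => hF1 ω θ).div_const _
  have hF'b : ∀ θ ∈ Set.Icc (0:ℝ) (Real.pi / 2), ‖F' θ‖ ≤ err := by
    intro θ hθ
    have c0 : 0 ≤ Real.cos θ := Real.cos_nonneg_of_mem_Icc ⟨by linarith [hθ.1, Real.pi_pos], hθ.2⟩
    have c1 : Real.cos θ ≤ 1 := Real.cos_le_one θ
    have s0 : 0 ≤ Real.sin θ := Real.sin_nonneg_of_nonneg_of_le_pi hθ.1 (by linarith [hθ.2, Real.pi_pos])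
    have s1 : Real.sin θ ≤ 1 := Real.sin_le_one θ
    have e1 : ∀ ω, ∫ J, gib β (Y ω θ J) (fun σ => Real.cos θ * X ω σ - Real.sin θ * Gp c J σ) ∂(gm P)
        = Real.cos θ * ∫ J, (gib β (Y ω θ J) (X ω) - Real.sin θ * gib2 β (Y ω θ J) w) ∂(gm P) := by
      intro ω
      have := gauss_ibp β (Real.cos θ) (fun σ => Real.sin θ * X ω σ) hC
      simp only [gib_sub, gib_mul]
      rw [integral_sub ((iX ω θ).const_mul _) ((iG ω θ).const_mul _), integral_const_mul,
        integral_const_mul, this, integral_sub (iX ω θ) ((iW ω θ).const_mul _), integral_const_mul]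
      ring
    have e2 : F' θ = Real.cos θ * ∫ J, (ev (fun ω => gib β (Y ω θ J) (X ω)) -
        Real.sin θ * ev (fun ω => gib2 β (Y ω θ J) w)) ∂(gm P) := by
      simp only [hF', e1]
      rw [ev_mul]
      congr 1
      simp only [← ev_mul, ← ev_sub]
      unfold ev
      rw [integral_div, integral_finset_sum]
      exact fun ω _ => (iX ω θ).sub ((iW ω θ).const_mul _)
    rw [e2, norm_mul, Real.norm_of_nonneg c0]
    have b : ‖∫ J, (ev (fun ω => gib β (Y ω θ J) (X ω)) -
        Real.sin θ * ev (fun ω => gib2 β (Y ω θ J) w)) ∂(gm P)‖ ≤ err := by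
      refine (norm_integral_le_of_norm_le_const (C := err) (ae_of_all _ fun J => ?_)).trans ?_
      · exact hX (Real.sin θ) (fun σ => Real.cos θ * Gp c J σ) s0 s1
      · simp
    nlinarith [norm_nonneg (∫ J, (ev (fun ω => gib β (Y ω θ J) (X ω)) -
        Real.sin θ * ev (fun ω => gib2 β (Y ω θ J) w)) ∂(gm P))]
  have herr : 0 ≤ err := (abs_nonneg _).trans (hX 0 0 le_rfl zero_le_one)
  have mv := Convex.norm_image_sub_le_of_norm_hasDerivWithin_le (f := F) (f' := F')
    (s := Set.Icc (0:ℝ) (Real.pi / 2)) (x := 0) (y := Real.pi / 2) (C := err)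
    (fun θ _ => (hFd θ).hasDerivWithinAt) hF'b (convex_Icc _ _)
    ⟨le_rfl, by positivity⟩ ⟨by positivity, le_rfl⟩
  have v1 : F (Real.pi / 2) = ev (fun ω => Phi β (X ω)) := by
    simp [hF, hY]
  have v0 : F 0 = ∫ J, Phi β (Gp c J) ∂(gm P) := by
    simp only [hF, hY, Real.sin_zero, Real.cos_zero, zero_mul, one_mul, zero_add]
    rw [ev_const]
  have hp : |Real.pi / 2| = Real.pi / 2 := abs_of_pos (by positivity)
  rw [v1, v0, Real.norm_eq_abs, Real.norm_eq_abs, sub_zero, hp] at mv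
  refine mv.trans ?_
  rw [mul_comm]
  exact mul_le_mul_of_nonneg_right (by linarith [Real.pi_le_four]) herr

end multi
end RB


namespace RB

/-! ### The comparison for balanced configurations -/

/-- balanced configurations -/
def Bal (n : ℕ) : Type := {σ : Fin n → Bool // ∑ i, spin (σ i) = 0}

noncomputable instance (n : ℕ) : Fintype (Bal n) := by
  classical
  unfold Bal
  infer_instance

lemma spin_sq (b : Bool) : spin b * spin b = 1 := by cases b <;> simp [spin]
lemma abs_spin (b : Bool) : |spin b| = 1 := by cases b <;> simp [spin]
lemma spin_mul (a b : Bool) : spin a * spin b = spin (a == b) := by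
  cases a <;> cases b <;> simp [spin]
lemma spin_not (b : Bool) : spin (!b) = - spin b := by cases b <;> simp [spin]

lemma rev_ne {n : ℕ} (hn : Even n) (i : Fin n) : Fin.rev i ≠ i := by
  intro h
  have := congrArg Fin.val h
  rw [Fin.val_rev] at this
  obtain ⟨k, hk⟩ := hn
  have := i.2
  omega

lemma Bal_nonempty {n : ℕ} (hn : Even n) : Nonempty (Bal n) := by
  refine ⟨⟨fun i => decide (i < Fin.rev i), ?_⟩⟩
  have h : ∑ i : Fin n, spin (decide (i < Fin.rev i)) =
      ∑ i : Fin n, - spin (decide (i < Fin.rev i)) := by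
    rw [← Equiv.sum_comp Fin.revPerm]
    refine Finset.sum_congr rfl fun i _ => ?_
    rw [← spin_not]
    congr 1
    simp only [Fin.revPerm_apply, Fin.rev_rev]
    have := rev_ne hn i
    rcases lt_trichotomy i (Fin.rev i) with h | h | h
    · simp [h, h.not_gt]
    · exact absurd h.symm this
    · simp [h, h.not_gt]
  rw [Finset.sum_neg_distrib] at h
  linarith

/-- the base matching -/
def iota (n γ : ℕ) : Equiv.Perm (Fin n × Fin γ) := Equiv.prodCongr Fin.revPerm (Equiv.refl _)

lemma iota_fpf {n : ℕ} (hn : Even n) (γ : ℕ) : FPF (iota n γ) := by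
  refine ⟨fun x => ?_, fun x hx => ?_⟩
  · exact Prod.ext (by simp [iota]) (by simp [iota])
  · have := congrArg Prod.fst hx
    exact rev_ne hn x.1 (by simpa [iota] using this)

noncomputable def sp {n : ℕ} (γ : ℕ) (σ : Bal n) (h : Fin n × Fin γ) : ℝ := spin (σ.1 h.1)

lemma sum_lift {n γ : ℕ} (f : Fin n → ℝ) : ∑ h : Fin n × Fin γ, f h.1 = γ * ∑ i, f i := by
  rw [Fintype.sum_prod_type]
  simp [Finset.mul_sum]

noncomputable def XX (n γ : ℕ) (π : Equiv.Perm (Fin n × Fin γ)) (σ : Bal n) : ℝ :=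
  Xh (iota n γ) (Real.sqrt γ)⁻¹ (sp γ) π σ

noncomputable def cc (n : ℕ) (p : Fin n × Fin n) (σ : Bal n) : ℝ :=
  (Real.sqrt (2 * n))⁻¹ * (spin (σ.1 p.1) * spin (σ.1 p.2))

lemma sum_cc (n : ℕ) (σ τ : Bal n) : ∑ p, cc n p σ * cc n p τ =
    (2 * (n:ℝ))⁻¹ * (∑ i, spin (σ.1 i) * spin (τ.1 i)) ^ 2 := by
  have h : (Real.sqrt (2 * n))⁻¹ * (Real.sqrt (2 * n))⁻¹ = (2 * (n:ℝ))⁻¹ := by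
    rw [← mul_inv, Real.mul_self_sqrt (by positivity)]
  rw [Fintype.sum_prod_type, sq, Finset.sum_mul_sum, Finset.mul_sum]
  refine Finset.sum_congr rfl fun i _ => ?_
  rw [Finset.mul_sum]
  refine Finset.sum_congr rfl fun j _ => ?_
  rw [← h]
  unfold cc
  ring

lemma exists_E {n γ : ℕ} (hn : Even n) (hn0 : 0 < n) (hγ : 0 < γ) :
    ∃ E : Equiv.Perm (Fin n × Fin γ) → ℝ,
      (∀ π (σ τ : Bal n), |fb (iota n γ) (sp γ σ) (sp γ τ) π| ≤ E π) ∧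
      (∀ π (σ τ : Bal n), |fb (iota n γ) (fun h => sp γ σ h * sp γ τ h)
        (fun h => sp γ σ h * sp γ τ h) π| ≤ E π) ∧ ev E ≤ 133 * n * Real.sqrt γ := by
  have h0 := iota_fpf hn γ
  have : Nonempty (Fin n × Fin γ) := ⟨(⟨0, hn0⟩, ⟨0, hγ⟩)⟩
  let I := (Fin n → Bool) × (Fin n → Bool)
  let L : (Fin n → Bool) → Fin n × Fin γ → ℝ := fun u h => spin (u h.1)
  have hL : ∀ u h, |L u h| ≤ 1 := fun u h => (abs_spin _).le
  let f : I → Equiv.Perm (Fin n × Fin γ) → ℝ := fun i π => fb (iota n γ) (L i.1) (L i.2) π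
  let E : Equiv.Perm (Fin n × Fin γ) → ℝ := fun π => univ.sup' univ_nonempty fun i : I => |f i π|
  have hE : ∀ π i, |f i π| ≤ E π := fun π i =>
    Finset.le_sup' (fun i : I => |f i π|) (mem_univ i)
  refine ⟨E, fun π σ τ => hE π (σ.1, τ.1), fun π σ τ => ?_, ?_⟩
  · have : (fun h => sp γ σ h * sp γ τ h) = L (fun i => σ.1 i == τ.1 i) := by
      ext h
      simp only [sp, L, spin_mul]
    rw [this]
    exact hE π (fun i => σ.1 i == τ.1 i, fun i => σ.1 i == τ.1 i)
  · have hs : 0 < Real.sqrt γ := Real.sqrt_pos.2 (by exact_mod_cast hγ)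
    have key := perm_max (f := f) (L := 8) (c := 2) (fun i => fb_lip h0 (hL _) (hL _))
      (fun i => abs_ev_fb_le h0 (hL _) (hL _)) (s := (Real.sqrt γ)⁻¹) (by positivity) E
      (fun π => by
        obtain ⟨i, _, hi⟩ := Finset.exists_mem_eq_sup' univ_nonempty fun i : I => |f i π|
        exact ⟨i, hi.le⟩)
    refine key.trans ?_
    have hcard : (Fintype.card I : ℝ) = 4 ^ n := by
      simp only [I, Fintype.card_prod, Fintype.card_fun, Fintype.card_bool, Fintype.card_fin]
      push_cast
      rw [← mul_pow]
      norm_num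
    have hn1 : (1:ℝ) ≤ n := by exact_mod_cast hn0
    have hlog : Real.log (2 * (Fintype.card I : ℝ)) ≤ 3 * n := by
      rw [hcard]
      have : (2:ℝ) * 4 ^ n = 2 ^ (2 * n + 1) := by rw [pow_succ, pow_mul]; norm_num; ring
      rw [this, Real.log_pow]
      have h2 : Real.log 2 ≤ 1 := by
        have := Real.log_two_lt_d9
        linarith
      have h3 : 0 ≤ Real.log 2 := Real.log_nonneg (by norm_num)
      push_cast
      nlinarith
    have hγ1 : 1 ≤ Real.sqrt γ := by
      rw [Real.one_le_sqrt]
      exact_mod_cast hγ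
    have hN : 2 * (Real.sqrt γ)⁻¹ * 8 ^ 2 * (Fintype.card (Fin n × Fin γ) : ℝ) = 128 * n * Real.sqrt γ := by
      simp only [Fintype.card_prod, Fintype.card_fin]
      push_cast
      have : (γ:ℝ) = Real.sqrt γ * Real.sqrt γ := (Real.mul_self_sqrt (by positivity)).symm
      field_simp
      rw [Real.sq_sqrt (by positivity)]
      ring
    rw [hN, div_inv_eq_mul]
    have := mul_le_mul_of_nonneg_right hlog hs.le
    nlinarith

lemma compare_Phi {n γ : ℕ} (hn : Even n) (hn0 : 0 < n) (hγ : 0 < γ) {β : ℝ} (hβ : 0 < β) :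
    |ev (fun π => Phi β (XX n γ π)) - ∫ J, Phi β (Gp (cc n) J) ∂(gm (Fin n × Fin n))|
      ≤ 2 * (n * ((1 + 202 * β + 48 * β ^ 2) / Real.sqrt γ)) := by
  have := Bal_nonempty hn
  have : Nonempty (Fin n × Fin γ) := ⟨(⟨0, hn0⟩, ⟨0, hγ⟩)⟩
  have hs : 0 < Real.sqrt γ := Real.sqrt_pos.2 (by exact_mod_cast hγ)
  have hss : Real.sqrt γ * Real.sqrt γ = γ := Real.mul_self_sqrt (by positivity)
  have hn1 : (1:ℝ) ≤ n := by exact_mod_cast hn0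
  have hγ1 : 1 ≤ Real.sqrt γ := by
    rw [Real.one_le_sqrt]
    exact_mod_cast hγ
  refine interpolation hβ (XX n γ) (C := (Real.sqrt (2 * n))⁻¹) (fun p σ => ?_) fun h g hh hh1 => ?_
  · unfold cc
    rw [abs_mul, abs_mul, abs_spin, abs_spin, mul_one, mul_one, abs_of_nonneg (by positivity)]
  · obtain ⟨E, hE1, hE2, hE3⟩ := exists_E hn hn0 hγ
    have key := stein (iota_fpf hn γ) (s := sp (n := n) γ) (κ := (Real.sqrt γ)⁻¹) (β := β) (h := h)
      (by positivity) hβ.le hh (fun σ h => spin_sq _)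
      (fun σ => by unfold sp; rw [sum_lift (fun i => spin (σ.1 i)), σ.2, mul_zero]) g E hE1 hE2
    have hW : ∀ y : Bal n → ℝ, gib2 β y (fun σ τ => β * ∑ p, (cc n p σ * cc n p σ - cc n p σ * cc n p τ))
      = (β * ((Real.sqrt γ)⁻¹) ^ 2 / (2 * Fintype.card (Fin n × Fin γ))) *
        gib2 β y (fun σ τ => (Fintype.card (Fin n × Fin γ) : ℝ) ^ 2
          - (∑ h, sp γ σ h * sp γ τ h) ^ 2) := by
      intro y
      rw [← gib2_mul]
      congr 1
      ext σ τ
      rw [Finset.sum_sub_distrib, sum_cc, sum_cc]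
      have e1 : ∑ h, sp γ σ h * sp γ τ h = γ * ∑ i, spin (σ.1 i) * spin (τ.1 i) :=
        sum_lift (fun i => spin (σ.1 i) * spin (τ.1 i))
      rw [e1]
      simp only [spin_sq, Finset.sum_const, card_univ, Fintype.card_fin, Fintype.card_prod]
      have hg0 : (γ:ℝ) ≠ 0 := by rw [← hss]; positivity
      rw [inv_pow, sq (Real.sqrt γ), hss]
      push_cast
      field_simp
      simp
    have hW2 : ev (fun π => gib2 β (fun σ => h * XX n γ π σ + g σ) (fun σ τ => β * ∑ p, (cc n p σ * cc n p σ - cc n p σ * cc n p τ)))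
      = (β * ((Real.sqrt γ)⁻¹) ^ 2 / (2 * Fintype.card (Fin n × Fin γ))) *
        ev (fun π => gib2 β (fun σ => h * XX n γ π σ + g σ) (fun σ τ => (Fintype.card (Fin n × Fin γ) : ℝ) ^ 2
          - (∑ h, sp γ σ h * sp γ τ h) ^ 2)) := by
      rw [← ev_mul]
      congr 1
      ext π
      exact hW _
    rw [hW2, ← mul_assoc]
    refine key.trans ?_
    simp only [Fintype.card_fin, Fintype.card_prod]
    push_cast
    set r := Real.sqrt γ with hr
    rw [← hss]
    have hb : h * β * r⁻¹ ^ 2 * (2 + 3 / 2 * ev E) ≤ β * r⁻¹ ^ 2 * (2 + 3 / 2 * (133 * n * r)) := by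
      have h1 : h * β * r⁻¹ ^ 2 * (2 + 3 / 2 * ev E) ≤ h * β * r⁻¹ ^ 2 * (2 + 3 / 2 * (133 * n * r)) := by
        gcongr
      refine h1.trans ?_
      have : h * β ≤ β := by nlinarith
      gcongr
    have hc : 48 * (n * (r * r)) * β ^ 2 * r⁻¹ ^ 3 * h ^ 2 ≤ 48 * (n * (r * r)) * β ^ 2 * r⁻¹ ^ 3 * 1 := by
      have : h ^ 2 ≤ 1 := by nlinarith
      gcongr
    have e1 : 48 * (n * (r * r)) * β ^ 2 * r⁻¹ ^ 3 * 1 = n * (48 * β ^ 2) * r⁻¹ := by field_simp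
    have e2 : β * r⁻¹ ^ 2 * (2 + 3 / 2 * (133 * n * r)) ≤ n * (202 * β) * r⁻¹ := by
      have e3 : n * (202 * β) * r⁻¹ - β * r⁻¹ ^ 2 * (2 + 3 / 2 * (133 * n * r)) =
        β * r⁻¹ ^ 2 * ((202 - 3/2*133) * n * r - 2) := by field_simp; ring
      have : 0 ≤ β * r⁻¹ ^ 2 * ((202 - 3/2*133) * n * r - 2) := by
        have : 0 ≤ (202 - 3/2*133) * n * r - 2 := by nlinarith
        positivity
      linarith
    have e4 : r⁻¹ ≤ n * r⁻¹ := le_mul_of_one_le_left (by positivity) hn1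
    rw [div_eq_mul_inv (1 + 202 * β + 48 * β ^ 2) r]
    linarith

section sup
variable {B : Type*} [Fintype B] [Nonempty B]

lemma le_sup (y : B → ℝ) (σ : B) : y σ ≤ ⨆ σ, y σ := le_ciSup (Set.finite_range y).bddAbove σ

lemma exists_sup (y : B → ℝ) : ∃ σ, (⨆ σ, y σ) = y σ := by
  obtain ⟨σ, hσ⟩ := exists_eq_ciSup_of_finite (f := y)
  exact ⟨σ, hσ.symm⟩

lemma sup_Phi {β : ℝ} (hβ : 0 < β) (y : B → ℝ) :
    (⨆ σ, y σ) ≤ Phi β y ∧ Phi β y ≤ (⨆ σ, y σ) + Real.log (Fintype.card B) / β :=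
  ⟨ciSup_le fun σ => le_Phi hβ y σ, Phi_le hβ y fun σ => le_sup y σ⟩

lemma abs_sup_sub_le (y z : B → ℝ) {L : ℝ} (h : ∀ σ, |y σ - z σ| ≤ L) :
    |(⨆ σ, y σ) - ⨆ σ, z σ| ≤ L := by
  rw [abs_le]
  constructor
  · obtain ⟨σ, hσ⟩ := exists_sup z
    have := le_sup y σ
    have := abs_le.1 (h σ)
    rw [hσ]
    linarith
  · obtain ⟨σ, hσ⟩ := exists_sup y
    have := le_sup z σ
    have := abs_le.1 (h σ)
    rw [hσ]
    linarith

lemma abs_sup_le (y : B → ℝ) {L : ℝ} (h : ∀ σ, |y σ| ≤ L) : |⨆ σ, y σ| ≤ L := by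
  obtain ⟨σ, hσ⟩ := exists_sup y
  rw [hσ]; exact h σ

lemma integrable_sup_Gp {P : Type*} [Fintype P] [DecidableEq P] {c : P → B → ℝ} {C : ℝ}
    (hC : ∀ p σ, |c p σ| ≤ C) : Integrable (fun J => ⨆ σ, Gp c J σ) (gm P) := by
  refine (integrable_sum_abs.const_mul C).mono' ?_ (ae_of_all _ fun J =>
    abs_sup_le _ (abs_Gp_le hC J))
  exact (Measurable.iSup fun σ => (continuous_Gp c σ).measurable).aestronglyMeasurable

end sup

lemma abs_cc_le {n : ℕ} (p : Fin n × Fin n) (σ : Bal n) : |cc n p σ| ≤ (Real.sqrt (2 * n))⁻¹ := by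
  unfold cc
  rw [abs_mul, abs_mul, abs_spin, abs_spin, mul_one, mul_one, abs_of_nonneg (by positivity)]

lemma log_card_Bal (n : ℕ) [Nonempty (Bal n)] : Real.log (Fintype.card (Bal n)) ≤ n := by
  have h1 : Fintype.card (Bal n) ≤ 2 ^ n := by
    have := Fintype.card_le_of_injective (fun σ : Bal n => σ.1) Subtype.val_injective
    simpa using this
  have h2 : (Fintype.card (Bal n) : ℝ) ≤ 2 ^ n := by exact_mod_cast h1
  have h0 : (0:ℝ) < Fintype.card (Bal n) := by exact_mod_cast Fintype.card_pos
  refine (Real.log_le_log h0 h2).trans ?_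
  rw [Real.log_pow]
  have := Real.log_two_lt_d9
  have : (0:ℝ) ≤ n := by positivity
  nlinarith

lemma compare_sup {n γ : ℕ} (hn : Even n) (hn0 : 0 < n) (hγ : 0 < γ) {β : ℝ} (hβ : 0 < β) :
    |ev (fun π => ⨆ σ, XX n γ π σ) - ∫ J, (⨆ σ, Gp (cc n) J σ) ∂(gm (Fin n × Fin n))|
      ≤ n * (2 * ((1 + 202 * β + 48 * β ^ 2) / Real.sqrt γ) + β⁻¹) := by
  have := Bal_nonempty hn
  have key := compare_Phi hn hn0 hγ hβ
  have hl : Real.log (Fintype.card (Bal n)) / β ≤ n * β⁻¹ := by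
    rw [div_eq_mul_inv]
    exact mul_le_mul_of_nonneg_right (log_card_Bal n) (by positivity)
  set l := Real.log (Fintype.card (Bal n)) / β with hldef
  have a1 : ev (fun π => ⨆ σ, XX n γ π σ) ≤ ev (fun π => Phi β (XX n γ π)) :=
    ev_mono fun π => (sup_Phi hβ _).1
  have a2 : ev (fun π => Phi β (XX n γ π)) ≤ ev (fun π => ⨆ σ, XX n γ π σ) + l := by
    have : ev (fun π => Phi β (XX n γ π)) ≤ ev (fun π => (⨆ σ, XX n γ π σ) + l) :=
      ev_mono fun π => (sup_Phi hβ _).2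
    rwa [ev_add, ev_const] at this
  have i1 := integrable_sup_Gp (B := Bal n) (P := Fin n × Fin n) (abs_cc_le (n := n))
  have i2 : Integrable (fun J => Phi β (Gp (cc n) J)) (gm (Fin n × Fin n)) := by
    have hb : Integrable (fun J => |⨆ σ, Gp (cc n) J σ| + l) (gm (Fin n × Fin n)) :=
      i1.abs.add (integrable_const _)
    refine hb.mono' (continuous_Phi β (continuous_Gp (cc n))).aestronglyMeasurable (ae_of_all _ fun J => ?_)
    have h1 := sup_Phi hβ (Gp (cc n) J)
    have h2 := neg_abs_le (⨆ σ, Gp (cc n) J σ)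
    have h3 := le_abs_self (⨆ σ, Gp (cc n) J σ)
    have h4 : 0 ≤ l := div_nonneg (Real.log_natCast_nonneg _) hβ.le
    rw [Real.norm_eq_abs, abs_le]
    constructor
    · linarith [h1.1]
    · linarith [h1.2]
  have b1 : ∫ J, (⨆ σ, Gp (cc n) J σ) ∂(gm (Fin n × Fin n)) ≤ ∫ J, Phi β (Gp (cc n) J) ∂(gm (Fin n × Fin n)) :=
    integral_mono i1 i2 fun J => (sup_Phi hβ _).1
  have b2 : ∫ J, Phi β (Gp (cc n) J) ∂(gm (Fin n × Fin n)) ≤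
      ∫ J, (⨆ σ, Gp (cc n) J σ) ∂(gm (Fin n × Fin n)) + l := by
    have : ∫ J, Phi β (Gp (cc n) J) ∂(gm (Fin n × Fin n)) ≤
      ∫ J, ((⨆ σ, Gp (cc n) J σ) + l) ∂(gm (Fin n × Fin n)) :=
      integral_mono i2 (i1.add (integrable_const _)) fun J => (sup_Phi hβ _).2
    rw [integral_add i1 (integrable_const _)] at this
    simpa using this
  have e : (n:ℝ) * (2 * ((1 + 202 * β + 48 * β ^ 2) / Real.sqrt γ) + β⁻¹) =
    2 * (n * ((1 + 202 * β + 48 * β ^ 2) / Real.sqrt γ)) + n * β⁻¹ := by ring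
  rw [e]
  rw [abs_le] at *
  constructor <;> linarith [key.1, key.2]

end RB


namespace RB

/-! ### Balanced SK versus full SK -/

abbrev Sp (n : ℕ) := Fin n → Bool

def mulS {n : ℕ} (σ τ : Sp n) : Sp n := fun i => σ i == τ i

lemma mulS_mulS {n : ℕ} (σ τ : Sp n) : mulS (mulS σ τ) τ = σ := by
  ext i
  simp only [mulS]
  cases σ i <;> cases τ i <;> rfl

def mulEquiv {n : ℕ} (σ : Sp n) : Sp n ≃ Sp n where
  toFun τ := mulS τ σ
  invFun τ := mulS τ σ
  left_inv τ := mulS_mulS τ σ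
  right_inv τ := mulS_mulS τ σ

lemma spin_mulS {n : ℕ} (σ τ : Sp n) (i : Fin n) : spin (mulS σ τ i) = spin (σ i) * spin (τ i) :=
  (spin_mul _ _).symm

noncomputable def cA (n : ℕ) (p : Fin n × Fin n) (σ : Sp n) : ℝ :=
  (Real.sqrt (2 * n))⁻¹ * (spin (σ p.1) * spin (σ p.2))

lemma sum_spin_int {n : ℕ} (η : Sp n) : ∑ i, spin (η i) =
    2 * ((univ.filter fun i => η i = true).card : ℝ) - n := by
  have : ∀ i, spin (η i) = 2 * (if η i = true then 1 else 0) - 1 := fun i => by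
    cases η i <;> simp [spin]; norm_num
  simp only [this, Finset.sum_sub_distrib, ← Finset.mul_sum]
  simp

/-- flipping a set inside `{η = c}` -/
lemma sum_flip {n : ℕ} (η : Sp n) (c : Bool) (F : Finset (Fin n)) (hF : ∀ i ∈ F, η i = c) :
    ∑ i, spin (if i ∈ F then !c else η i) = ∑ i, spin (η i) - 2 * spin c * F.card ∧
    ∑ i, spin (if i ∈ F then !c else η i) * spin (η i) = n - 2 * F.card := by
  constructor
  · have : ∀ i, spin (if i ∈ F then !c else η i) = spin (η i) - 2 * spin c * (if i ∈ F then 1 else 0) := by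
      intro i
      split_ifs with h
      · rw [hF i h, spin_not]; ring
      · ring
    simp only [this, Finset.sum_sub_distrib, ← Finset.mul_sum]
    simp
  · have : ∀ i, spin (if i ∈ F then !c else η i) * spin (η i) = 1 - 2 * (if i ∈ F then 1 else 0) := by
      intro i
      split_ifs with h
      · rw [hF i h, spin_not]
        have := spin_sq c
        linarith
      · rw [spin_sq]; ring
    simp only [this, Finset.sum_sub_distrib, ← Finset.mul_sum]
    simp

lemma exists_bal {n : ℕ} (hn : Even n) (η : Sp n) :
    ∃ b : Bal n, ∑ i, spin (b.1 i) * spin (η i) = n - |∑ i, spin (η i)| := by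
  have h1 := sum_spin_int η
  set p := (univ.filter fun i => η i = true).card with hp
  have h2 : p + (univ.filter fun i => η i = false).card = n := by
    have := Finset.card_filter_add_card_filter_not (s := (univ : Finset (Fin n))) (fun i => η i = true)
    simpa using this
  set q := (univ.filter fun i => η i = false).card with hq
  obtain ⟨k, hk⟩ := hn
  rcases le_total q p with h | h
  · obtain ⟨F, hF1, hF2⟩ := Finset.exists_subset_card_eq (s := univ.filter fun i => η i = true)
      (n := p - k) (by omega)
    have hf := sum_flip η true F (fun i hi => by simpa using hF1 hi)
    have e : (F.card : ℝ) = p - k := by rw [hF2, Nat.cast_sub (by omega)]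
    have ek : (n : ℝ) = k + k := by exact_mod_cast hk
    have e2 : (k:ℝ) ≤ p := by exact_mod_cast (by omega : k ≤ p)
    refine ⟨⟨fun i => if i ∈ F then !true else η i, ?_⟩, hf.2.trans ?_⟩
    · rw [hf.1, h1, e]; simp [spin]; linarith
    · rw [h1, abs_of_nonneg (by linarith), e]; linarith
  · obtain ⟨F, hF1, hF2⟩ := Finset.exists_subset_card_eq (s := univ.filter fun i => η i = false)
      (n := q - k) (by omega)
    have hf := sum_flip η false F (fun i hi => by simpa using hF1 hi)
    have e : (F.card : ℝ) = k - p := by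
      rw [hF2, Nat.cast_sub (by omega)]
      have : (p:ℝ) + q = k + k := by exact_mod_cast h2.trans hk
      linarith
    have ek : (n : ℝ) = k + k := by exact_mod_cast hk
    have e2 : (p:ℝ) ≤ k := by exact_mod_cast (by omega : p ≤ k)
    refine ⟨⟨fun i => if i ∈ F then !false else η i, ?_⟩, hf.2.trans ?_⟩
    · rw [hf.1, h1, e]; simp [spin]; linarith
    · rw [h1, abs_of_nonpos (by linarith), e]; linarith

lemma exists_perm_pair {α : Type*} [DecidableEq α] {i j k l : α} (hij : i ≠ j) (hkl : k ≠ l) :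
    ∃ ρ : Equiv.Perm α, ρ i = k ∧ ρ j = l := by
  refine ⟨Equiv.swap (Equiv.swap i k j) l * Equiv.swap i k, ?_, ?_⟩
  · simp only [Equiv.Perm.coe_mul, Function.comp_apply, Equiv.swap_apply_left]
    apply Equiv.swap_apply_of_ne_of_ne _ hkl
    intro h
    have := congrArg (Equiv.swap i k) h
    simp at this
    exact hij this
  · simp

/-- two-point function of a random permutation -/
lemma ev_perm_pair {n : ℕ} (hn : 2 ≤ n) (w : Fin n → ℝ) (hw : ∀ i, w i * w i = 1) {i j : Fin n}
    (hij : i ≠ j) : ev (fun π : Equiv.Perm (Fin n) => w (π i) * w (π j)) =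
      ((∑ i, w i) ^ 2 - n) / (n * (n - 1)) := by
  set c := ev (fun π : Equiv.Perm (Fin n) => w (π i) * w (π j)) with hc
  have h1 : ∀ k l, k ≠ l → ev (fun π : Equiv.Perm (Fin n) => w (π k) * w (π l)) = c := by
    intro k l hkl
    obtain ⟨ρ, r1, r2⟩ := exists_perm_pair hij hkl
    rw [hc, ← ev_equiv (Equiv.mulRight ρ) (fun π : Equiv.Perm (Fin n) => w (π i) * w (π j))]
    simp [r1, r2]
  have h2 : ∑ k, ∑ l, ev (fun π : Equiv.Perm (Fin n) => w (π k) * w (π l)) = (∑ i, w i) ^ 2 := by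
    simp only [← ev_sum]
    have : ∀ π : Equiv.Perm (Fin n), ∑ k, ∑ l, w (π k) * w (π l) = (∑ i, w i) ^ 2 := fun π => by
      rw [← Finset.sum_mul_sum, Equiv.sum_comp π w, sq]
    simp only [this, ev_const]
  have h3 : ∑ k, ∑ l, ev (fun π : Equiv.Perm (Fin n) => w (π k) * w (π l)) = n + n * (n - 1) * c := by
    have : ∀ k : Fin n, ∑ l, ev (fun π : Equiv.Perm (Fin n) => w (π k) * w (π l)) = 1 + (n - 1) * c := by
      intro k
      rw [← Finset.add_sum_erase _ _ (mem_univ k)]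
      simp only [hw, ev_const]
      rw [Finset.sum_congr rfl fun l hl => h1 k l (Finset.ne_of_mem_erase hl).symm, Finset.sum_const,
        Finset.card_erase_of_mem (mem_univ k)]
      simp [Nat.cast_sub (by omega : 1 ≤ n)]
    simp only [this, Finset.sum_const, card_univ, Fintype.card_fin, nsmul_eq_mul]
    ring
  have hn' : (2:ℝ) ≤ n := by exact_mod_cast hn
  rw [eq_div_iff (by nlinarith)]
  linarith

lemma ev_spin_sq {n : ℕ} : ev (fun η : Sp n => (∑ i, spin (η i)) ^ 2) = n := by
  have h : ∀ i j : Fin n, ev (fun η : Sp n => spin (η i) * spin (η j)) = if i = j then 1 else 0 := by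
    intro i j
    split_ifs with h
    · subst h; simp only [spin_sq, ev_const]
    · have e := ev_equiv (mulEquiv (fun k : Fin n => !decide (k = i)))
        (fun η : Sp n => spin (η i) * spin (η j))
      have : ∀ η : Sp n, spin (mulEquiv (fun k : Fin n => !decide (k = i)) η i) *
        spin (mulEquiv (fun k : Fin n => !decide (k = i)) η j) = - (spin (η i) * spin (η j)) := by
        intro η
        have hji : ¬ (j = i) := fun h' => h h'.symm
        simp only [mulEquiv, Equiv.coe_fn_mk, spin_mulS]
        simp only [hji, decide_true, decide_false, Bool.not_true, Bool.not_false]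
        cases η i <;> cases η j <;> simp [spin]
      simp only [this] at e
      rw [ev_neg] at e
      linarith
  simp only [sq, Finset.sum_mul_sum, ev_sum, h]
  simp

lemma ev_abs_spin {n : ℕ} : ev (fun η : Sp n => |∑ i, spin (η i)|) ≤ Real.sqrt n := by
  rcases Nat.eq_zero_or_pos n with h0 | h0
  · subst h0; simp [ev]
  have hs : 0 < Real.sqrt n := Real.sqrt_pos.2 (by exact_mod_cast h0)
  have h : ∀ η : Sp n, |∑ i, spin (η i)| ≤ (2 * Real.sqrt n)⁻¹ * (∑ i, spin (η i)) ^ 2 + Real.sqrt n / 2 := by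
    intro η
    set S := ∑ i, spin (η i)
    have e : (2 * Real.sqrt n)⁻¹ * S ^ 2 + Real.sqrt n / 2 - |S| =
      (2 * Real.sqrt n)⁻¹ * (|S| - Real.sqrt n) ^ 2 := by
      rw [← sq_abs S]; field_simp; ring
    have : 0 ≤ (2 * Real.sqrt n)⁻¹ * (|S| - Real.sqrt n) ^ 2 := by positivity
    linarith
  refine (ev_mono h).trans ?_
  rw [ev_add, ev_mul, ev_spin_sq, ev_const]
  have e : (n:ℝ) = Real.sqrt n * Real.sqrt n := (Real.mul_self_sqrt (by positivity)).symm
  have : (2 * Real.sqrt n)⁻¹ * (n:ℝ) = Real.sqrt n / 2 := by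
    field_simp
    rw [Real.sq_sqrt (by positivity)]
  rw [this]
  linarith

/-- The deterministic comparison after averaging over gauges. -/
lemma gauge_avg {n : ℕ} (hn : Even n) (hn2 : 2 ≤ n) :
    ∃ ρ : ℝ, 1 - 2 * Real.sqrt n / (n - 1) ≤ ρ ∧ ∀ J : Fin n × Fin n → ℝ,
    ρ * (⨆ σ : Sp n, Gp (cA n) J σ) + (1 - ρ) * ((Real.sqrt (2 * n))⁻¹ * ∑ i, J (i, i)) ≤
      ev (fun τ : Sp n => ⨆ b : Bal n, Gp (cA n) J (mulS b.1 τ)) := by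
  have := Bal_nonempty hn
  have hn' : (2:ℝ) ≤ n := by exact_mod_cast hn2
  choose b hb using exists_bal hn
  let w : Sp n → Fin n → ℝ := fun η i => spin ((b η).1 i) * spin (η i)
  have hww : ∀ η i, w η i * w η i = 1 := fun η i => by
    have h1 := spin_sq ((b η).1 i)
    have h2 := spin_sq (η i)
    calc w η i * w η i = (spin ((b η).1 i) * spin ((b η).1 i)) * (spin (η i) * spin (η i)) := by
          simp only [w]; ring
      _ = 1 := by rw [h1, h2, one_mul]
  refine ⟨ev (fun η => ((∑ i, w η i) ^ 2 - n) / (n * (n - 1))), ?_, fun J => ?_⟩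
  · have h1 : ∀ η : Sp n, 1 - 2 / (n - 1) * |∑ i, spin (η i)| ≤
        ((∑ i, w η i) ^ 2 - n) / (n * (n - 1)) := by
      intro η
      have : ∑ i, w η i = n - |∑ i, spin (η i)| := hb η
      rw [this]
      set S := |∑ i, spin (η i)|
      have e : ((n - S) ^ 2 - n) / (n * ((n:ℝ) - 1)) - (1 - 2 / (n - 1) * S) =
        S ^ 2 / (n * ((n:ℝ) - 1)) := by
        have : (n:ℝ) - 1 ≠ 0 := by linarith
        field_simp
        ring
      have : 0 ≤ S ^ 2 / (n * ((n:ℝ) - 1)) := by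
        apply div_nonneg (sq_nonneg _)
        apply mul_nonneg <;> linarith
      linarith
    refine le_trans ?_ (ev_mono h1)
    rw [ev_sub, ev_mul, ev_const]
    have h2 := ev_abs_spin (n := n)
    have h3 : 0 ≤ 2 / ((n:ℝ) - 1) := div_nonneg (by norm_num) (by linarith)
    have h4 := mul_le_mul_of_nonneg_left h2 h3
    have h5 : 2 * Real.sqrt n / ((n:ℝ) - 1) = 2 / ((n:ℝ) - 1) * Real.sqrt n := by ring
    rw [h5]
    linarith
  · obtain ⟨σ, hσ⟩ := exists_sup (fun σ : Sp n => Gp (cA n) J σ)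
    rw [hσ]
    -- lower bound for each gauge and permutation
    let e : Sp n → Equiv.Perm (Fin n) → Sp n := fun η π => η ∘ π
    have step1 : ∀ (π : Equiv.Perm (Fin n)) (η : Sp n),
        (Real.sqrt (2 * n))⁻¹ * ∑ p : Fin n × Fin n, J p * (spin (σ p.1) * spin (σ p.2)) *
          (w (η ∘ π.symm) (π p.1) * w (η ∘ π.symm) (π p.2)) ≤
        ⨆ b : Bal n, Gp (cA n) J (mulS b.1 (mulS η σ)) := by
      intro π η
      have hbal : ∑ i, spin ((b (η ∘ π.symm)).1 (π i)) = 0 := by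
        rw [Equiv.sum_comp π fun i => spin ((b (η ∘ π.symm)).1 i)]
        exact (b (η ∘ π.symm)).2
      let b' : Bal n := ⟨fun i => (b (η ∘ π.symm)).1 (π i), hbal⟩
      refine le_trans (le_of_eq ?_) (le_sup (fun b : Bal n => Gp (cA n) J (mulS b.1 (mulS η σ))) b')
      simp only [Gp, cA, Finset.mul_sum]
      refine Finset.sum_congr rfl fun p _ => ?_
      simp only [spin_mulS, w, b', Function.comp_apply, Equiv.symm_apply_apply]
      ring
    have step2 : ev (fun τ : Sp n => ⨆ b : Bal n, Gp (cA n) J (mulS b.1 τ)) =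
        ev (fun η : Sp n => ⨆ b : Bal n, Gp (cA n) J (mulS b.1 (mulS η σ))) :=
      (ev_equiv (mulEquiv σ) _).symm
    rw [step2]
    have step3 : ev (fun η : Sp n => ev (fun π : Equiv.Perm (Fin n) =>
        (Real.sqrt (2 * n))⁻¹ * ∑ p : Fin n × Fin n, J p * (spin (σ p.1) * spin (σ p.2)) *
          (w (η ∘ π.symm) (π p.1) * w (η ∘ π.symm) (π p.2)))) ≤
        ev (fun η : Sp n => ⨆ b : Bal n, Gp (cA n) J (mulS b.1 (mulS η σ))) :=
      ev_mono fun η => ev_le_const fun π => step1 π η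
    refine le_trans (le_of_eq ?_) step3
    have step4 : ∀ p : Fin n × Fin n, ev (fun η : Sp n => ev (fun π : Equiv.Perm (Fin n) =>
        w (η ∘ π.symm) (π p.1) * w (η ∘ π.symm) (π p.2))) =
        ev (fun η : Sp n => ev (fun π : Equiv.Perm (Fin n) => w η (π p.1) * w η (π p.2))) := by
      intro p
      have swap : ∀ f : Sp n → Equiv.Perm (Fin n) → ℝ, ev (fun η => ev (fun π => f η π)) =
          ev (fun π => ev (fun η => f η π)) := by
        intro f
        unfold ev
        simp only [← Finset.sum_div]
        rw [Finset.sum_comm, div_right_comm]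
      rw [swap, swap]
      congr 1
      ext π
      exact ev_equiv (Equiv.arrowCongr π (Equiv.refl Bool))
        (fun η : Sp n => w η (π p.1) * w η (π p.2))
    have step5 : ev (fun η : Sp n => ev (fun π : Equiv.Perm (Fin n) =>
        (Real.sqrt (2 * n))⁻¹ * ∑ p : Fin n × Fin n, J p * (spin (σ p.1) * spin (σ p.2)) *
          (w (η ∘ π.symm) (π p.1) * w (η ∘ π.symm) (π p.2)))) =
        (Real.sqrt (2 * n))⁻¹ * ∑ p : Fin n × Fin n, J p * (spin (σ p.1) * spin (σ p.2)) *
          ev (fun η : Sp n => ev (fun π : Equiv.Perm (Fin n) => w η (π p.1) * w η (π p.2))) := by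
      simp only [ev_mul, ev_sum, step4]
    rw [step5]
    set ρ := ev (fun η => ((∑ i, w η i) ^ 2 - n) / (n * ((n:ℝ) - 1)))
    have step6 : ∀ p : Fin n × Fin n, ev (fun η : Sp n => ev (fun π : Equiv.Perm (Fin n) =>
        w η (π p.1) * w η (π p.2))) = ρ + (1 - ρ) * (if p.1 = p.2 then 1 else 0) := by
      intro p
      split_ifs with h
      · rw [h]; simp only [hww, ev_const]; ring
      · simp only [ev_perm_pair hn2 _ (hww _) h]; simp [ρ]
    simp only [step6]
    have step7 : ∑ p : Fin n × Fin n, J p * (spin (σ p.1) * spin (σ p.2)) *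
        (ρ + (1 - ρ) * (if p.1 = p.2 then 1 else 0)) =
        ρ * ∑ p : Fin n × Fin n, J p * (spin (σ p.1) * spin (σ p.2)) + (1 - ρ) * ∑ i, J (i, i) := by
      have : ∀ p : Fin n × Fin n, J p * (spin (σ p.1) * spin (σ p.2)) *
        (ρ + (1 - ρ) * (if p.1 = p.2 then 1 else 0)) = ρ * (J p * (spin (σ p.1) * spin (σ p.2))) +
          (1 - ρ) * (if p.1 = p.2 then J p else 0) := by
        intro p
        split_ifs with h
        · rw [h, spin_sq]; ring
        · ring
      simp only [this, Finset.sum_add_distrib, ← Finset.mul_sum]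
      congr 2
      rw [Fintype.sum_prod_type]
      simp
    rw [step7]
    have step8 : Gp (cA n) J σ = (Real.sqrt (2 * n))⁻¹ *
        ∑ p : Fin n × Fin n, J p * (spin (σ p.1) * spin (σ p.2)) := by
      unfold Gp cA
      rw [Finset.mul_sum]
      exact Finset.sum_congr rfl fun p _ => by ring
    rw [step8]
    ring

lemma mp_gauge {n : ℕ} (τ : Sp n) : MeasurePreserving
    (fun (J : Fin n × Fin n → ℝ) p => spin (τ p.1) * spin (τ p.2) * J p)
    (gm (Fin n × Fin n)) (gm (Fin n × Fin n)) := by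
  refine measurePreserving_pi (fun _ => gs) (fun _ => gs)
    (f := fun (p : Fin n × Fin n) x => spin (τ p.1) * spin (τ p.2) * x) fun p => ?_
  refine ⟨measurable_const_mul _, ?_⟩
  unfold gs
  rw [ProbabilityTheory.gaussianReal_map_const_mul]
  congr 1
  · simp
  · ext
    have h1 := spin_sq (τ p.1)
    have h2 := spin_sq (τ p.2)
    simp only [NNReal.coe_mul, NNReal.coe_mk, NNReal.coe_one, mul_one]
    calc (spin (τ p.1) * spin (τ p.2)) ^ 2 =
      (spin (τ p.1) * spin (τ p.1)) * (spin (τ p.2) * spin (τ p.2)) := by ring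
      _ = 1 := by rw [h1, h2, one_mul]

lemma abs_cA_le {n : ℕ} (p : Fin n × Fin n) (σ : Sp n) : |cA n p σ| ≤ (Real.sqrt (2 * n))⁻¹ := by
  unfold cA
  rw [abs_mul, abs_mul, abs_spin, abs_spin, mul_one, mul_one, abs_of_nonneg (by positivity)]

lemma integral_coord {P : Type*} [Fintype P] [DecidableEq P] (p : P) :
    ∫ J : P → ℝ, J p ∂(gm P) = 0 := by
  have h := measurePreserving_eval (fun _ : P => gs) p
  have h2 := integral_map (μ := gm P) h.measurable.aemeasurable (f := fun x : ℝ => x)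
    aestronglyMeasurable_id
  rw [h.map_eq] at h2
  simp only [Function.eval] at h2
  rw [← h2]
  exact ProbabilityTheory.integral_id_gaussianReal

lemma SK_lower {n : ℕ} (hn : Even n) (hn2 : 2 ≤ n) :
    (1 - 2 * Real.sqrt n / (n - 1)) * ∫ J, (⨆ σ : Sp n, Gp (cA n) J σ) ∂(gm (Fin n × Fin n)) ≤
      ∫ J, (⨆ σ : Bal n, Gp (cc n) J σ) ∂(gm (Fin n × Fin n)) := by
  have := Bal_nonempty hn
  obtain ⟨ρ, hρ, hJ⟩ := gauge_avg hn hn2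
  have i1 := integrable_sup_Gp (P := Fin n × Fin n) (abs_cA_le (n := n))
  have i2 := integrable_sup_Gp (P := Fin n × Fin n) (abs_cc_le (n := n))
  have hpos : 0 ≤ ∫ J, (⨆ σ : Sp n, Gp (cA n) J σ) ∂(gm (Fin n × Fin n)) := by
    have ig : Integrable (fun J => Gp (cA n) J (fun _ => true)) (gm (Fin n × Fin n)) :=
      integrable_finset_sum _ fun p _ => (integrable_coord p).mul_const _
    have : ∫ J, Gp (cA n) J (fun _ => true) ∂(gm (Fin n × Fin n)) = 0 := by
      unfold Gp
      rw [integral_finset_sum _ fun p _ => (integrable_coord p).mul_const _]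
      refine Finset.sum_eq_zero fun p _ => ?_
      rw [integral_mul_const, integral_coord, zero_mul]
    rw [← this]
    exact integral_mono ig i1 fun J => le_sup (fun σ => Gp (cA n) J σ) _
  have hg : ∀ (τ : Sp n) (J : Fin n × Fin n → ℝ), (⨆ b : Bal n, Gp (cA n) J (mulS b.1 τ)) =
      ⨆ b : Bal n, Gp (cc n) (fun p => spin (τ p.1) * spin (τ p.2) * J p) b := by
    intro τ J
    congr 1
    ext b
    unfold Gp cA cc
    refine Finset.sum_congr rfl fun p _ => ?_
    simp only [spin_mulS]
    ring
  have i3 : ∀ τ : Sp n, Integrable (fun J => ⨆ b : Bal n, Gp (cA n) J (mulS b.1 τ))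
      (gm (Fin n × Fin n)) := by
    intro τ
    simp only [hg]
    exact ((mp_gauge τ).integrable_comp i2.aestronglyMeasurable).2 i2
  have e3 : ∀ τ : Sp n, ∫ J, (⨆ b : Bal n, Gp (cA n) J (mulS b.1 τ)) ∂(gm (Fin n × Fin n)) =
      ∫ J, (⨆ σ : Bal n, Gp (cc n) J σ) ∂(gm (Fin n × Fin n)) := by
    intro τ
    simp only [hg]
    have h := mp_gauge τ
    have h2 := integral_map (μ := gm (Fin n × Fin n)) h.measurable.aemeasurable
      (f := fun J => ⨆ σ : Bal n, Gp (cc n) J σ) (by rw [h.map_eq]; exact i2.aestronglyMeasurable)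
    rw [h.map_eq] at h2
    exact h2.symm
  have e4 : ∫ J, ev (fun τ : Sp n => ⨆ b : Bal n, Gp (cA n) J (mulS b.1 τ)) ∂(gm (Fin n × Fin n)) =
      ∫ J, (⨆ σ : Bal n, Gp (cc n) J σ) ∂(gm (Fin n × Fin n)) := by
    have : ∫ J, ev (fun τ : Sp n => ⨆ b : Bal n, Gp (cA n) J (mulS b.1 τ)) ∂(gm (Fin n × Fin n)) =
      ev (fun τ : Sp n => ∫ J, (⨆ b : Bal n, Gp (cA n) J (mulS b.1 τ)) ∂(gm (Fin n × Fin n))) := by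
      unfold ev
      rw [integral_div, integral_finset_sum _ fun τ _ => i3 τ]
    rw [this]
    simp only [e3, ev_const]
  have iev : Integrable (fun J => ev (fun τ : Sp n => ⨆ b : Bal n, Gp (cA n) J (mulS b.1 τ)))
      (gm (Fin n × Fin n)) := by
    unfold ev
    exact (integrable_finset_sum _ fun τ _ => i3 τ).div_const _
  have idiag : Integrable (fun J : Fin n × Fin n → ℝ => ∑ i, J (i, i)) (gm (Fin n × Fin n)) :=
    integrable_finset_sum _ fun i _ => integrable_coord (i, i)
  have hdiag : ∫ J : Fin n × Fin n → ℝ, ∑ i, J (i, i) ∂(gm (Fin n × Fin n)) = 0 := by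
    rw [integral_finset_sum _ fun i _ => integrable_coord (i, i)]
    exact Finset.sum_eq_zero fun i _ => integral_coord (i, i)
  have key := integral_mono ((i1.const_mul ρ).add ((idiag.const_mul ((Real.sqrt (2 * n))⁻¹)).const_mul
    (1 - ρ))) iev hJ
  simp only [Pi.add_apply] at key
  rw [integral_add (i1.const_mul ρ) ((idiag.const_mul ((Real.sqrt (2 * n))⁻¹)).const_mul
    (1 - ρ)), integral_const_mul, integral_const_mul, integral_const_mul, hdiag, e4] at key
  have := mul_le_mul_of_nonneg_right hρ hpos
  linarith

lemma SK_upper {n : ℕ} (hn : Even n) :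
      ∫ J, (⨆ σ : Bal n, Gp (cc n) J σ) ∂(gm (Fin n × Fin n)) ≤
      ∫ J, (⨆ σ : Sp n, Gp (cA n) J σ) ∂(gm (Fin n × Fin n)) := by
  have := Bal_nonempty hn
  refine integral_mono (integrable_sup_Gp (P := Fin n × Fin n) (abs_cc_le (n := n)))
    (integrable_sup_Gp (P := Fin n × Fin n) (abs_cA_le (n := n))) fun J => ?_
  exact ciSup_le fun σ => le_sup (fun σ => Gp (cA n) J σ) σ.1

lemma SK_eq (n : ℕ) : ∫ J, (⨆ σ : Fin n → Bool, -HSK n J σ) ∂(skMeasure n) =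
    ∫ J, (⨆ σ : Sp n, Gp (cA n) J σ) ∂(gm (Fin n × Fin n)) := by
  have : ∀ J (σ : Fin n → Bool), -HSK n J σ = Gp (cA n) J σ := fun J σ => by
    unfold HSK Gp cA
    rw [neg_mul, neg_neg, Finset.mul_sum]
    exact Finset.sum_congr rfl fun p _ => by ring
  simp only [this]
  rfl

/-- Convergence of the balanced SK maximum along even sizes. -/
lemma SK_bal_tendsto {Pstar : ℝ} (hP : Tendsto (fun n : ℕ =>
        (n : ℝ)⁻¹ * ∫ J, (⨆ σ : Fin n → Bool, -HSK n J σ) ∂(skMeasure n)) atTop (nhds Pstar)) :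
    Tendsto (fun n : ℕ => (n : ℝ)⁻¹ * ∫ J, (⨆ σ : Bal n, Gp (cc n) J σ) ∂(gm (Fin n × Fin n)))
      (atTop ⊓ Filter.principal {n : ℕ | Even n}) (nhds Pstar) := by
  have hP' := hP.mono_left (inf_le_left : atTop ⊓ Filter.principal {n : ℕ | Even n} ≤ atTop)
  have hr : Tendsto (fun n : ℕ => 1 - 2 * Real.sqrt n / ((n:ℝ) - 1)) atTop (nhds 1) := by
    have h1 : Tendsto (fun n : ℕ => 4 * (Real.sqrt n)⁻¹) atTop (nhds 0) := by
      have := (tendsto_inv_atTop_zero.comp (Real.tendsto_sqrt_atTop.comp tendsto_natCast_atTop_atTop)).const_mul (4:ℝ)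
      simpa using this
    have h2 : Tendsto (fun n : ℕ => 2 * Real.sqrt n / ((n:ℝ) - 1)) atTop (nhds 0) := by
      refine tendsto_of_tendsto_of_tendsto_of_le_of_le' tendsto_const_nhds h1 ?_ ?_
      · filter_upwards [eventually_ge_atTop 2] with n hn
        have : (2:ℝ) ≤ n := by exact_mod_cast hn
        apply div_nonneg (by positivity) (by linarith)
      · filter_upwards [eventually_ge_atTop 2] with n hn
        have h2 : (2:ℝ) ≤ n := by exact_mod_cast hn
        have hs : 0 < Real.sqrt n := Real.sqrt_pos.2 (by linarith)
        rw [div_le_iff₀ (by linarith)]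
        have e : (n:ℝ) = Real.sqrt n * Real.sqrt n := (Real.mul_self_sqrt (by positivity)).symm
        have e2 : 4 * (Real.sqrt n)⁻¹ * n = 4 * Real.sqrt n := by
          field_simp
          rw [Real.sq_sqrt (by positivity)]
        have e3 : 4 * (Real.sqrt n)⁻¹ * 1 ≤ 2 * Real.sqrt n := by
          rw [mul_one, ← div_eq_mul_inv, div_le_iff₀ hs]
          nlinarith
        linarith
    simpa using h2.const_sub 1
  have hr' := hr.mono_left (inf_le_left : atTop ⊓ Filter.principal {n : ℕ | Even n} ≤ atTop)
  have hlow := hr'.mul hP'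
  rw [one_mul] at hlow
  have hev : ∀ᶠ n in atTop ⊓ Filter.principal {n : ℕ | Even n}, Even n ∧ 2 ≤ n := by
    rw [eventually_inf_principal]
    filter_upwards [eventually_ge_atTop 2] with n hn he
    exact ⟨he, hn⟩
  refine tendsto_of_tendsto_of_tendsto_of_le_of_le' hlow hP' ?_ ?_
  · filter_upwards [hev] with n hn
    rw [SK_eq]
    have := mul_le_mul_of_nonneg_left (SK_lower hn.1 hn.2) (by positivity : 0 ≤ (n:ℝ)⁻¹)
    linarith
  · filter_upwards [hev] with n hn
    rw [SK_eq]
    exact mul_le_mul_of_nonneg_left (SK_upper hn.1) (by positivity : 0 ≤ (n:ℝ)⁻¹)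

end RB

namespace RB

/-- a half-edge is bad if it lies on a loop or on a multiple edge -/
def Bad {n γ : ℕ} (M : Equiv.Perm (Fin n × Fin γ)) (h : Fin n × Fin γ) : Prop :=
  (M h).1 = h.1 ∨ ∃ h', h' ≠ h ∧ h'.1 = h.1 ∧ (M h').1 = (M h).1

open Classical in
noncomputable def badSet {n γ : ℕ} (M : Equiv.Perm (Fin n × Fin γ)) : Finset (Fin n × Fin γ) :=
  univ.filter fun h => Bad M h

lemma mem_badSet {n γ : ℕ} (M : Equiv.Perm (Fin n × Fin γ)) (h : Fin n × Fin γ) :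
    h ∈ badSet M ↔ Bad M h := by simp [badSet]

/-- switching -/
lemma bad_switch {n γ : ℕ} (M M' : Equiv.Perm (Fin n × Fin γ)) (hM : ∀ x, M (M x) = x)
    (h c : Fin n × Fin γ) (g d : Fin n × Fin γ) (hg : g = M h) (hd : d = M c)
    (h1 : M' h = c) (h2 : M' c = h) (h3 : M' g = d) (h4 : M' d = g)
    (h5 : ∀ k, k ≠ h → k ≠ c → k ≠ g → k ≠ d → M' k = M k)
    (hc : ¬ Bad M c)
    (n1 : c.1 ≠ h.1) (n2 : c.1 ≠ g.1) (n3 : d.1 ≠ h.1) (n4 : d.1 ≠ g.1)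
    (a1 : ∀ k, k.1 = h.1 → (M k).1 ≠ c.1) (a2 : ∀ k, k.1 = h.1 → (M k).1 ≠ d.1)
    (a3 : ∀ k, k.1 = g.1 → (M k).1 ≠ c.1) (a4 : ∀ k, k.1 = g.1 → (M k).1 ≠ d.1)
    (k : Fin n × Fin γ) (hk : Bad M' k) : Bad M k ∧ k ≠ h := by
  have hcd : c.1 ≠ d.1 := fun e => hc (Or.inl (by rw [← hd, e]))
  -- symmetric versions
  have b1 : ∀ k, k.1 = c.1 → (M k).1 ≠ h.1 := fun k e e' => a1 (M k) e' (by rw [hM, e])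
  have b2 : ∀ k, k.1 = d.1 → (M k).1 ≠ h.1 := fun k e e' => a2 (M k) e' (by rw [hM, e])
  have b3 : ∀ k, k.1 = c.1 → (M k).1 ≠ g.1 := fun k e e' => a3 (M k) e' (by rw [hM, e])
  have b4 : ∀ k, k.1 = d.1 → (M k).1 ≠ g.1 := fun k e e' => a4 (M k) e' (by rw [hM, e])
  have tr : ∀ k, (k = h ∨ k = c ∨ k = g ∨ k = d) ∨ (M' k = M k ∧ k ≠ h) := by
    intro k
    by_cases e1 : k = h
    · tauto
    by_cases e2 : k = c
    · tauto
    by_cases e3 : k = g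
    · tauto
    by_cases e4 : k = d
    · tauto
    exact Or.inr ⟨h5 k e1 e2 e3 e4, e1⟩
  rcases hk with hl | ⟨k', q1, q2, q3⟩
  · rcases tr k with (rfl | rfl | rfl | rfl) | ⟨e, e'⟩
    · rw [h1] at hl; exact absurd hl n1
    · rw [h2] at hl; exact absurd hl.symm n1
    · rw [h3] at hl; exact absurd hl n4
    · rw [h4] at hl; exact absurd hl.symm n4
    · rw [e] at hl; exact ⟨Or.inl hl, e'⟩
  · rcases tr k with (rfl | rfl | rfl | rfl) | ⟨e, e'⟩ <;>
    rcases tr k' with (rfl | rfl | rfl | rfl) | ⟨f, f'⟩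
    all_goals first
      | exact absurd rfl q1
      | (simp only [h1, h2, h3, h4, e, f] at q3
         grind)
      | (simp only [h1, h2, h3, h4, e] at q3
         grind)
      | (simp only [h1, h2, h3, h4, f] at q3
         grind)
      | (simp only [h1, h2, h3, h4] at q3
         grind)
      | (rw [e, f] at q3
         exact ⟨Or.inr ⟨k', q1, q2, q3⟩, e'⟩)

lemma exists_switch {n γ K : ℕ} {ι₀ : Equiv.Perm (Fin n × Fin γ)} (h0 : FPF ι₀)
    (hN : K + 8 * (γ + 1) * γ < n * γ) (π : Equiv.Perm (Fin n × Fin γ))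
    (hK : (badSet (Mt ι₀ π)).card ≤ K) (hpos : 0 < (badSet (Mt ι₀ π)).card) :
    ∃ a c, (badSet (Mt ι₀ (Equiv.swap a c * π))).card < (badSet (Mt ι₀ π)).card := by
  classical
  set M := Mt ι₀ π with hMdef
  have hM := (Mt_fpf h0 π).1
  have hM2 := (Mt_fpf h0 π).2
  obtain ⟨h, hh⟩ := Finset.card_pos.mp hpos
  set g := M h with hg
  -- forbidden vertices
  let S : Finset (Fin n) := {h.1, g.1} ∪ (univ.image fun i : Fin γ => (M (h.1, i)).1)
    ∪ (univ.image fun i : Fin γ => (M (g.1, i)).1)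
  have hS : S.card ≤ 2 + γ + γ := by
    refine (Finset.card_union_le _ _).trans (Nat.add_le_add ((Finset.card_union_le _ _).trans
      (Nat.add_le_add Finset.card_le_two ?_)) ?_)
    · exact Finset.card_image_le.trans (by simp)
    · exact Finset.card_image_le.trans (by simp)
  let T : Finset (Fin n × Fin γ) := S ×ˢ univ
  have hT : T.card ≤ (2 + γ + γ) * γ := by
    rw [Finset.card_product]; simp only [card_univ, Fintype.card_fin]
    exact Nat.mul_le_mul_right _ hS
  let U := badSet M ∪ T ∪ T.image M
  have hU : U.card < (univ : Finset (Fin n × Fin γ)).card := by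
    have h1 : U.card ≤ K + (2 + γ + γ) * γ + (2 + γ + γ) * γ :=
      (Finset.card_union_le _ _).trans (Nat.add_le_add ((Finset.card_union_le _ _).trans
      (Nat.add_le_add hK hT)) (Finset.card_image_le.trans hT))
    have h2 : (univ : Finset (Fin n × Fin γ)).card = n * γ := by simp
    rw [h2]
    nlinarith
  obtain ⟨c, -, hc⟩ := Finset.exists_mem_notMem_of_card_lt_card hU
  set d := M c with hd
  have hc1 : ¬ Bad M c := fun h => hc (by simp [U, mem_badSet, h])
  have hc2 : c.1 ∉ S := fun h => hc (by simp [U, T, h])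
  have hd2 : d.1 ∉ S := fun h => hc (by
    simp only [U, Finset.mem_union, Finset.mem_image]
    exact Or.inr ⟨d, by simp [T, h], hM c⟩)
  have key : ∀ w, w ∉ S → w ≠ h.1 ∧ w ≠ g.1 ∧ (∀ k : Fin n × Fin γ, k.1 = h.1 → (M k).1 ≠ w) ∧
      (∀ k : Fin n × Fin γ, k.1 = g.1 → (M k).1 ≠ w) := by
    intro w hw
    refine ⟨fun e => hw (by simp [S, e]), fun e => hw (by simp [S, e]), ?_, ?_⟩
    · rintro ⟨k1, k2⟩ e1 e2
      refine hw ?_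
      simp only at e1
      subst e1
      simp only [S, Finset.mem_union, Finset.mem_image]
      exact Or.inl (Or.inr ⟨k2, mem_univ _, e2⟩)
    · rintro ⟨k1, k2⟩ e1 e2
      refine hw ?_
      simp only at e1
      subst e1
      simp only [S, Finset.mem_union, Finset.mem_image]
      exact Or.inr ⟨k2, mem_univ _, e2⟩
  obtain ⟨n1, n2, a1, a3⟩ := key _ hc2
  obtain ⟨n3, n4, a2, a4⟩ := key _ hd2
  have hch : c ≠ h := fun e => n1 (by rw [e])
  have hcg : c ≠ g := fun e => n2 (by rw [e])
  have hdh : d ≠ h := fun e => n3 (by rw [e])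
  have hdg : d ≠ g := fun e => n4 (by rw [e])
  have hgh : g ≠ h := hM2 h
  have hdc : d ≠ c := hM2 c
  have hMg : M g = h := hM h
  have hMd : M d = c := hM c
  refine ⟨g, c, Finset.card_lt_card ?_⟩
  have sw := Mt_swap (ι₀ := ι₀) g c π
  have main := bad_switch M (Mt ι₀ (Equiv.swap g c * π)) hM h c g d rfl rfl
    (by rw [sw, Equiv.swap_apply_of_ne_of_ne hgh.symm hch.symm, ← hMdef, ← hg, Equiv.swap_apply_left])
    (by rw [sw, Equiv.swap_apply_right, ← hMdef, hMg, Equiv.swap_apply_of_ne_of_ne hgh.symm hch.symm])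
    (by rw [sw, Equiv.swap_apply_left, ← hMdef, ← hd, Equiv.swap_apply_of_ne_of_ne hdg hdc])
    (by rw [sw, Equiv.swap_apply_of_ne_of_ne hdg hdc, ← hMdef, hMd, Equiv.swap_apply_right])
    (by
      intro k k1 k2 k3 k4
      rw [sw, Equiv.swap_apply_of_ne_of_ne k3 k2, ← hMdef, Equiv.swap_apply_of_ne_of_ne]
      · intro e; apply k1; rw [← hM k, e, hMg]
      · intro e; apply k4; rw [← hM k, e])
    hc1 n1 n2 n3 n4 a1 a2 a3 a4
  rw [Finset.ssubset_iff_of_subset]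
  · exact ⟨h, hh, fun h' => (main h ((mem_badSet _ _).1 h')).2 rfl⟩
  · intro k hk
    exact (mem_badSet _ _).2 (main k ((mem_badSet _ _).1 hk)).1

open Classical in
noncomputable def lev {n γ : ℕ} (ι₀ : Equiv.Perm (Fin n × Fin γ)) (k : ℕ) :
    Finset (Equiv.Perm (Fin n × Fin γ)) := univ.filter fun π => (badSet (Mt ι₀ π)).card ≤ k

lemma mem_lev {n γ : ℕ} (ι₀ : Equiv.Perm (Fin n × Fin γ)) (k : ℕ) (π) :
    π ∈ lev ι₀ k ↔ (badSet (Mt ι₀ π)).card ≤ k := by simp [lev]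

lemma lev_succ {n γ K : ℕ} {ι₀ : Equiv.Perm (Fin n × Fin γ)} (h0 : FPF ι₀)
    (hN : K + 8 * (γ + 1) * γ < n * γ) (k : ℕ) (hk : k + 1 ≤ K) :
    (lev ι₀ (k+1)).card ≤ (n * γ) ^ 2 * (lev ι₀ k).card := by
  classical
  have hsub : lev ι₀ (k+1) ⊆ ((univ : Finset ((Fin n × Fin γ) × (Fin n × Fin γ))) ×ˢ lev ι₀ k).image
      (fun q => Equiv.swap q.1.1 q.1.2 * q.2) := by
    intro π hπ
    rw [mem_lev] at hπ
    have : ∃ a c, (badSet (Mt ι₀ (Equiv.swap a c * π))).card ≤ k := by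
      by_cases hp : (badSet (Mt ι₀ π)).card ≤ k
      · have : 0 < Fintype.card (Fin n × Fin γ) := by
          rw [Fintype.card_prod, Fintype.card_fin, Fintype.card_fin]
          exact Nat.lt_of_le_of_lt (Nat.zero_le _) hN
        obtain ⟨a⟩ := Fintype.card_pos_iff.1 this
        exact ⟨a, a, by rw [Equiv.swap_self]; exact hp⟩
      · obtain ⟨a, c, h⟩ := exists_switch h0 hN π (hπ.trans hk) (by omega)
        exact ⟨a, c, by omega⟩
    obtain ⟨a, c, h⟩ := this
    rw [Finset.mem_image]
    refine ⟨((a, c), Equiv.swap a c * π), by simp [mem_lev, h], ?_⟩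
    simp [← mul_assoc]
  refine (Finset.card_le_card hsub).trans (Finset.card_image_le.trans ?_)
  rw [Finset.card_product]
  simp [sq]

lemma lev_le {n γ K : ℕ} {ι₀ : Equiv.Perm (Fin n × Fin γ)} (h0 : FPF ι₀)
    (hN : K + 8 * (γ + 1) * γ < n * γ) : ∀ k ≤ K,
    (lev ι₀ k).card ≤ (n * γ) ^ (2 * k) * (lev ι₀ 0).card := by
  intro k
  induction k with
  | zero => intro _; simp
  | succ k ih =>
    intro hk
    refine (lev_succ h0 hN k hk).trans ?_
    refine (Nat.mul_le_mul_left _ (ih (by omega))).trans (le_of_eq ?_)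
    ring

/-- one-point probability -/
lemma prob_one {H : Type} [Fintype H] [DecidableEq H] {ι₀ : Equiv.Perm H} (h0 : FPF ι₀)
    (a b : H) (hab : b ≠ a) (hN : 2 ≤ Fintype.card H) :
    ev (fun π => if Mt ι₀ π a = b then (1:ℝ) else 0) ≤ 1 / (Fintype.card H - 1) := by
  have h1 : ∀ c, c ≠ a → ev (fun π => if Mt ι₀ π a = c then (1:ℝ) else 0) =
      ev (fun π => if Mt ι₀ π a = b then (1:ℝ) else 0) := by
    intro c hc
    rw [← ev_swap (fun π => if Mt ι₀ π a = c then (1:ℝ) else 0) (Equiv.swap b c)]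
    congr 1
    ext π
    rw [Mt_swap, Equiv.swap_apply_of_ne_of_ne hab.symm hc.symm]
    congr 1
    rw [eq_iff_iff, Equiv.swap_apply_eq_iff, Equiv.swap_apply_right]
  have h2 : ∑ c ∈ univ.erase a, ev (fun π => if Mt ι₀ π a = c then (1:ℝ) else 0) ≤ 1 := by
    rw [← ev_sum]
    apply ev_le_const
    intro π
    rw [Finset.sum_ite_eq]
    split_ifs <;> norm_num
  rw [Finset.sum_congr rfl fun c hc => h1 c (Finset.ne_of_mem_erase hc), Finset.sum_const,
    Finset.card_erase_of_mem (mem_univ a), card_univ, nsmul_eq_mul, Nat.cast_sub (by omega)] at h2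
  have : (2:ℝ) ≤ Fintype.card H := by exact_mod_cast hN
  rw [le_div_iff₀ (by linarith)]
  push_cast at h2
  linarith

lemma prob_two {H : Type} [Fintype H] [DecidableEq H] {ι₀ : Equiv.Perm H} (h0 : FPF ι₀)
    (a a' b b' : H) (haa : a ≠ a') (hab : b ≠ a) (hab2 : b ≠ a') (hb1 : b' ≠ a) (hb2 : b' ≠ a')
    (hb3 : b' ≠ b) (hN : 4 ≤ Fintype.card H) :
    ev (fun π => if Mt ι₀ π a = b ∧ Mt ι₀ π a' = b' then (1:ℝ) else 0) ≤
      1 / ((Fintype.card H - 1) * (Fintype.card H - 3)) := by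
  have h1 : ∀ c ∈ ((univ.erase a).erase a').erase b,
      ev (fun π => if Mt ι₀ π a = b ∧ Mt ι₀ π a' = c then (1:ℝ) else 0) =
      ev (fun π => if Mt ι₀ π a = b ∧ Mt ι₀ π a' = b' then (1:ℝ) else 0) := by
    intro c hc
    simp only [Finset.mem_erase, Finset.mem_univ, and_true] at hc
    obtain ⟨c1, c2, c3⟩ := hc
    rw [← ev_swap (fun π => if Mt ι₀ π a = b ∧ Mt ι₀ π a' = c then (1:ℝ) else 0) (Equiv.swap b' c)]
    congr 1
    ext π
    rw [Mt_swap, Mt_swap, Equiv.swap_apply_of_ne_of_ne hb1.symm c3.symm,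
      Equiv.swap_apply_of_ne_of_ne hb2.symm c2.symm]
    congr 1
    rw [eq_iff_iff, Equiv.swap_apply_eq_iff, Equiv.swap_apply_eq_iff, Equiv.swap_apply_right,
      Equiv.swap_apply_of_ne_of_ne hb3.symm c1.symm]
  have h2 : ∑ c ∈ ((univ.erase a).erase a').erase b,
      ev (fun π => if Mt ι₀ π a = b ∧ Mt ι₀ π a' = c then (1:ℝ) else 0) ≤
      ev (fun π => if Mt ι₀ π a = b then (1:ℝ) else 0) := by
    rw [← ev_sum]
    apply ev_mono
    intro π
    by_cases hb : Mt ι₀ π a = b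
    · simp only [hb, true_and, if_true]
      rw [Finset.sum_ite_eq]
      split_ifs <;> norm_num
    · simp [hb]
  have h3 := prob_one h0 a b hab (by omega)
  have hcard : (((univ.erase a).erase a').erase b : Finset H).card = Fintype.card H - 3 := by
    rw [Finset.card_erase_of_mem, Finset.card_erase_of_mem, Finset.card_erase_of_mem, card_univ]
    · omega
    · simp
    · simp [haa.symm]
    · simp [hab, hab2]
  rw [Finset.sum_congr rfl h1, Finset.sum_const, hcard, nsmul_eq_mul, Nat.cast_sub (by omega)] at h2
  have : (4:ℝ) ≤ Fintype.card H := by exact_mod_cast hN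
  rw [← div_div, le_div_iff₀ (by linarith)]
  push_cast at h2
  linarith

end RB

namespace RB

lemma ev_bad_one {n γ : ℕ} {ι₀ : Equiv.Perm (Fin n × Fin γ)} (h0 : FPF ι₀)
    (hN : 6 ≤ n * γ) (h : Fin n × Fin γ) [∀ π, Decidable (Bad (Mt ι₀ π) h)] :
    ev (fun π => if Bad (Mt ι₀ π) h then (1:ℝ) else 0) ≤
      (2 * γ + 4 * γ ^ 2) / (n * γ) := by
  classical
  have hcard : Fintype.card (Fin n × Fin γ) = n * γ := by simp
  have hcR : (Fintype.card (Fin n × Fin γ) : ℝ) = n * γ := by rw [hcard]; push_cast; ring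
  have hNR : (6:ℝ) ≤ n * γ := by exact_mod_cast hN
  set N : ℝ := n * γ with hNdef
  -- loops
  let L : Finset (Fin n × Fin γ) := univ.image fun i : Fin γ => (h.1, i)
  have hL : ∀ k, k ∈ L ↔ k.1 = h.1 := by
    intro k
    simp only [L, Finset.mem_image, mem_univ, true_and]
    constructor
    · rintro ⟨i, rfl⟩; rfl
    · intro e; exact ⟨k.2, by rw [← e]⟩
  have hLc : L.card ≤ γ := Finset.card_image_le.trans (by simp)
  have hLcR : (L.card : ℝ) ≤ γ := by exact_mod_cast hLc
  let f1 : Fin n × Fin γ → Equiv.Perm (Fin n × Fin γ) → ℝ := fun b π => if Mt ι₀ π h = b then 1 else 0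
  let f2 : Fin n × Fin γ → (Fin n × Fin γ) × Fin γ → Equiv.Perm (Fin n × Fin γ) → ℝ :=
    fun h' b π => if Mt ι₀ π h = b.1 ∧ Mt ι₀ π h' = (b.1.1, b.2) then 1 else 0
  let B : Finset ((Fin n × Fin γ) × Fin γ) := univ.filter fun b => b.1.1 ≠ h.1 ∧ (b.1.1, b.2) ≠ b.1
  have hBc : B.card ≤ n * γ * γ := (Finset.card_le_univ _).trans (by simp)
  have hBcR : (B.card : ℝ) ≤ N * γ := by
    rw [hNdef]; exact_mod_cast hBc
  have nn1 : ∀ b π, 0 ≤ f1 b π := fun b π => by simp only [f1]; split_ifs <;> norm_num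
  have nn2 : ∀ a b π, 0 ≤ f2 a b π := fun a b π => by simp only [f2]; split_ifs <;> norm_num
  have pt : ∀ π, (if Bad (Mt ι₀ π) h then (1:ℝ) else 0) ≤
      ∑ b ∈ L.erase h, f1 b π + ∑ h' ∈ L.erase h, ∑ b ∈ B, f2 h' b π := by
    intro π
    have hs1 : 0 ≤ ∑ b ∈ L.erase h, f1 b π := Finset.sum_nonneg fun b _ => nn1 b π
    have hs2 : 0 ≤ ∑ h' ∈ L.erase h, ∑ b ∈ B, f2 h' b π :=
      Finset.sum_nonneg fun a _ => Finset.sum_nonneg fun b _ => nn2 a b π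
    split_ifs with hb
    · by_cases hl : (Mt ι₀ π h).1 = h.1
      · have : f1 (Mt ι₀ π h) π ≤ ∑ b ∈ L.erase h, f1 b π :=
          Finset.single_le_sum (f := fun b => f1 b π) (fun b _ => nn1 b π)
            (Finset.mem_erase.2 ⟨(Mt_fpf h0 π).2 h, (hL _).2 hl⟩)
        have e : f1 (Mt ι₀ π h) π = 1 := by simp [f1]
        linarith
      · rcases hb with hb | ⟨h', q1, q2, q3⟩
        · exact absurd hb hl
        · have t1 : ∑ b ∈ B, f2 h' b π ≤ ∑ h' ∈ L.erase h, ∑ b ∈ B, f2 h' b π :=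
            Finset.single_le_sum (f := fun h' => ∑ b ∈ B, f2 h' b π)
              (fun a _ => Finset.sum_nonneg fun b _ => nn2 a b π)
              (Finset.mem_erase.2 ⟨q1, (hL _).2 q2⟩)
          have hm : ((Mt ι₀ π h), (Mt ι₀ π h').2) ∈ B := by
            simp only [B, Finset.mem_filter, mem_univ, true_and]
            refine ⟨hl, ?_⟩
            rw [← q3]
            intro e
            exact q1 ((Mt ι₀ π).injective e)
          have t2 : f2 h' ((Mt ι₀ π h), (Mt ι₀ π h').2) π ≤ ∑ b ∈ B, f2 h' b π :=
            Finset.single_le_sum (f := fun b => f2 h' b π) (fun b _ => nn2 h' b π) hm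
          have e : f2 h' ((Mt ι₀ π h), (Mt ι₀ π h').2) π = 1 := by
            simp only [f2]
            rw [if_pos]
            refine ⟨trivial, ?_⟩
            rw [← q3]
          linarith
    · linarith
  have c1 : ∀ b ∈ L.erase h, ev (f1 b) ≤ 1 / (N - 1) := by
    intro b hb
    have := prob_one h0 h b (Finset.ne_of_mem_erase hb) (by omega)
    rw [hcR] at this
    exact this
  have c2 : ∀ h' ∈ L.erase h, ∀ b ∈ B, ev (f2 h' b) ≤ 1 / ((N - 1) * (N - 3)) := by
    intro h' hh b hb
    simp only [B, Finset.mem_filter, mem_univ, true_and] at hb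
    obtain ⟨b1, b2⟩ := hb
    have e1 := (hL h').1 (Finset.mem_of_mem_erase hh)
    have := prob_two h0 h h' b.1 (b.1.1, b.2) (Finset.ne_of_mem_erase hh).symm
      (fun e => b1 (by rw [e])) (fun e => b1 (by rw [e, e1]))
      (fun e => b1 (by rw [← e])) (fun e => b1 (by rw [← e1, ← e])) b2 (by omega)
    rw [hcR] at this
    exact this
  have he : ((L.erase h).card : ℝ) ≤ γ :=
    le_trans (by exact_mod_cast Finset.card_erase_le) hLcR
  have p1 : 0 ≤ 1 / (N - 1) := by apply div_nonneg <;> linarith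
  have p2 : 0 ≤ 1 / ((N - 1) * (N - 3)) := by
    apply div_nonneg; norm_num; apply mul_nonneg <;> linarith
  calc ev (fun π => if Bad (Mt ι₀ π) h then (1:ℝ) else 0)
      ≤ ev (fun π => ∑ b ∈ L.erase h, f1 b π + ∑ h' ∈ L.erase h, ∑ b ∈ B, f2 h' b π) := ev_mono pt
    _ = ∑ b ∈ L.erase h, ev (f1 b) + ∑ h' ∈ L.erase h, ∑ b ∈ B, ev (f2 h' b) := by
        rw [ev_add, ev_sum, ev_sum]
        congr 1
        exact Finset.sum_congr rfl fun h' _ => ev_sum _ _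
    _ ≤ ∑ b ∈ L.erase h, 1 / (N - 1) + ∑ h' ∈ L.erase h, ∑ b ∈ B, 1 / ((N - 1) * (N - 3)) :=
        add_le_add (Finset.sum_le_sum c1) (Finset.sum_le_sum fun a ha => Finset.sum_le_sum (c2 a ha))
    _ = ((L.erase h).card : ℝ) * (1 / (N - 1)) +
        ((L.erase h).card : ℝ) * (B.card * (1 / ((N - 1) * (N - 3)))) := by
        simp only [Finset.sum_const, nsmul_eq_mul]
    _ ≤ γ * (1 / (N - 1)) + γ * ((N * γ) * (1 / ((N - 1) * (N - 3)))) := by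
        gcongr
    _ ≤ γ * (2 / N) + γ * ((N * γ) * (4 / N ^ 2)) := by
        have q1 : 1 / (N - 1) ≤ 2 / N := by
          rw [div_le_div_iff₀ (by linarith) (by linarith)]; linarith
        have q2 : 1 / ((N - 1) * (N - 3)) ≤ 4 / N ^ 2 := by
          rw [div_le_div_iff₀ (mul_pos (by linarith) (by linarith)) (by positivity)]; nlinarith
        gcongr
    _ = (2 * γ + 4 * γ ^ 2) / N := by
        field_simp

lemma ev_bad {n γ : ℕ} {ι₀ : Equiv.Perm (Fin n × Fin γ)} (h0 : FPF ι₀)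
    (hN : 6 ≤ n * γ) :
    ev (fun π => ((badSet (Mt ι₀ π)).card : ℝ)) ≤ 2 * γ + 4 * γ ^ 2 := by
  classical
  have : ∀ π, ((badSet (Mt ι₀ π)).card : ℝ) = ∑ h, if Bad (Mt ι₀ π) h then (1:ℝ) else 0 := by
    intro π
    simp [badSet]
  simp only [this]
  rw [ev_sum]
  refine (Finset.sum_le_sum fun h _ => ev_bad_one h0 hN h).trans ?_
  have hNR : (6:ℝ) ≤ n * γ := by exact_mod_cast hN
  simp only [Finset.sum_const, card_univ, Fintype.card_prod, Fintype.card_fin, nsmul_eq_mul]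
  push_cast
  rw [mul_div_cancel₀]
  linarith

/-- the constant K -/
def KK (γ : ℕ) : ℕ := 4 * γ + 8 * γ ^ 2

lemma card_simple_ge {n γ : ℕ} {ι₀ : Equiv.Perm (Fin n × Fin γ)} (h0 : FPF ι₀)
    (hN : 6 ≤ n * γ) (hN2 : KK γ + 8 * (γ + 1) * γ < n * γ) :
    (Fintype.card (Equiv.Perm (Fin n × Fin γ)) : ℝ) ≤
      2 * (n * γ : ℝ) ^ (2 * KK γ) * (lev ι₀ 0).card := by
  classical
  have h1 := ev_bad h0 hN
  have h2 : ev (fun π => (KK γ : ℝ) * (if π ∈ lev ι₀ (KK γ) then 0 else 1)) ≤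
      ev (fun π => ((badSet (Mt ι₀ π)).card : ℝ)) := by
    apply ev_mono
    intro π
    split_ifs with h
    · simp
    · rw [mem_lev, not_le] at h
      rw [mul_one]
      exact_mod_cast h.le
  rw [ev_mul] at h2
  have hKK : (KK γ : ℝ) = 2 * (2 * γ + 4 * γ ^ 2) := by simp [KK]; ring
  have hγ : 0 < γ := Nat.pos_of_ne_zero fun h => by simp [h] at hN
  have hγR : (0:ℝ) < γ := by exact_mod_cast hγ
  have h3 : ev (fun π => if π ∈ lev ι₀ (KK γ) then (0:ℝ) else 1) ≤ 1 / 2 := by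
    rw [hKK] at h2
    have hp : (0:ℝ) < 2 * γ + 4 * γ ^ 2 := by positivity
    nlinarith
  have h4 : ev (fun π => if π ∈ lev ι₀ (KK γ) then (0:ℝ) else 1) =
      1 - (lev ι₀ (KK γ)).card / Fintype.card (Equiv.Perm (Fin n × Fin γ)) := by
    have e : ∀ π, (if π ∈ lev ι₀ (KK γ) then (0:ℝ) else 1) =
      1 - (if π ∈ lev ι₀ (KK γ) then (1:ℝ) else 0) := fun π => by split_ifs <;> norm_num
    simp only [e]
    rw [ev_sub, ev_const]
    congr 1
    unfold ev
    simp
  have h5 := lev_le h0 hN2 (KK γ) le_rfl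
  have h5R : ((lev ι₀ (KK γ)).card : ℝ) ≤ (n * γ : ℝ) ^ (2 * KK γ) * (lev ι₀ 0).card := by
    exact_mod_cast h5
  have hc : (0:ℝ) < Fintype.card (Equiv.Perm (Fin n × Fin γ)) := by exact_mod_cast Fintype.card_pos
  rw [h4] at h3
  have h6 : (1:ℝ) / 2 ≤ (lev ι₀ (KK γ)).card / Fintype.card (Equiv.Perm (Fin n × Fin γ)) := by linarith
  rw [le_div_iff₀ hc] at h6
  nlinarith

end RB

namespace RB

lemma fpf_cycleType {H : Type} [Fintype H] [DecidableEq H] [Nonempty H] {M : Equiv.Perm H} (h : FPF M) :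
    M.cycleType = Multiset.replicate (Fintype.card H / 2) 2 := by
  have ho : orderOf M = 2 := by
    rw [orderOf_eq_prime_iff]
    refine ⟨?_, ?_⟩
    · ext x; simp [sq, h.1]
    · intro e
      obtain ⟨x⟩ := ‹Nonempty H›
      exact h.2 x (by rw [e]; rfl)
  obtain ⟨k, hk⟩ := Equiv.Perm.cycleType_prime_order (σ := M) (by rw [ho]; exact Nat.prime_two)
  have hs := M.sum_cycleType
  rw [hk, ho] at hs
  have hsup : M.support = univ := by
    ext x; simp [h.2 x]
  rw [hsup, card_univ] at hs
  simp at hs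
  rw [hk, ho]
  congr 1
  omega

lemma fpf_conj {H : Type} [Fintype H] [DecidableEq H] {ι₀ M : Equiv.Perm H} (h0 : FPF ι₀) (h : FPF M) :
    ∃ ρ, Mt ι₀ ρ = M := by
  rcases isEmpty_or_nonempty H with he | he
  · exact ⟨1, Subsingleton.elim _ _⟩
  · have : IsConj ι₀ M := by
      rw [Equiv.Perm.isConj_iff_cycleType_eq, fpf_cycleType h0, fpf_cycleType h]
    rw [isConj_iff] at this
    exact this

open Classical in
lemma card_conj {H : Type} [Fintype H] [DecidableEq H] {ι₀ M : Equiv.Perm H} (h0 : FPF ι₀) (h : FPF M) :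
    (univ.filter fun π => Mt ι₀ π = M).card = (univ.filter fun π => Mt ι₀ π = ι₀).card := by
  obtain ⟨ρ, rfl⟩ := fpf_conj h0 h
  symm
  refine Finset.card_bij (fun π _ => ρ * π) ?_ ?_ ?_
  · intro π hπ
    simp only [Finset.mem_filter, mem_univ, true_and] at hπ ⊢
    unfold Mt at hπ ⊢
    rw [mul_inv_rev]
    calc ρ * π * ι₀ * (π⁻¹ * ρ⁻¹) = ρ * (π * ι₀ * π⁻¹) * ρ⁻¹ := by group
      _ = _ := by rw [hπ]
  · intro a _ b _ hab
    exact mul_left_cancel hab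
  · intro π hπ
    refine ⟨ρ⁻¹ * π, ?_, by group⟩
    simp only [Finset.mem_filter, mem_univ, true_and] at hπ ⊢
    unfold Mt at hπ ⊢
    calc ρ⁻¹ * π * ι₀ * (ρ⁻¹ * π)⁻¹ = ρ⁻¹ * (π * ι₀ * π⁻¹) * ρ := by group
      _ = _ := by rw [hπ]; group

/-- `M` represents the simple graph `G` -/
def Rep {n γ : ℕ} (M : Equiv.Perm (Fin n × Fin γ)) (G : SimpleGraph (Fin n)) : Prop :=
  (∀ h, G.Adj h.1 (M h).1) ∧ ∀ h h', h.1 = h'.1 → (M h).1 = (M h').1 → h = h'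

/-- The set of regular graphs. -/
def Reg (n γ : ℕ) : Set (SimpleGraph (Fin n)) := {G | ∀ v, (G.neighborSet v).ncard = γ}

lemma rep_surj {n γ : ℕ} {M : Equiv.Perm (Fin n × Fin γ)} {G : SimpleGraph (Fin n)}
    (hR : Rep M G) (hG : G ∈ Reg n γ) {v w : Fin n} (hvw : G.Adj v w) : ∃ i, (M (v, i)).1 = w := by
  have hinj : Function.Injective (fun i : Fin γ => (M (v, i)).1) := by
    intro i j hij
    have := hR.2 (v, i) (v, j) rfl hij
    simpa using this
  have hsub : Set.range (fun i : Fin γ => (M (v, i)).1) ⊆ G.neighborSet v := by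
    rintro _ ⟨i, rfl⟩
    exact hR.1 (v, i)
  have hc : (Set.range (fun i : Fin γ => (M (v, i)).1)).ncard = γ := by
    rw [← Set.image_univ, Set.ncard_image_of_injective _ hinj, Set.ncard_univ]; simp
  have heq := Set.eq_of_subset_of_ncard_le hsub (by rw [hc, hG v]) (Set.toFinite _)
  have : w ∈ G.neighborSet v := hvw
  rw [← heq] at this
  exact this

lemma rep_unique {n γ : ℕ} {M : Equiv.Perm (Fin n × Fin γ)} {G G' : SimpleGraph (Fin n)}
    (hR : Rep M G) (hG : G ∈ Reg n γ) (hR' : Rep M G') (hG' : G' ∈ Reg n γ) : G = G' := by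
  ext v w
  constructor
  · intro h
    obtain ⟨i, rfl⟩ := rep_surj hR hG h
    exact hR'.1 (v, i)
  · intro h
    obtain ⟨i, rfl⟩ := rep_surj hR' hG' h
    exact hR.1 (v, i)

lemma rep_exists {n γ : ℕ} {M : Equiv.Perm (Fin n × Fin γ)} (hM : FPF M) (hb : ∀ h, ¬ Bad M h) :
    ∃ G ∈ Reg n γ, Rep M G := by
  let G : SimpleGraph (Fin n) :=
    { Adj := fun v w => ∃ i, (M (v, i)).1 = w
      symm := by
        refine ⟨?_⟩
        rintro v w ⟨i, hi⟩
        refine ⟨(M (v, i)).2, ?_⟩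
        have : (w, (M (v, i)).2) = M (v, i) := by rw [← hi]
        rw [this, hM.1]
      loopless := by
        refine ⟨?_⟩
        rintro v ⟨i, hi⟩
        exact hb (v, i) (Or.inl hi) }
  have h2 : ∀ h h' : Fin n × Fin γ, h.1 = h'.1 → (M h).1 = (M h').1 → h = h' := by
    intro h h' e1 e2
    by_contra hne
    exact hb h' (Or.inr ⟨h, hne, e1, e2⟩)
  refine ⟨G, ?_, fun h => ⟨h.2, rfl⟩, h2⟩
  intro v
  have hinj : Function.Injective (fun i : Fin γ => (M (v, i)).1) := by
    intro i j hij
    have := h2 (v, i) (v, j) rfl hij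
    simpa using this
  have : G.neighborSet v = Set.range (fun i : Fin γ => (M (v, i)).1) := by
    ext w; exact Iff.rfl
  rw [this, ← Set.image_univ, Set.ncard_image_of_injective _ hinj, Set.ncard_univ]; simp

/-- labelling to matching -/
lemma lab_inv {n γ : ℕ} {G : SimpleGraph (Fin n)} (φ : ∀ v, Fin γ ≃ G.neighborSet v) :
    Function.Involutive (fun h : Fin n × Fin γ =>
      (((φ h.1 h.2 : G.neighborSet h.1) : Fin n),
        (φ (φ h.1 h.2 : Fin n)).symm ⟨h.1, (φ h.1 h.2).2.symm⟩)) := by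
  rintro ⟨v, i⟩
  have key : ∀ v' (_ : v' = v) (p : (φ v i : Fin n) ∈ G.neighborSet v'),
      (φ v').symm ⟨(φ v i : Fin n), p⟩ = i := by
    intro v' hv p
    subst hv
    simp
  refine Prod.ext ?_ ?_
  · simp
  · exact key _ (by simp) _

def labM {n γ : ℕ} {G : SimpleGraph (Fin n)} (φ : ∀ v, Fin γ ≃ G.neighborSet v) :
    Equiv.Perm (Fin n × Fin γ) := (lab_inv φ).toPerm

lemma labM_fst {n γ : ℕ} {G : SimpleGraph (Fin n)} (φ : ∀ v, Fin γ ≃ G.neighborSet v) (h) :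
    (labM φ h).1 = φ h.1 h.2 := rfl

lemma labM_spec {n γ : ℕ} {G : SimpleGraph (Fin n)} (φ : ∀ v, Fin γ ≃ G.neighborSet v) :
    FPF (labM φ) ∧ Rep (labM φ) G := by
  refine ⟨⟨lab_inv φ, ?_⟩, ?_, ?_⟩
  · intro x hx
    have h1 : (labM φ x).1 = x.1 := by rw [hx]
    rw [labM_fst] at h1
    have := (φ x.1 x.2).2
    rw [h1] at this
    exact G.loopless.irrefl _ this
  · intro h
    rw [labM_fst]
    exact (φ h.1 h.2).2
  · rintro ⟨v, i⟩ ⟨v', i'⟩ e1 e2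
    simp only at e1
    subst e1
    rw [labM_fst, labM_fst] at e2
    have := (φ v).injective (Subtype.ext e2)
    exact Prod.ext rfl this

lemma lab_exists {n γ : ℕ} {M : Equiv.Perm (Fin n × Fin γ)} {G : SimpleGraph (Fin n)}
    (hM : FPF M) (hR : Rep M G) (hG : G ∈ Reg n γ) :
    ∃ φ : ∀ v, Fin γ ≃ G.neighborSet v, labM φ = M := by
  have hb : ∀ v, Function.Bijective (fun i : Fin γ => (⟨(M (v, i)).1, hR.1 (v, i)⟩ : G.neighborSet v)) := by
    intro v
    refine ⟨?_, ?_⟩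
    · intro i j hij
      have := hR.2 (v, i) (v, j) rfl (congrArg Subtype.val hij)
      simpa using this
    · rintro ⟨w, hw⟩
      obtain ⟨i, hi⟩ := rep_surj hR hG hw
      exact ⟨i, Subtype.ext hi⟩
  let φ : ∀ v, Fin γ ≃ G.neighborSet v := fun v => Equiv.ofBijective _ (hb v)
  have hφ : ∀ v i, ((φ v i : G.neighborSet v) : Fin n) = (M (v, i)).1 := fun v i => rfl
  refine ⟨φ, ?_⟩
  have h1 : ∀ h, (labM φ h).1 = (M h).1 := fun h => hφ h.1 h.2
  ext1 h
  apply hR.2 _ _ (h1 h)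
  rw [hM.1, ← h1, (labM_spec φ).1.1]

lemma labM_inj {n γ : ℕ} {G : SimpleGraph (Fin n)} {φ ψ : ∀ v, Fin γ ≃ G.neighborSet v}
    (h : labM φ = labM ψ) : φ = ψ := by
  funext v
  ext i
  have := congrArg (fun M : Equiv.Perm (Fin n × Fin γ) => ((M (v, i)).1 : ℕ)) h
  exact this

open Classical in
lemma card_M {n γ : ℕ} {G : SimpleGraph (Fin n)} (hG : G ∈ Reg n γ) :
    (univ.filter fun M : Equiv.Perm (Fin n × Fin γ) => FPF M ∧ Rep M G).card = (γ.factorial) ^ n := by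
  have h1 : (univ.filter fun M : Equiv.Perm (Fin n × Fin γ) => FPF M ∧ Rep M G) =
      univ.image (fun φ : ∀ v, Fin γ ≃ G.neighborSet v => labM φ) := by
    ext M
    simp only [Finset.mem_filter, mem_univ, true_and, Finset.mem_image]
    constructor
    · rintro ⟨a, b⟩
      exact lab_exists a b hG
    · rintro ⟨φ, rfl⟩
      exact labM_spec φ
  rw [h1, Finset.card_image_of_injective _ (fun φ ψ h => labM_inj h), card_univ, Fintype.card_pi]
  have : ∀ v, Fintype.card (Fin γ ≃ G.neighborSet v) = γ.factorial := by
    intro v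
    have hc : Fintype.card (Fin γ) = Fintype.card (G.neighborSet v) := by
      rw [Fintype.card_fin, ← Nat.card_eq_fintype_card]
      exact (hG v).symm
    rw [Fintype.card_equiv (Fintype.equivOfCardEq hc), Fintype.card_fin]
  simp [this]

open Classical in
lemma card_fib {n γ : ℕ} {ι₀ : Equiv.Perm (Fin n × Fin γ)} (h0 : FPF ι₀) {G : SimpleGraph (Fin n)}
    (hG : G ∈ Reg n γ) :
    (univ.filter fun π => Rep (Mt ι₀ π) G).card =
      (γ.factorial) ^ n * (univ.filter fun π => Mt ι₀ π = ι₀).card := by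
  rw [← card_M hG]
  rw [Finset.card_eq_sum_card_fiberwise (f := fun π => Mt ι₀ π)
    (t := univ.filter fun M : Equiv.Perm (Fin n × Fin γ) => FPF M ∧ Rep M G)]
  · rw [Finset.sum_const_nat]
    intro M hM
    simp only [Finset.mem_filter, mem_univ, true_and] at hM
    rw [← card_conj h0 hM.1]
    congr 1
    ext π
    simp only [Finset.mem_filter, mem_univ, true_and]
    constructor
    · exact fun h => h.2
    · intro h; exact ⟨by rw [h]; exact hM.2, h⟩
  · intro π hπ
    simp only [Finset.coe_filter, mem_univ, true_and, Set.mem_ofPred_eq] at hπ ⊢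
    exact ⟨Mt_fpf h0 π, hπ⟩

open Classical in
/-- transfer from configuration model to uniform regular graphs -/
lemma transfer {n γ : ℕ} {ι₀ : Equiv.Perm (Fin n × Fin γ)} (h0 : FPF ι₀) (B : Set (SimpleGraph (Fin n)))
    (Q : Equiv.Perm (Fin n × Fin γ) → Prop)
    (hQ : ∀ π, ∀ G ∈ Reg n γ, Rep (Mt ι₀ π) G → G ∉ B → Q π) (hpos : 0 < (lev ι₀ 0).card) :
    1 - ((univ.filter Q).card : ℝ) / (lev ι₀ 0).card ≤ probUniform (Reg n γ) B ∧
      probUniform (Reg n γ) B ≤ 1 := by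
  set C := (γ.factorial) ^ n * (univ.filter fun π => Mt ι₀ π = ι₀).card with hC
  let A : Finset (SimpleGraph (Fin n)) := univ.filter fun G => G ∈ Reg n γ
  let F : SimpleGraph (Fin n) → Finset (Equiv.Perm (Fin n × Fin γ)) := fun G =>
    univ.filter fun π => Rep (Mt ι₀ π) G
  have hA : ∀ G, G ∈ A ↔ G ∈ Reg n γ := by intro G; simp [A]
  -- covering
  have h1 : (lev ι₀ 0).card ≤ A.card * C := by
    have hsub : lev ι₀ 0 ⊆ A.biUnion F := by
      intro π hπ
      rw [mem_lev, Nat.le_zero, Finset.card_eq_zero] at hπ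
      obtain ⟨G, hG, hR⟩ := rep_exists (Mt_fpf h0 π) (fun h hb => by
        have := (mem_badSet _ _).2 hb
        rw [hπ] at this
        simp at this)
      rw [Finset.mem_biUnion]
      exact ⟨G, (hA G).2 hG, by simp [F, hR]⟩
    refine (Finset.card_le_card hsub).trans (Finset.card_biUnion_le.trans (le_of_eq ?_))
    rw [Finset.sum_const_nat]
    intro G hG
    exact card_fib h0 ((hA G).1 hG)
  have h2 : (A.filter fun G => G ∉ B).card * C ≤ (univ.filter Q).card := by
    have : ((A.filter fun G => G ∉ B).biUnion F).card = (A.filter fun G => G ∉ B).card * C := by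
      rw [Finset.card_biUnion, Finset.sum_const_nat]
      · intro G hG
        exact card_fib h0 ((hA G).1 (Finset.mem_filter.1 hG).1)
      · intro G hG G' hG' hne
        change Disjoint (F G) (F G')
        rw [Finset.disjoint_left]
        intro π hπ hπ'
        simp only [F, Finset.mem_filter, mem_univ, true_and] at hπ hπ'
        exact hne (rep_unique hπ ((hA G).1 (Finset.mem_filter.1 hG).1) hπ'
          ((hA G').1 (Finset.mem_filter.1 hG').1))
    rw [← this]
    apply Finset.card_le_card
    intro π hπ
    rw [Finset.mem_biUnion] at hπ
    obtain ⟨G, hG, hπ⟩ := hπ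
    simp only [F, Finset.mem_filter, mem_univ, true_and] at hG hπ ⊢
    exact hQ π G ((hA G).1 hG.1) hπ hG.2
  have e1 : (Reg n γ).ncard = A.card := by
    rw [← Set.ncard_coe_finset]; congr 1; ext G; simp [A]
  have e2 : (Reg n γ ∩ B).ncard = (A.filter fun G => G ∈ B).card := by
    rw [← Set.ncard_coe_finset]; congr 1; ext G; simp [A]
  have e3 := Finset.card_filter_add_card_filter_not (s := A) (fun G => G ∈ B)
  unfold probUniform
  rw [e1, e2]
  have hApos : 0 < A.card := by
    rcases Nat.eq_zero_or_pos A.card with h | h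
    · rw [h] at h1; omega
    · exact h
  have hCpos : 0 < C := by
    rcases Nat.eq_zero_or_pos C with h | h
    · rw [h] at h1; omega
    · exact h
  have hAR : (0:ℝ) < A.card := by exact_mod_cast hApos
  have hCR : (0:ℝ) < C := by exact_mod_cast hCpos
  have hLR : (0:ℝ) < (lev ι₀ 0).card := by exact_mod_cast hpos
  have h1R : ((lev ι₀ 0).card : ℝ) ≤ A.card * C := by exact_mod_cast h1
  have h2R : ((A.filter fun G => G ∉ B).card : ℝ) * C ≤ (univ.filter Q).card := by exact_mod_cast h2
  have e3R : ((A.filter fun G => G ∈ B).card : ℝ) + (A.filter fun G => G ∉ B).card = A.card := by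
    exact_mod_cast e3
  constructor
  · have : ((A.filter fun G => G ∈ B).card : ℝ) / A.card =
      1 - ((A.filter fun G => G ∉ B).card : ℝ) / A.card := by
      rw [eq_sub_iff_add_eq, ← add_div, e3R, div_self hAR.ne']
    rw [this]
    apply sub_le_sub_left
    calc ((A.filter fun G => G ∉ B).card : ℝ) / A.card
        = ((A.filter fun G => G ∉ B).card : ℝ) * C / (A.card * C) := by field_simp
      _ ≤ (univ.filter Q).card / (lev ι₀ 0).card := by
          gcongr
  · rw [div_le_one hAR]
    have : (0:ℝ) ≤ (A.filter fun G => G ∉ B).card := by positivity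
    linarith

end RB

namespace RB

open Classical in
lemma sum_rep {n γ : ℕ} {M : Equiv.Perm (Fin n × Fin γ)} {G : SimpleGraph (Fin n)}
    (hR : Rep M G) (hG : G ∈ Reg n γ) (u v : Fin n → ℝ) :
    ∑ i, ∑ j, (if G.Adj i j then u i * v j else 0) = ∑ h : Fin n × Fin γ, u h.1 * v (M h).1 := by
  rw [Fintype.sum_prod_type]
  refine Finset.sum_congr rfl fun i _ => ?_
  rw [← Finset.sum_filter]
  symm
  refine Finset.sum_bij (fun (k : Fin γ) _ => (M (i, k)).1) ?_ ?_ ?_ ?_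
  · intro k _
    simp only [Finset.mem_filter, mem_univ, true_and]
    exact hR.1 (i, k)
  · intro k _ k' _ e
    have := hR.2 (i, k) (i, k') rfl e
    simpa using this
  · intro j hj
    simp only [Finset.mem_filter, mem_univ, true_and] at hj
    obtain ⟨k, hk⟩ := rep_surj hR hG hj
    exact ⟨k, mem_univ _, hk⟩
  · intro k _; rfl

lemma cut_rep {n γ : ℕ} {M : Equiv.Perm (Fin n × Fin γ)} {G : SimpleGraph (Fin n)}
    (hR : Rep M G) (hG : G ∈ Reg n γ) (S : Finset (Fin n)) (s : Fin n → ℝ)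
    (hs : ∀ i, s i = if i ∈ S then 1 else -1) :
    (cutSize G S : ℝ) = (n * γ - ∑ h : Fin n × Fin γ, s h.1 * s (M h).1) / 4 := by
  classical
  have h1 : (cutSize G S : ℝ) =
      ∑ i, ∑ j, (if G.Adj i j then ((1 + s i) / 2) * ((1 - s j) / 2) else 0) := by
    unfold cutSize
    push_cast
    rw [← Finset.sum_filter_add_sum_filter_not univ (fun i => i ∈ S)]
    have z : ∑ i with i ∉ S, ∑ j, (if G.Adj i j then ((1 + s i) / 2) * ((1 - s j) / 2) else 0) = 0 := by
      refine Finset.sum_eq_zero fun i hi => Finset.sum_eq_zero fun j _ => ?_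
      simp only [Finset.mem_filter, mem_univ, true_and] at hi
      rw [hs i, if_neg hi]; simp
    rw [z, add_zero]
    have f : (univ.filter fun i => i ∈ S) = S := by ext; simp
    rw [f]
    refine Finset.sum_congr rfl fun i hi => ?_
    have f2 : Sᶜ = univ.filter fun j => j ∉ S := by ext; simp
    rw [f2, Finset.sum_filter]
    refine Finset.sum_congr rfl fun j _ => ?_
    rw [hs i, if_pos hi, hs j]
    by_cases hj : j ∈ S <;> by_cases ha : G.Adj i j <;> simp [hj, ha]
  rw [h1, sum_rep hR hG (fun i => (1 + s i) / 2) (fun j => (1 - s j) / 2)]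
  have h2 : ∑ h : Fin n × Fin γ, s (M h).1 = ∑ h : Fin n × Fin γ, s h.1 :=
    Equiv.sum_comp M (fun h => s h.1)
  have h3 : ∀ h : Fin n × Fin γ, (1 + s h.1) / 2 * ((1 - s (M h).1) / 2) =
      (1 + s h.1 - s (M h).1 - s h.1 * s (M h).1) / 4 := fun h => by ring
  simp only [h3]
  rw [← Finset.sum_div, Finset.sum_sub_distrib, Finset.sum_sub_distrib, Finset.sum_add_distrib, h2]
  simp

lemma bis_iff {n : ℕ} (hn : Even n) (S : Finset (Fin n)) (σ : Fin n → Bool)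
    (hσ : ∀ i, σ i = true ↔ i ∈ S) : IsBisection S ↔ ∑ i, spin (σ i) = 0 := by
  have h1 := sum_spin_int σ
  have h2 : (univ.filter fun i => σ i = true) = S := by ext i; simp [hσ]
  rw [h2] at h1
  rw [h1, sub_eq_zero]
  obtain ⟨k, hk⟩ := hn
  unfold IsBisection
  constructor
  · rintro ⟨a, b⟩
    have : 2 * S.card = n := by omega
    exact_mod_cast this
  · intro h
    have : 2 * S.card = n := by exact_mod_cast h
    omega

lemma XX_eq {n γ : ℕ} (π) (σ : Bal n) (hγ : 0 < γ) :
    ∑ h : Fin n × Fin γ, spin (σ.1 h.1) * spin (σ.1 (Mt (iota n γ) π h).1) =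
      2 * Real.sqrt γ * XX n γ π σ := by
  have : 0 < Real.sqrt γ := Real.sqrt_pos.2 (by exact_mod_cast hγ)
  unfold XX Xh ff sp
  field_simp

lemma mcut_eq {n γ : ℕ} (hn : Even n) (hγ : 0 < γ) {G : SimpleGraph (Fin n)} (π)
    (hR : Rep (Mt (iota n γ) π) G) (hG : G ∈ Reg n γ) :
    (mcut G : ℝ) = n * γ / 4 - Real.sqrt γ / 2 * (⨆ σ, XX n γ π σ) := by
  classical
  have : Nonempty (Bal n) := Bal_nonempty hn
  have hpos : 0 < Real.sqrt γ := Real.sqrt_pos.2 (by exact_mod_cast hγ)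
  have cut : ∀ σ : Bal n, (cutSize G (univ.filter fun i => σ.1 i = true) : ℝ) =
      n * γ / 4 - Real.sqrt γ / 2 * XX n γ π σ := by
    intro σ
    rw [cut_rep hR hG _ (fun i => spin (σ.1 i)) (by intro i; simp [spin]), XX_eq π σ hγ]
    ring
  have bis : ∀ σ : Bal n, IsBisection (univ.filter fun i => σ.1 i = true) := by
    intro σ
    rw [bis_iff hn _ σ.1 (by simp)]
    exact σ.2
  apply le_antisymm
  · obtain ⟨σ, hσ⟩ := exists_sup (fun σ => XX n γ π σ)
    rw [hσ, ← cut σ]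
    have : mcut G ≤ cutSize G (univ.filter fun i => σ.1 i = true) :=
      Nat.sInf_le ⟨_, bis σ, rfl⟩
    exact_mod_cast this
  · have hne : {k : ℕ | ∃ S : Finset (Fin n), IsBisection S ∧ cutSize G S = k}.Nonempty := by
      obtain ⟨σ⟩ := ‹Nonempty (Bal n)›
      exact ⟨_, _, bis σ, rfl⟩
    obtain ⟨S, hS, hc⟩ := Nat.sInf_mem hne
    let σ : Bal n := ⟨fun i => decide (i ∈ S), (bis_iff hn S _ (by simp)).1 hS⟩
    have e : (univ.filter fun i => σ.1 i = true) = S := by ext i; simp [σ]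
    have hm : (mcut G : ℝ) = cutSize G S := by
      rw [hc]; rfl
    rw [hm]
    have := cut σ
    rw [e] at this
    rw [this]
    have := le_sup (fun σ => XX n γ π σ) σ
    have := mul_le_mul_of_nonneg_left this (by positivity : 0 ≤ Real.sqrt γ / 2)
    linarith

lemma F_lip {n γ : ℕ} (hn : Even n) :
    PermLip (fun π => ⨆ σ, XX n γ π σ) (4 * (Real.sqrt γ)⁻¹) := by
  have : Nonempty (Bal n) := Bal_nonempty hn
  intro x y π
  apply abs_sup_sub_le
  intro σ
  exact abs_Xh_swap (iota_fpf hn γ) (by positivity) (fun σ h => by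
    unfold sp; rw [abs_spin]) x y π σ

open Classical in
lemma dev_card {n γ : ℕ} (hn : Even n) (hγ : 0 < γ) {ε : ℝ} (hε : 0 < ε) :
    ((univ.filter fun π => ε * n < |(⨆ σ, XX n γ π σ) - ev (fun π => ⨆ σ, XX n γ π σ)|).card : ℝ) ≤
      2 * Real.exp (-(ε ^ 2 / 128 * n)) * Fintype.card (Equiv.Perm (Fin n × Fin γ)) := by
  have h := perm_tail (F_lip (γ := γ) hn) (s := ε / 64) (r := ε * n) (by positivity)
    (fun π => ε * n < |(⨆ σ, XX n γ π σ) - ev (fun π => ⨆ σ, XX n γ π σ)|) (fun π h => h.le)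
  have hc : (0:ℝ) < Fintype.card (Equiv.Perm (Fin n × Fin γ)) := by exact_mod_cast Fintype.card_pos
  have e : 2 * (ε / 64) ^ 2 * (4 * (Real.sqrt γ)⁻¹) ^ 2 * (Fintype.card (Fin n × Fin γ) : ℝ)
      - ε / 64 * (ε * n) = -(ε ^ 2 / 128 * n) := by
    have hs : Real.sqrt γ ^ 2 = γ := Real.sq_sqrt (by positivity)
    have hγR : (0:ℝ) < γ := by exact_mod_cast hγ
    rw [Fintype.card_prod, Fintype.card_fin, Fintype.card_fin, mul_pow, inv_pow, hs]
    push_cast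
    field_simp
    ring
  rw [e] at h
  unfold ev at h
  rw [div_le_iff₀ hc] at h
  refine le_trans (le_of_eq ?_) h
  rw [Finset.sum_boole]
  rfl

theorem main {Pstar : ℝ}
    (hP : Tendsto (fun n : ℕ =>
        (n : ℝ)⁻¹ * ∫ J, (⨆ σ : Fin n → Bool, -HSK n J σ) ∂(skMeasure n))
      atTop (nhds Pstar)) (ε : ℝ) (hε : 0 < ε) : ∃ γ₀ : ℕ, ∀ γ : ℕ, γ ≥ γ₀ →
      Tendsto (fun n : ℕ =>
          probUniform (Reg n γ)
            {G : SimpleGraph (Fin n) |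
              |(mcut G : ℝ) / n - ((γ : ℝ) / 4 - Pstar * Real.sqrt ((γ : ℝ) / 4))|
                ≤ ε * Real.sqrt (γ : ℝ)})
        (atTop ⊓ Filter.principal {n : ℕ | Even n ∧ γ < n}) (nhds 1) := by
  classical
  set β : ℝ := 4 / ε with hβ
  have hβpos : 0 < β := by positivity
  set c : ℝ := 8 * (1 + 202 * β + 48 * β ^ 2) / ε with hc
  have hcpos : 0 < c := by positivity
  obtain ⟨γ₀, hγ₀⟩ := exists_nat_ge (c ^ 2)
  refine ⟨γ₀ + 1, fun γ hγ => ?_⟩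
  have hγpos : 0 < γ := by omega
  have hγR : (0:ℝ) < γ := by exact_mod_cast hγpos
  have hsγ : c ≤ Real.sqrt γ := by
    apply Real.le_sqrt_of_sq_le
    have : (γ₀ : ℝ) ≤ γ := by exact_mod_cast (by omega : γ₀ ≤ γ)
    linarith
  have hspos : 0 < Real.sqrt γ := lt_of_lt_of_le hcpos hsγ
  have hcmp : 2 * ((1 + 202 * β + 48 * β ^ 2) / Real.sqrt γ) + β⁻¹ ≤ ε / 2 := by
    have h1 : (1 + 202 * β + 48 * β ^ 2) / Real.sqrt γ ≤ ε / 8 := by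
      rw [div_le_iff₀ hspos]
      have : ε / 8 * c = 1 + 202 * β + 48 * β ^ 2 := by rw [hc]; field_simp
      nlinarith
    have h2 : β⁻¹ = ε / 4 := by rw [hβ, inv_div]
    linarith
  set l := atTop ⊓ Filter.principal {n : ℕ | Even n ∧ γ < n} with hl
  have hlat : l ≤ atTop := inf_le_left
  have hev : ∀ᶠ n : ℕ in l, Even n ∧ γ < n := by
    rw [hl, eventually_inf_principal]; exact Eventually.of_forall fun n h => h
  have hle : l ≤ atTop ⊓ Filter.principal {n : ℕ | Even n} :=
    inf_le_inf_left _ (Filter.principal_mono.2 fun n h => h.1)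
  have hSK := (SK_bal_tendsto hP).mono_left hle
  have hSK2 : ∀ᶠ n : ℕ in l, |(n:ℝ)⁻¹ * ∫ J, (⨆ σ : Bal n, Gp (cc n) J σ) ∂gm (Fin n × Fin n) - Pstar|
      ≤ ε / 2 := by
    have := (Metric.tendsto_nhds.1 hSK) (ε / 2) (by positivity)
    filter_upwards [this] with n hn
    rw [Real.dist_eq] at hn
    exact hn.le
  have hbig : ∀ᶠ n : ℕ in l, KK γ + 8 * (γ + 1) * γ + 6 < n :=
    hlat (eventually_gt_atTop _)
  set b : ℝ := ε ^ 2 / 128 with hb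
  have hbpos : 0 < b := by positivity
  -- error term
  have herr : Tendsto (fun n : ℕ => 1 - 4 * (n * γ : ℝ) ^ (2 * KK γ) * Real.exp (-(b * n))) l (nhds 1) := by
    have t1 : Tendsto (fun n : ℕ => b * (n:ℝ)) atTop atTop :=
      Tendsto.const_mul_atTop hbpos tendsto_natCast_atTop_atTop
    have t2 := (Real.tendsto_pow_mul_exp_neg_atTop_nhds_zero (2 * KK γ)).comp t1
    have t3 := (t2.const_mul (4 * (γ / b) ^ (2 * KK γ))).const_sub 1
    rw [mul_zero, sub_zero] at t3
    refine (t3.congr fun n => ?_).mono_left hlat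
    simp only [Function.comp_apply]
    rw [← mul_assoc, mul_assoc 4, ← mul_pow]
    congr 4
    field_simp
  have hmain : ∀ᶠ n : ℕ in l, 1 - 4 * (n * γ : ℝ) ^ (2 * KK γ) * Real.exp (-(b * n)) ≤
      probUniform (Reg n γ) {G : SimpleGraph (Fin n) |
              |(mcut G : ℝ) / n - ((γ : ℝ) / 4 - Pstar * Real.sqrt ((γ : ℝ) / 4))|
                ≤ ε * Real.sqrt (γ : ℝ)} ∧ probUniform (Reg n γ) {G : SimpleGraph (Fin n) |
              |(mcut G : ℝ) / n - ((γ : ℝ) / 4 - Pstar * Real.sqrt ((γ : ℝ) / 4))|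
                ≤ ε * Real.sqrt (γ : ℝ)} ≤ 1 := by
    filter_upwards [hev, hSK2, hbig] with n hn1 hn2 hn3
    obtain ⟨hne, hnγ⟩ := hn1
    have hn0 : 0 < n := by omega
    have hnR : (0:ℝ) < n := by exact_mod_cast hn0
    have hN1 : n ≤ n * γ := Nat.le_mul_of_pos_right _ hγpos
    have h0 := iota_fpf hne γ
    have hcs := card_simple_ge h0 (by omega) (by omega)
    have hNf : (0:ℝ) < Fintype.card (Equiv.Perm (Fin n × Fin γ)) := by exact_mod_cast Fintype.card_pos
    have hlev : 0 < (lev (iota n γ) 0).card := by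
      rcases Nat.eq_zero_or_pos (lev (iota n γ) 0).card with h | h
      · rw [h] at hcs; simp at hcs
      · exact h
    have hlevR : (0:ℝ) < (lev (iota n γ) 0).card := by exact_mod_cast hlev
    have hdev := dev_card (γ := γ) hne hγpos hε
    set F : Equiv.Perm (Fin n × Fin γ) → ℝ := fun π => ⨆ σ, XX n γ π σ with hF
    have hmean : |ev F - n * Pstar| ≤ ε * n := by
      have h1 := compare_sup hne hn0 hγpos hβpos
      have h2 : (n:ℝ) * (2 * ((1 + 202 * β + 48 * β ^ 2) / Real.sqrt γ) + β⁻¹) ≤ n * (ε / 2) :=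
        mul_le_mul_of_nonneg_left hcmp hnR.le
      set I := ∫ J, (⨆ σ : Bal n, Gp (cc n) J σ) ∂gm (Fin n × Fin n) with hI
      have h3 : |I - n * Pstar| ≤ n * (ε / 2) := by
        have e : I - n * Pstar = n * ((n:ℝ)⁻¹ * I - Pstar) := by field_simp
        rw [e, abs_mul, abs_of_pos hnR]
        exact mul_le_mul_of_nonneg_left hn2 hnR.le
      have h4 : |ev F - n * Pstar| ≤ |ev F - I| + |I - n * Pstar| := abs_sub_le _ _ _
      have h5 : |ev F - I| ≤ n * (ε / 2) := h1.trans h2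
      linarith
    have htr := transfer h0 {G : SimpleGraph (Fin n) |
              |(mcut G : ℝ) / n - ((γ : ℝ) / 4 - Pstar * Real.sqrt ((γ : ℝ) / 4))|
                ≤ ε * Real.sqrt (γ : ℝ)} (fun π => ε * n < |F π - ev F|) (by
      intro π G hG hR hGB
      have hm := mcut_eq hne hγpos π hR hG
      by_contra hcon
      rw [not_lt] at hcon
      apply hGB
      change |(mcut G : ℝ) / n - ((γ : ℝ) / 4 - Pstar * Real.sqrt ((γ : ℝ) / 4))|
                ≤ ε * Real.sqrt (γ : ℝ)
      have hs4 : Real.sqrt ((γ:ℝ) / 4) = Real.sqrt γ / 2 := by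
        rw [Real.sqrt_div hγR.le, show (4:ℝ) = 2 ^ 2 by norm_num, Real.sqrt_sq (by norm_num)]
      have e : (mcut G : ℝ) / n - ((γ : ℝ) / 4 - Pstar * Real.sqrt ((γ : ℝ) / 4)) =
          -(Real.sqrt γ / (2 * n)) * (F π - n * Pstar) := by
        rw [hm, hs4, hF]
        field_simp
        ring
      have h6 : |F π - n * Pstar| ≤ |F π - ev F| + |ev F - n * Pstar| := abs_sub_le _ _ _
      have h7 : |F π - n * Pstar| ≤ 2 * ε * n := by linarith
      rw [e, abs_mul, abs_neg, abs_of_pos (by positivity)]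
      calc Real.sqrt γ / (2 * n) * |F π - n * Pstar| ≤ Real.sqrt γ / (2 * n) * (2 * ε * n) :=
            mul_le_mul_of_nonneg_left h7 (by positivity)
        _ = ε * Real.sqrt γ := by field_simp) hlev
    refine ⟨le_trans ?_ htr.1, htr.2⟩
    apply sub_le_sub_left
    rw [div_le_iff₀ hlevR]
    refine hdev.trans ?_
    calc 2 * Real.exp (-(b * n)) * (Fintype.card (Equiv.Perm (Fin n × Fin γ)) : ℝ)
        ≤ 2 * Real.exp (-(b * n)) * (2 * (n * γ : ℝ) ^ (2 * KK γ) * (lev (iota n γ) 0).card) :=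
          mul_le_mul_of_nonneg_left hcs (by positivity)
      _ = _ := by ring
  exact tendsto_of_tendsto_of_tendsto_of_le_of_le' herr tendsto_const_nhds
    (hmain.mono fun n h => h.1) (hmain.mono fun n h => h.2)

end RB

/-- **Minimum bisection of random regular graphs.**
If `P_*` is the limit of `n⁻¹ E[max_σ (-H^SK_n(σ))]` (which exists by the Parisi
formula), then for every `ε > 0` there is an integer `γ₀` such that for every
integer `γ ≥ γ₀`, the minimum bisection of a uniformly random simple `γ`-regular
graph on `n` vertices satisfies, w.h.p. as `n → ∞` along even `n > γ`,
`mcut(R_n(γ))/n = γ/4 − P_* √(γ/4) + o_γ(√γ)`. -/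
theorem min_bisection_regular
    (Pstar : ℝ)
    (hP : Tendsto (fun n : ℕ =>
        (n : ℝ)⁻¹ * ∫ J, (⨆ σ : Fin n → Bool, -HSK n J σ) ∂(skMeasure n))
      atTop (nhds Pstar)) :
    ∀ ε > (0 : ℝ), ∃ γ₀ : ℕ, ∀ γ : ℕ, γ ≥ γ₀ →
      Tendsto (fun n : ℕ =>
          probUniform {G : SimpleGraph (Fin n) | ∀ v, (G.neighborSet v).ncard = γ}
            {G : SimpleGraph (Fin n) |
              |(mcut G : ℝ) / n - ((γ : ℝ) / 4 - Pstar * Real.sqrt ((γ : ℝ) / 4))|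
                ≤ ε * Real.sqrt (γ : ℝ)})
        (atTop ⊓ Filter.principal {n : ℕ | Even n ∧ γ < n}) (nhds 1) := by
  exact fun ε hε => RB.main hP ε hε
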